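/- arXiv:1906.06964 — 2 statements merged into one kernel-verified Lean document; each statement's English description precedes it below -/
import Mathlib

section
/- Let N be a lattice-count family, and for each (g,n) with 2g−2+n ≥ 1 let W̃_{g,n} : (ℂ∖{0,1,−1})ⁿ → ℂ be a holomorphic function that agrees on the punctured unit polydisc {z : 0 < |zᵢ| < 1} with the sum of the series ∑_{b∈ℕⁿ} N_{g,n}(b)·∏ᵢ [bᵢ]·zᵢ^{bᵢ−1}; set W̃_{0,2}(u,v) := 1/(u−v)² + 1/(u·v). Then for every (g,n) with 2g−2+n ≥ 1 and all z₁,…,zₙ ∈ ℂ∖{0,1,−1} there exists ε₀ > 0 such that for every ε ∈ (0,ε₀): W̃_{g,n}(z₁,…,zₙ) = (1/(2πi))·∑_{α∈{1,−1}} ∮_{C(α,ε)} (1/(z₁−z) + L_α(z)/z₁)·(z/(1−z²)²)·B(z) dz, where B(z) := W̃_{g−1,n+1}(z, 1/z, z₂,…,zₙ) (this term omitted when g = 0) + ∑ W̃_{g₁,|I|+1}(z, z_I)·W̃_{g₂,|J|+1}(1/z, z_J), the last sum being over ordered pairs (g₁,I), (g₂,J) with g₁+g₂ = g, I and J disjoint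 with I ∪ J = {2,…,n}, omitting exactly the terms with (g₁,|I|+1) = (0,1) or (g₂,|J|+1) = (0,1); any factor with indices (g',n') = (0,2) denotes the explicit function W̃_{0,2} above (in particular W̃_{0,2}(z,1/z) = z²/(z²−1)² + 1 and W̃_{0,2}(z,z_j) = 1/(z−z_j)² + 1/(z·z_j)). -/
open scoped BigOperators

/-- `[b] = b` for positive `b` and `[0] = 1`. -/
def br (b : ℕ) : ℕ := if b = 0 then 1 else b

/-- A lattice-count family: symmetric quasi-polynomial functions `N g α : (α → ℕ) → ℚ`
(with `n = card α`), vanishing on odd total parity, with the Do–Norbury base cases and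
combinatorial recursion. -/
structure LatticeCountFamily : Type 1 where
  N : (g : ℕ) → (α : Type) → [Fintype α] → [DecidableEq α] → (α → ℕ) → ℚ
  symm : ∀ (g : ℕ) (α β : Type) [Fintype α] [DecidableEq α] [Fintype β] [DecidableEq β]
      (e : α ≃ β) (b : β → ℕ), N g α (b ∘ e) = N g β b
  odd_vanish : ∀ (g : ℕ) (α : Type) [Fintype α] [DecidableEq α],
      3 ≤ 2 * g + Fintype.card α → ∀ b : α → ℕ, Odd (∑ a, b a) → N g α b = 0
  quasipoly : ∀ (g : ℕ) (α : Type) [Fintype α] [DecidableEq α],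
      3 ≤ 2 * g + Fintype.card α → ∀ ε : α → ℕ,
        ∃ P : MvPolynomial α ℚ, ∀ b : α → ℕ, (∀ a, b a % 2 = ε a) →
          N g α b = MvPolynomial.eval (fun a => (b a : ℚ) ^ 2) P
  base_zero_three : ∀ b : Fin 3 → ℕ,
      N 0 (Fin 3) b = if Even (b 0 + b 1 + b 2) then 1 else 0
  base_one_one : ∀ b : Fin 1 → ℕ,
      N 1 (Fin 1) b = if Even (b 0) then ((b 0 : ℚ) ^ 2 + 20) / 48 else 0
  recursion : ∀ (g : ℕ) (α : Type) [Fintype α] [DecidableEq α],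
      4 ≤ 2 * g + Fintype.card α → ∀ b : α → ℕ,
      (∑ i, (b i : ℚ)) * N g α b =
        (1 / 2) * (∑ i, ∑ j ∈ Finset.univ.filter (fun j => j ≠ i),
          ∑ p ∈ Finset.range (b i + b j + 1),
            (if Even (b i + b j - p) then
              (br p : ℚ) * ((b i + b j - p : ℕ) : ℚ) *
                N g (Option {a : α // a ≠ i ∧ a ≠ j})
                  (fun x => Option.elim x p (fun a => b a.1))
             else 0))
        + (1 / 2) * (∑ i, ∑ p ∈ Finset.range (b i + 1), ∑ q ∈ Finset.range (b i - p + 1),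
            (if Even (b i - p - q) then
              (br p : ℚ) * (br q : ℚ) * ((b i - p - q : ℕ) : ℚ) *
                ((if g = 0 then 0 else
                    N (g - 1) (Option (Option {a : α // a ≠ i}))
                      (fun x => Option.elim x p
                        (fun y => Option.elim y q (fun a => b a.1))))
                  + ∑ g₁ ∈ Finset.range (g + 1),
                      ∑ I ∈ (Finset.univ : Finset {a : α // a ≠ i}).powerset,
                        (if 3 ≤ 2 * g₁ + (I.card + 1) ∧ 3 ≤ 2 * (g - g₁) + (Iᶜ.card + 1) then
                          N g₁ (Option {x : {a : α // a ≠ i} // x ∈ I})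
                            (fun x => Option.elim x p (fun a => b a.1.1)) *
                          N (g - g₁) (Option {x : {a : α // a ≠ i} // x ∈ Iᶜ})
                            (fun x => Option.elim x q (fun a => b a.1.1))
                         else 0))
             else 0))

/-- The subtuple of `z` indexed by the finite set `I`, in increasing index order. -/
def restr {n : ℕ} (z : Fin n → ℂ) (I : Finset (Fin n)) : Fin I.card → ℂ :=
  fun j => z ((I.orderIsoOfFin rfl j : {x // x ∈ I}) : Fin n)

/-- `extW W` agrees with `W` except that any factor with `(g, n) = (0, 2)`
denotes the explicit function `W̃₀,₂(u,v) = 1/(u-v)² + 1/(u·v)`. -/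
noncomputable def extW (W : (g n : ℕ) → (Fin n → ℂ) → ℂ) (g n : ℕ)
    (z : Fin n → ℂ) : ℂ :=
  if h : g = 0 ∧ n = 2 then
    1 / (z ⟨0, by omega⟩ - z ⟨1, by omega⟩) ^ 2 +
      1 / (z ⟨0, by omega⟩ * z ⟨1, by omega⟩)
  else W g n z

/-- The bracketed term `B(z)` of the topological recursion:
`W̃_{g-1,n+1}(z, 1/z, z₂,…,zₙ)` (omitted when `g = 0`) plus the sum over stable
ordered splittings `(g₁, I), (g₂, J)` of `W̃_{g₁,|I|+1}(z, z_I)·W̃_{g₂,|J|+1}(1/z, z_J)`,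
omitting exactly the terms containing a `(0,1)` factor, with `(0,2)` factors given
by the explicit `W̃₀,₂`.  Here `zs : Fin m → ℂ` records the variables `z₂,…,zₙ`
(so `n = m + 1`). -/
noncomputable def recursionBracket (W : (g n : ℕ) → (Fin n → ℂ) → ℂ)
    (g m : ℕ) (zs : Fin m → ℂ) (z : ℂ) : ℂ :=
  (if g = 0 then 0 else
    extW W (g - 1) (m + 2) (Fin.cons z (Fin.cons z⁻¹ zs)))
  + ∑ g₁ ∈ Finset.range (g + 1),
      ∑ I ∈ (Finset.univ : Finset (Fin m)).powerset,
        if ¬(g₁ = 0 ∧ I.card = 0) ∧ ¬(g - g₁ = 0 ∧ Iᶜ.card = 0) then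
          extW W g₁ (I.card + 1) (Fin.cons z (restr zs I)) *
            extW W (g - g₁) (Iᶜ.card + 1) (Fin.cons z⁻¹ (restr zs Iᶜ))
        else 0

open Polynomial in
noncomputable def pm : ℕ → Polynomial ℂ
  | 0 => X
  | (m+1) => derivative (pm m) * (X ^ 2 - X)

noncomputable def linq (q : Polynomial ℂ) (t : ℕ) : ℂ :=
  q.sum fun k c => c * ((t + k).choose k : ℂ)

lemma linq_add (p q : Polynomial ℂ) (t : ℕ) : linq (p + q) t = linq p t + linq q t := by
  unfold linq
  apply Polynomial.sum_add_index <;> intros <;> ring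

lemma linq_monomial (k : ℕ) (c : ℂ) (t : ℕ) :
    linq (Polynomial.monomial k c) t = c * ((t + k).choose k : ℂ) := by
  unfold linq
  apply Polynomial.sum_monomial_index; ring

lemma linq_hasSum (q : Polynomial ℂ) {r : ℂ} (hr : ‖r‖ < 1) :
    HasSum (fun t : ℕ => linq q t * r ^ t) ((Polynomial.X * q).eval (1 / (1 - r))) := by
  induction q using Polynomial.induction_on' with
  | add p q hp hq =>
    simp only [linq_add, add_mul, mul_add, Polynomial.eval_add]
    exact hp.add hq
  | monomial k c =>
    have h := (hasSum_choose_mul_geometric_of_norm_lt_one k hr).mul_left c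
    simp only [linq_monomial]
    have e : (Polynomial.X * Polynomial.monomial k c).eval (1 / (1 - r)) = c * (1 / (1 - r) ^ (k + 1)) := by
      rw [Polynomial.eval_mul, Polynomial.eval_X, Polynomial.eval_monomial, one_div, one_div, ← inv_pow]; ring
    rw [e]
    simpa only [mul_assoc] using h

open Polynomial in
lemma linq_theta (q : Polynomial ℂ) (t : ℕ) :
    (t : ℂ) * linq q t = linq (derivative (X * q) * (X - 1)) t := by
  induction q using Polynomial.induction_on' with
  | add p q hp hq =>
    simp only [linq_add, mul_add, add_mul, derivative_add, hp, hq]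
  | monomial k c =>
    have e : derivative (X * monomial k c : Polynomial ℂ) * (X - 1)
        = monomial (k+1) ((k+1 : ℂ) * c) + monomial k (-((k+1 : ℂ) * c)) := by
      simp only [← C_mul_X_pow_eq_monomial]
      have : (X * (C c * X ^ k) : Polynomial ℂ) = C c * X ^ (k+1) := by ring
      rw [this]
      simp [derivative_X_pow]
      ring
    rw [e, linq_add, linq_monomial, linq_monomial, linq_monomial]
    have h1 : ((k + 1 : ℕ) : ℂ) * ((t + (k+1)).choose (k+1) : ℂ) = ((t + k + 1 : ℕ):ℂ) * ((t + k).choose k : ℂ) := by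
      have := Nat.add_one_mul_choose_eq (t+k) k
      rw [show t + (k+1) = t + k + 1 by ring]
      have h2 : (k+1) * (t+k+1).choose (k+1) = (t+k+1) * (t+k).choose k := by rw [this]; ring
      exact_mod_cast h2
    push_cast at h1
    linear_combination (-c) * h1

open Polynomial in
lemma pm_form (m : ℕ) : ∃ q : Polynomial ℂ, pm m = X * q ∧ ∀ t : ℕ, (t : ℂ) ^ m = linq q t := by
  induction m with
  | zero => 
    refine ⟨1, by simp [pm], fun t => ?_⟩
    rw [show (1 : Polynomial ℂ) = monomial 0 1 by simp, linq_monomial]; simp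
  | succ m ih =>
    obtain ⟨q, hq, ht⟩ := ih
    refine ⟨derivative (X * q) * (X - 1), ?_, fun t => ?_⟩
    · rw [pm, hq]; ring
    · rw [← linq_theta, ← ht]; ring

lemma pm_hasSum (m : ℕ) {r : ℂ} (hr : ‖r‖ < 1) :
    HasSum (fun t : ℕ => (t : ℂ) ^ m * r ^ t) ((pm m).eval (1 / (1 - r))) := by
  obtain ⟨q, hq, ht⟩ := pm_form m
  simp only [hq, ht]
  exact linq_hasSum q hr

open Polynomial in
lemma pm_comp (m : ℕ) : (pm (m+1)).comp (1 - X) = (-1) ^ m * pm (m+1) := by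
  induction m with
  | zero => simp [pm]; ring
  | succ m ih =>
    rw [pm, mul_comp]
    have h := congrArg derivative ih
    rw [derivative_comp] at h
    have h2 : derivative ((-1) ^ m * pm (m+1) : Polynomial ℂ) = (-1)^m * derivative (pm (m+1)) := by
      rw [show ((-1) ^ m : Polynomial ℂ) = C ((-1)^m) by simp, derivative_C_mul]
    rw [h2] at h
    simp at h
    simp
    rw [show (derivative (pm (m+1))).comp (1 - X) = - ((-1)^m * derivative (pm (m+1))) by rw [← h]; ring]
    ring

/-- the coordinate v -/
noncomputable def vv (α z : ℂ) : ℂ := 1 / (1 - α * z)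

lemma vv_inv {α z : ℂ} (hα : α ^ 2 = 1) (hz : z ≠ 0) (hza : z ≠ α) : vv α z⁻¹ = 1 - vv α z := by
  have hα0 : α ≠ 0 := by rintro rfl; norm_num at hα
  have h1 : 1 - α * z ≠ 0 := by
    intro h; apply hza
    linear_combination (-α) * h + (-z) * hα
  have h2 : z - α ≠ 0 := sub_ne_zero.2 hza
  unfold vv
  rw [show 1 - α * z⁻¹ = (z - α) / z by field_simp]
  rw [one_div_div, eq_sub_iff_add_eq, div_add_div _ _ h2 h1, div_eq_one_iff_eq (mul_ne_zero h2 h1)]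
  linear_combination (-z) * hα

lemma pm_inv (m : ℕ) {α z : ℂ} (hα : α ^ 2 = 1) (hz : z ≠ 0) (hza : z ≠ α) :
    (pm (m+1)).eval (vv α z⁻¹) = (-1) ^ m * (pm (m+1)).eval (vv α z) := by
  have := congrArg (Polynomial.eval (vv α z)) (pm_comp m)
  rw [vv_inv hα hz hza]
  simpa [Polynomial.eval_comp] using this

lemma one_sub_ne {α z : ℂ} (hα : α ^ 2 = 1) (hza : z ≠ α) : 1 - α * z ≠ 0 := by
  intro h; apply hza
  linear_combination (-α) * h + (-z) * hα

lemma vv_hasDerivAt {α z : ℂ} (hα : α ^ 2 = 1) (hza : z ≠ α) :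
    HasDerivAt (vv α) (α * vv α z ^ 2) z := by
  have h1 := one_sub_ne hα hza
  have : HasDerivAt (fun z => 1 - α * z) (-α) z := by
    simpa using ((hasDerivAt_id z).const_mul α).const_sub 1
  have h := this.inv h1
  unfold vv
  simp only [one_div]
  refine h.congr_deriv ?_
  rw [inv_pow]; ring

lemma vv_eq {α z : ℂ} (hα : α ^ 2 = 1) : vv α z = -α * (z - α)⁻¹ := by
  have hα0 : α ≠ 0 := by rintro rfl; norm_num at hα
  have : 1 - α * z = -α * (z - α) := by linear_combination -hα
  rw [vv, this, one_div, mul_inv]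
  congr 1
  field_simp
  linear_combination hα

lemma pm_hasDerivAt (m : ℕ) {α z : ℂ} (hα : α ^ 2 = 1) (hz : z ≠ 0) (hza : z ≠ α) :
    HasDerivAt (fun z => (pm m).eval (vv α z)) ((pm (m+1)).eval (vv α z) / z) z := by
  have h := ((pm m).hasDerivAt (vv α z)).comp z (vv_hasDerivAt hα hza)
  have h1 := one_sub_ne hα hza
  refine h.congr_deriv ?_
  rw [pm]
  simp only [Polynomial.eval_mul, Polynomial.eval_sub, Polynomial.eval_pow, Polynomial.eval_X]
  rw [mul_div_assoc]
  congr 1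
  unfold vv
  field_simp
  ring

lemma ne_of_sphere {α z : ℂ} {ε : ℝ} (hε : 0 < ε) (hz : z ∈ Metric.sphere α ε) : z ≠ α := by
  rintro rfl; simp at hz; linarith

lemma vv_pow_integral {α : ℂ} (hα : α ^ 2 = 1) {ε : ℝ} (hε : 0 < ε) (j : ℕ) :
    (∮ z in C(α, ε), vv α z ^ (j + 1)) = if j = 0 then -α * (2 * Real.pi * Complex.I) else 0 := by
  have e : ∀ z, vv α z ^ (j+1) = (-α) ^ (j+1) * (z - α) ^ (-((j:ℤ)+1)) := by
    intro z
    rw [vv_eq hα, mul_pow, inv_pow, zpow_neg]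
    norm_cast
  simp only [e]
  rw [circleIntegral.integral_const_mul]
  split_ifs with hj
  · subst hj
    simp only [Nat.cast_zero, zero_add, zpow_neg, zpow_one, pow_one]
    rw [circleIntegral.integral_sub_center_inv _ hε.ne']
  · rw [circleIntegral.integral_sub_zpow_of_ne (by omega)]; simp

lemma vv_contOn {α : ℂ} (hα : α ^ 2 = 1) {ε : ℝ} (hε : 0 < ε) :
    ContinuousOn (vv α) (Metric.sphere α ε) := fun z hz =>
  (vv_hasDerivAt hα (ne_of_sphere hε hz)).continuousAt.continuousWithinAt

lemma vv_key {α z z₁ : ℂ} (h1 : 1 - α * z ≠ 0) (h2 : 1 - α * z₁ ≠ 0) (h3 : z₁ - z ≠ 0) :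
    vv α z * (1 / (z₁ - z)) = vv α z₁ * (1 / (z₁ - z)) - α * vv α z₁ * vv α z := by
  have : vv α z = vv α z₁ - α * (z₁ - z) * vv α z * vv α z₁ := by
    have e1 : vv α z * (1 - α * z) = 1 := by unfold vv; rw [one_div, inv_mul_cancel₀ h1]
    have e2 : vv α z₁ * (1 - α * z₁) = 1 := by unfold vv; rw [one_div, inv_mul_cancel₀ h2]
    linear_combination vv α z₁ * e1 - vv α z * e2
  rw [mul_one_div, mul_one_div, div_eq_iff h3, sub_mul, div_mul_cancel₀ _ h3]
  linear_combination this

lemma vv_proj {α : ℂ} (hα : α ^ 2 = 1) {ε : ℝ} (hε : 0 < ε) {z₁ : ℂ} (hz₁ : z₁ ∉ Metric.closedBall α ε)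
    (j : ℕ) :
    (∮ z in C(α, ε), vv α z ^ (j + 1) * (1 / (z₁ - z))) = 2 * Real.pi * Complex.I * vv α z₁ ^ (j+1) := by
  have hza : z₁ ≠ α := by rintro rfl; exact hz₁ (by simp [hε.le])
  have hne : ∀ z ∈ Metric.closedBall α ε, z₁ - z ≠ 0 := fun z hz h => hz₁ (by rwa [sub_eq_zero.1 h])
  have hcont : ∀ j : ℕ, ContinuousOn (fun z => vv α z ^ j * (1 / (z₁ - z))) (Metric.sphere α ε) := by
    intro j
    apply ((vv_contOn hα hε).pow j).mul
    apply ContinuousOn.div continuousOn_const (by fun_prop)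
    intro z hz; exact hne z (Metric.sphere_subset_closedBall hz)
  have key : ∀ j : ℕ, (∮ z in C(α, ε), vv α z ^ (j + 1) * (1 / (z₁ - z))) =
      vv α z₁ * (∮ z in C(α, ε), vv α z ^ j * (1 / (z₁ - z))) - α * vv α z₁ * ∮ z in C(α, ε), vv α z ^ (j + 1) := by
    intro j
    rw [← circleIntegral.integral_const_mul, ← circleIntegral.integral_const_mul,
      ← circleIntegral.integral_sub]
    · apply circleIntegral.integral_congr hε.le
      intro z hz
      have h1 := one_sub_ne hα (ne_of_sphere hε hz)
      have h2 := one_sub_ne hα hza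
      have h3 := hne z (Metric.sphere_subset_closedBall hz)
      have h4 := vv_key h1 h2 h3
      simp only
      rw [pow_succ]
      linear_combination (vv α z ^ j) * h4
    · exact (continuousOn_const.mul (hcont j)).circleIntegrable hε.le
    · exact (continuousOn_const.mul ((vv_contOn hα hε).pow _)).circleIntegrable hε.le
  induction j with
  | zero =>
    rw [key, vv_pow_integral hα hε]
    have : (∮ z in C(α, ε), vv α z ^ 0 * (1 / (z₁ - z))) = 0 := by
      apply Complex.circleIntegral_eq_zero_of_differentiable_on_off_countable hε.le Set.countable_empty
      · simp only [pow_zero, one_mul]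
        apply ContinuousOn.div continuousOn_const (by fun_prop) hne
      · intro z hz
        simp only [pow_zero, one_mul]
        apply DifferentiableAt.div (by fun_prop) (by fun_prop)
        exact hne z (Metric.ball_subset_closedBall hz.1)
    rw [this]; simp; linear_combination (2 * Real.pi * Complex.I * vv α z₁) * hα
  | succ j ih =>
    rw [key, ih, vv_pow_integral hα hε]; simp; ring

lemma vv_proj_poly {α : ℂ} (hα : α ^ 2 = 1) {ε : ℝ} (hε : 0 < ε) {z₁ : ℂ} (hz₁ : z₁ ∉ Metric.closedBall α ε)
    (q : Polynomial ℂ) :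
    (∮ z in C(α, ε), (Polynomial.X * q).eval (vv α z) * (1 / (z₁ - z))) =
      2 * Real.pi * Complex.I * (Polynomial.X * q).eval (vv α z₁) := by
  have hne : ∀ z ∈ Metric.closedBall α ε, z₁ - z ≠ 0 := fun z hz h => hz₁ (by rwa [sub_eq_zero.1 h])
  have hcont : ∀ q : Polynomial ℂ, CircleIntegrable (fun z => q.eval (vv α z) * (1 / (z₁ - z))) α ε := by
    intro j
    apply ContinuousOn.circleIntegrable hε.le
    apply (j.continuous.comp_continuousOn (vv_contOn hα hε)).mul
    apply ContinuousOn.div continuousOn_const (by fun_prop)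
    intro z hz; exact hne z (Metric.sphere_subset_closedBall hz)
  induction q using Polynomial.induction_on' with
  | add p q hp hq =>
    simp only [mul_add, Polynomial.eval_add, add_mul]
    rw [circleIntegral.integral_add (hcont _) (hcont _), hp, hq]
  | monomial k c =>
    have := vv_proj hα hε hz₁ k
    have e : ∀ z, (Polynomial.X * Polynomial.monomial k c).eval (vv α z) = c * vv α z ^ (k+1) := by
      intro z; rw [Polynomial.eval_mul, Polynomial.eval_X, Polynomial.eval_monomial]; ring
    simp only [e, mul_assoc]
    rw [circleIntegral.integral_const_mul, this]; ring

def XX (z : ℂ) : Prop := z ≠ 0 ∧ z ≠ 1 ∧ z ≠ -1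

lemma XX.inv {z : ℂ} (h : XX z) : XX z⁻¹ := by
  refine ⟨inv_ne_zero h.1, fun e => h.2.1 ?_, fun e => h.2.2 ?_⟩
  · rwa [inv_eq_one] at e
  · rw [← inv_inv z, e]; norm_num

lemma circ_zero {f : ℂ → ℂ} {c : ℂ} {r : ℝ} (hr : 0 ≤ r)
    (h : ∀ z ∈ Metric.closedBall c r, DifferentiableAt ℂ f z) : (∮ z in C(c, r), f z) = 0 :=
  Complex.circleIntegral_eq_zero_of_differentiable_on_off_countable hr Set.countable_empty
    (fun z hz => (h z hz).continuousAt.continuousWithinAt)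
    (fun z hz => h z (Metric.ball_subset_closedBall hz.1))

lemma pm_diff (m : ℕ) {α z : ℂ} (hα : α ^ 2 = 1) (hza : z ≠ α) :
    DifferentiableAt ℂ (fun z => (pm m).eval (vv α z)) z :=
  (pm m).differentiable.differentiableAt.comp z (vv_hasDerivAt hα hza).differentiableAt

/-- generating function of the basis sequence -/
noncomputable def psiB (α : ℂ) (m : ℕ) (z : ℂ) : ℂ :=
  (pm (m+1)).eval (vv α z) + if m = 0 then 1 else 0

lemma pm_div_eq (m : ℕ) {α z : ℂ} (hα : α ^ 2 = 1) (hz : z ≠ 0) (hza : z ≠ α) :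
    (pm (m+1)).eval (vv α z) / z =
     (Polynomial.X * (Polynomial.derivative (pm m) * Polynomial.C α * Polynomial.X)).eval (vv α z) := by
  rw [pm]
  simp only [Polynomial.eval_mul, Polynomial.eval_sub, Polynomial.eval_pow, Polynomial.eval_X, Polynomial.eval_C]
  have e1 : vv α z * (1 - α * z) = 1 := by
    unfold vv; rw [one_div, inv_mul_cancel₀ (one_sub_ne hα hza)]
  rw [div_eq_iff hz]
  linear_combination ((Polynomial.eval (vv α z) (Polynomial.derivative (pm m))) * vv α z) * e1

lemma inv_pm_integral {α : ℂ} (hα : α ^ 2 = 1) {ε : ℝ} (hε : 0 < ε) (hε1 : ε < 1) (m : ℕ) :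
    (∮ z in C(α, ε), (pm m).eval (vv α z) / z) = if m = 0 then -(2 * Real.pi * Complex.I) else 0 := by
  have h0 : ∀ z ∈ Metric.closedBall α ε, z ≠ 0 := by
    rintro z hz rfl
    have : ‖α‖ = 1 := by
      have := congrArg norm hα
      rw [norm_pow, norm_one] at this
      exact (pow_eq_one_iff_of_nonneg (norm_nonneg _) two_ne_zero).1 this
    simp [this] at hz; linarith
  rcases m with _ | m
  · have e : ∀ z ∈ Metric.sphere α ε, (pm 0).eval (vv α z) / z = z⁻¹ + α * vv α z ^ (0+1) := by
      intro z hz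
      have hz0 := h0 z (Metric.sphere_subset_closedBall hz)
      have e1 : vv α z * (1 - α * z) = 1 := by
        unfold vv; rw [one_div, inv_mul_cancel₀ (one_sub_ne hα (ne_of_sphere hε hz))]
      simp only [pm, Polynomial.eval_X, zero_add, pow_one]
      rw [div_eq_iff hz0, add_mul, inv_mul_cancel₀ hz0]
      linear_combination e1
    rw [circleIntegral.integral_congr hε.le e, circleIntegral.integral_add,
      circleIntegral.integral_const_mul, vv_pow_integral hα hε, circ_zero hε.le]
    · simp; linear_combination (2 * Real.pi * Complex.I) * hα
    · intro z hz; exact differentiableAt_inv (h0 z hz)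
    · refine ContinuousOn.circleIntegrable hε.le (continuousOn_id.inv₀ ?_)
      intro z hz; exact h0 z (Metric.sphere_subset_closedBall hz)
    · exact (continuousOn_const.mul ((vv_contOn hα hε).pow _)).circleIntegrable hε.le
  · simp only [Nat.add_eq_zero_iff, one_ne_zero, and_false, if_false]
    apply circleIntegral.integral_eq_zero_of_hasDerivWithinAt hε.le
    intro z hz
    exact (pm_hasDerivAt m hα (h0 z (Metric.sphere_subset_closedBall hz)) (ne_of_sphere hε hz)).hasDerivWithinAt

lemma psiB_proj {α : ℂ} (hα : α ^ 2 = 1) {ε : ℝ} (hε : 0 < ε) (hε1 : ε < 1) {z₁ : ℂ} (hz10 : z₁ ≠ 0)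
    (hz₁ : z₁ ∉ Metric.closedBall α ε) (L : ℂ → ℂ) (hL : ∀ z ∈ Metric.closedBall α ε, HasDerivAt L z⁻¹ z)
    (m : ℕ) :
    (∮ z in C(α, ε), (1 / (z₁ - z) + L z / z₁) * (psiB α m z / z)) =
      2 * Real.pi * Complex.I * (psiB α m z₁ / z₁) := by
  have hn : ‖α‖ = 1 := by
    have := congrArg norm hα
    rw [norm_pow, norm_one] at this
    exact (pow_eq_one_iff_of_nonneg (norm_nonneg _) two_ne_zero).1 this
  have h0 : ∀ z ∈ Metric.closedBall α ε, z ≠ 0 := by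
    rintro z hz rfl
    simp [hn] at hz; linarith
  have hne : ∀ z ∈ Metric.closedBall α ε, z₁ - z ≠ 0 := fun z hz h => hz₁ (by rwa [sub_eq_zero.1 h])
  have hs := Metric.sphere_subset_closedBall (x := α) (ε := ε)
  have hza : z₁ ≠ α := by rintro rfl; exact hz₁ (by simp [hε.le])
  set δ : ℂ := if m = 0 then 1 else 0 with hδ
  set q := Polynomial.derivative (pm m) * Polynomial.C α * Polynomial.X with hq
  have cL : ContinuousOn L (Metric.sphere α ε) := fun z hz => (hL z (hs hz)).continuousAt.continuousWithinAt
  have cz : ContinuousOn (fun z : ℂ => z) (Metric.sphere α ε) := continuousOn_id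
  have cp : ∀ p : Polynomial ℂ, ContinuousOn (fun z => p.eval (vv α z)) (Metric.sphere α ε) := fun p =>
    p.continuous.comp_continuousOn (vv_contOn hα hε)
  have cpz : ContinuousOn (fun z => (pm (m+1)).eval (vv α z) / z) (Metric.sphere α ε) :=
    (cp _).div cz fun z hz => h0 z (hs hz)
  have cpz' : ContinuousOn (fun z => (pm m).eval (vv α z) / z) (Metric.sphere α ε) :=
    (cp _).div cz fun z hz => h0 z (hs hz)
  have c1 : ContinuousOn (fun z => 1 / (z₁ - z)) (Metric.sphere α ε) :=
    continuousOn_const.div (by fun_prop) fun z hz => hne z (hs hz)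
  have I1 : (∮ z in C(α, ε), (pm (m+1)).eval (vv α z) / z * (1 / (z₁ - z))) =
      2 * Real.pi * Complex.I * ((pm (m+1)).eval (vv α z₁) / z₁) := by
    rw [pm_div_eq m hα hz10 hza, ← vv_proj_poly hα hε hz₁]
    apply circleIntegral.integral_congr hε.le
    intro z hz
    simp only
    rw [pm_div_eq m hα (h0 z (hs hz)) (ne_of_sphere hε hz)]
  have I2 : (∮ z in C(α, ε), L z * ((pm (m+1)).eval (vv α z) / z)) = 2 * Real.pi * Complex.I * δ := by
    have hh : (∮ z in C(α, ε), (z⁻¹ * (pm m).eval (vv α z) + L z * ((pm (m+1)).eval (vv α z) / z))) = 0 := by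
      apply circleIntegral.integral_eq_zero_of_hasDerivWithinAt hε.le
      intro z hz
      exact ((hL z (hs hz)).mul (pm_hasDerivAt m hα (h0 z (hs hz)) (ne_of_sphere hε hz))).hasDerivWithinAt
    have e : ∀ z, z⁻¹ * (pm m).eval (vv α z) = (pm m).eval (vv α z) / z := fun z => by rw [mul_comm]; rfl
    simp only [e] at hh
    have cLp : ContinuousOn (fun z => L z * ((pm (m+1)).eval (vv α z) / z)) (Metric.sphere α ε) := cL.mul cpz
    rw [circleIntegral.integral_add (cpz'.circleIntegrable hε.le) (cLp.circleIntegrable hε.le),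
      inv_pm_integral hα hε hε1] at hh
    rw [hδ]
    split_ifs at hh ⊢ <;> linear_combination hh
  have I3 : (∮ z in C(α, ε), (1 / (z₁ - z) + L z / z₁) * (δ / z)) = 0 := by
    apply circ_zero hε.le
    intro z hz
    have := (hL z hz).differentiableAt
    apply DifferentiableAt.mul
    · apply DifferentiableAt.add
      · exact (differentiableAt_const _).div (by fun_prop) (hne z hz)
      · exact this.div_const _
    · exact (differentiableAt_const _).div differentiableAt_id (h0 z hz)
  have e : ∀ z ∈ Metric.sphere α ε, (1 / (z₁ - z) + L z / z₁) * (psiB α m z / z) =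
     ((pm (m+1)).eval (vv α z) / z * (1 / (z₁ - z)) + z₁⁻¹ * (L z * ((pm (m+1)).eval (vv α z) / z)))
       + (1 / (z₁ - z) + L z / z₁) * (δ / z) := by
    intro z _
    unfold psiB
    ring
  rw [circleIntegral.integral_congr hε.le e, circleIntegral.integral_add, circleIntegral.integral_add,
    circleIntegral.integral_const_mul, I1, I2, I3]
  · unfold psiB; ring
  · exact (cpz.mul c1).circleIntegrable hε.le
  · exact (continuousOn_const.mul (cL.mul cpz)).circleIntegrable hε.le
  · exact ((cpz.mul c1).add (continuousOn_const.mul (cL.mul cpz))).circleIntegrable hε.le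
  · exact ((c1.add (cL.div_const _)).mul (continuousOn_const.div cz fun z hz => h0 z (hs hz))).circleIntegrable hε.le

lemma psiB_diff {α z : ℂ} (hα : α ^ 2 = 1) (m : ℕ) (hza : z ≠ α) : DifferentiableAt ℂ (psiB α m) z :=
  (pm_diff (m+1) hα hza).add_const _

lemma psiB_proj' {α β : ℂ} (hα : α ^ 2 = 1) (hβ : ‖β‖ = 1) {ε : ℝ} (hε : 0 < ε) (hε1 : ε < 1) {z₁ : ℂ}
    (hab : α ∉ Metric.closedBall β ε)
    (hz₁ : z₁ ∉ Metric.closedBall β ε) (L : ℂ → ℂ) (hL : ∀ z ∈ Metric.closedBall β ε, HasDerivAt L z⁻¹ z)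
    (m : ℕ) :
    (∮ z in C(β, ε), (1 / (z₁ - z) + L z / z₁) * (psiB α m z / z)) = 0 := by
  have h0 : ∀ z ∈ Metric.closedBall β ε, z ≠ 0 := by
    rintro z hz rfl
    simp [hβ] at hz; linarith
  have hne : ∀ z ∈ Metric.closedBall β ε, z₁ - z ≠ 0 := fun z hz h => hz₁ (by rwa [sub_eq_zero.1 h])
  apply circ_zero hε.le
  intro z hz
  have := (hL z hz).differentiableAt
  apply DifferentiableAt.mul
  · apply DifferentiableAt.add
    · exact (differentiableAt_const _).div (by fun_prop) (hne z hz)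
    · exact this.div_const _
  · exact (psiB_diff hα m (fun h => hab (h ▸ hz))).div differentiableAt_id (h0 z hz)

/-- the two kernels -/
noncomputable def kerP (z₁ z : ℂ) : ℂ := 1 / (z₁ - z) + Complex.log z / z₁
noncomputable def kerM (z₁ z : ℂ) : ℂ := 1 / (z₁ - z) + (Complex.log (-z) + Real.pi * Complex.I) / z₁

lemma logP {z : ℂ} {ε : ℝ} (hε1 : ε < 1) (hz : z ∈ Metric.closedBall (1:ℂ) ε) :
    HasDerivAt Complex.log z⁻¹ z := by
  apply Complex.hasDerivAt_log
  apply Complex.ball_one_subset_slitPlane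
  simp at hz ⊢; linarith

lemma logM {z : ℂ} {ε : ℝ} (hε1 : ε < 1) (hz : z ∈ Metric.closedBall (-1:ℂ) ε) :
    HasDerivAt (fun z => Complex.log (-z) + Real.pi * Complex.I) z⁻¹ z := by
  have h : HasDerivAt Complex.log (-z)⁻¹ (-z) := by
    apply logP hε1
    rw [Metric.mem_closedBall, dist_eq_norm] at hz ⊢
    rw [← norm_neg]
    have e : -(-z - 1) = z - -1 := by ring
    rw [e]; exact hz
  have h2 := (h.comp z (hasDerivAt_neg z)).add_const (Real.pi * Complex.I)
  refine h2.congr_deriv ?_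
  rw [inv_neg]; ring

structure GF (f : ℕ → ℂ) (Ψ : ℂ → ℂ) : Prop where
  diff : ∀ z, z ≠ 1 → z ≠ -1 → DifferentiableAt ℂ Ψ z
  sum : ∀ z : ℂ, ‖z‖ < 1 → HasSum (fun t : ℕ => (br t : ℂ) * f t * z ^ t) (Ψ z)
  inv : ∀ z, XX z → Ψ z⁻¹ = Ψ z
  proj : ∀ (ε : ℝ) (z₁ : ℂ), 0 < ε → ε < 1 → z₁ ≠ 0 → z₁ ∉ Metric.closedBall 1 ε → z₁ ∉ Metric.closedBall (-1) ε →
    (∮ z in C(1, ε), kerP z₁ z * (Ψ z / z)) + (∮ z in C(-1, ε), kerM z₁ z * (Ψ z / z)) =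
      2 * Real.pi * Complex.I * (Ψ z₁ / z₁)

lemma br_pow (t m : ℕ) : (br t : ℂ) * (t : ℂ) ^ m = (t : ℂ) ^ (m + 1) + if t = 0 then (if m = 0 then 1 else 0) else 0 := by
  unfold br
  by_cases ht : t = 0
  · subst ht; by_cases hm : m = 0 <;> simp [hm]
  · simp [ht]; ring

lemma GF_basis {α : ℂ} (hα : α = 1 ∨ α = -1) (k : ℕ) :
    GF (fun t => (t : ℂ) ^ (2 * k) * α ^ t) (psiB α (2 * k)) := by
  have hα2 : α ^ 2 = 1 := by rcases hα with rfl | rfl <;> norm_num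
  have hn : ‖α‖ = 1 := by rcases hα with rfl | rfl <;> norm_num
  constructor
  · intro z h1 h2
    apply psiB_diff hα2
    rcases hα with rfl | rfl <;> assumption
  · intro z hz
    have h1 := pm_hasSum (2 * k + 1) (r := α * z) (by rw [norm_mul, hn, one_mul]; exact hz)
    have h2 := h1.add (hasSum_ite_eq 0 (if 2 * k = 0 then (1:ℂ) else 0))
    unfold psiB vv
    have e : (fun t : ℕ => (br t : ℂ) * ((t : ℂ) ^ (2 * k) * α ^ t) * z ^ t) = fun t : ℕ =>
        (t : ℂ) ^ (2 * k + 1) * (α * z) ^ t + if t = 0 then (if 2 * k = 0 then (1:ℂ) else 0) else 0 := by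
      funext t
      have := br_pow t (2 * k)
      rw [mul_pow]
      by_cases ht : t = 0
      · subst ht
        rw [if_pos rfl] at this ⊢
        simp only [pow_zero, mul_one]
        exact this
      · rw [if_neg ht] at this ⊢
        linear_combination (α ^ t * z ^ t) * this
    rw [e]; exact h2
  · intro z hz
    have hza : z ≠ α := by rcases hα with rfl | rfl; exacts [hz.2.1, hz.2.2]
    unfold psiB
    rw [pm_inv (2*k) hα2 hz.1 hza]
    simp [pow_mul]
  · intro ε z₁ hε hε1 hz0 hz1 hz2
    rcases hα with rfl | rfl
    · have A := psiB_proj hα2 hε hε1 hz0 hz1 Complex.log (fun z hz => logP hε1 hz) (2*k)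
      have B := psiB_proj' hα2 (β := -1) (by norm_num) hε hε1 (by simp [dist_eq_norm]; norm_num; linarith) hz2 _ (fun z hz => logM hε1 hz) (2*k)
      unfold kerP kerM
      rw [A, B, add_zero]
    · have A := psiB_proj' hα2 (β := 1) (by norm_num) hε hε1 (by simp [dist_eq_norm]; norm_num; linarith) hz1 Complex.log (fun z hz => logP hε1 hz) (2*k)
      have B := psiB_proj hα2 hε hε1 hz0 hz2 _ (fun z hz => logM hε1 hz) (2*k)
      unfold kerP kerM
      rw [A, B, zero_add]

open Polynomial in
/-- even quasi-polynomials in one variable -/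
def EQ (f : ℕ → ℂ) : Prop := ∃ P : ℕ → ℂ[X], ∀ t, f t = (P (t % 2)).eval ((t : ℂ) ^ 2)

lemma EQ.const (c : ℂ) : EQ (fun _ => c) := ⟨fun _ => Polynomial.C c, fun t => by simp⟩

lemma EQ.add {f g : ℕ → ℂ} (hf : EQ f) (hg : EQ g) : EQ (fun t => f t + g t) := by
  obtain ⟨P, hP⟩ := hf
  obtain ⟨Q, hQ⟩ := hg
  exact ⟨fun i => P i + Q i, fun t => by simp [hP, hQ]⟩

lemma EQ.mul {f g : ℕ → ℂ} (hf : EQ f) (hg : EQ g) : EQ (fun t => f t * g t) := by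
  obtain ⟨P, hP⟩ := hf
  obtain ⟨Q, hQ⟩ := hg
  exact ⟨fun i => P i * Q i, fun t => by simp [hP, hQ]⟩

lemma EQ.sum {ι : Type*} (s : Finset ι) {f : ι → ℕ → ℂ} (hf : ∀ i ∈ s, EQ (f i)) : EQ (fun t => ∑ i ∈ s, f i t) := by
  classical
  induction s using Finset.induction_on with
  | empty => simpa using EQ.const 0
  | insert a s ha ih =>
    simp only [Finset.sum_insert ha]
    exact (hf a (by simp)).add (ih fun i hi => hf i (by simp [hi]))

lemma EQ.ite (p : Prop) [Decidable p] {f : ℕ → ℂ} (hf : p → EQ f) : EQ (fun t => if p then f t else 0) := by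
  by_cases h : p
  · simpa [h] using hf h
  · simpa [h] using EQ.const 0

lemma XX_of_sphere1 {z : ℂ} {ε : ℝ} (hε : 0 < ε) (hε1 : ε < 1) (hz : z ∈ Metric.sphere (1:ℂ) ε) : XX z := by
  rw [mem_sphere_iff_norm] at hz
  refine ⟨?_, ?_, ?_⟩ <;> rintro rfl <;> norm_num at hz <;> linarith

lemma XX_of_sphere2 {z : ℂ} {ε : ℝ} (hε : 0 < ε) (hε1 : ε < 1) (hz : z ∈ Metric.sphere (-1:ℂ) ε) : XX z := by
  rw [mem_sphere_iff_norm] at hz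
  refine ⟨?_, ?_, ?_⟩ <;> rintro rfl <;> norm_num at hz <;> linarith

lemma kerP_cont {ε : ℝ} (hε1 : ε < 1) {z₁ : ℂ} (hz : z₁ ∉ Metric.closedBall 1 ε) {z : ℂ}
    (h : z ∈ Metric.closedBall (1:ℂ) ε) : DifferentiableAt ℂ (kerP z₁) z := by
  unfold kerP
  have hne : z₁ - z ≠ 0 := fun h' => hz (by rwa [sub_eq_zero.1 h'])
  exact ((differentiableAt_const _).div (by fun_prop) hne).add ((logP hε1 h).differentiableAt.div_const _)

lemma kerM_cont {ε : ℝ} (hε1 : ε < 1) {z₁ : ℂ} (hz : z₁ ∉ Metric.closedBall (-1) ε) {z : ℂ}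
    (h : z ∈ Metric.closedBall (-1:ℂ) ε) : DifferentiableAt ℂ (kerM z₁) z := by
  unfold kerM
  have hne : z₁ - z ≠ 0 := fun h' => hz (by rwa [sub_eq_zero.1 h'])
  exact ((differentiableAt_const _).div (by fun_prop) hne).add ((logM hε1 h).differentiableAt.div_const _)

lemma kerP_int {ε : ℝ} (hε : 0 < ε) (hε1 : ε < 1) {z₁ : ℂ} (hz : z₁ ∉ Metric.closedBall 1 ε) {Ψ : ℂ → ℂ}
    (hΨ : ∀ z, XX z → ContinuousAt Ψ z) : CircleIntegrable (fun z => kerP z₁ z * (Ψ z / z)) 1 ε := by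
  apply ContinuousOn.circleIntegrable hε.le
  intro z h
  have hx := XX_of_sphere1 hε hε1 h
  exact ((kerP_cont hε1 hz (Metric.sphere_subset_closedBall h)).continuousAt.mul
    ((hΨ z hx).div continuousAt_id hx.1)).continuousWithinAt

lemma kerM_int {ε : ℝ} (hε : 0 < ε) (hε1 : ε < 1) {z₁ : ℂ} (hz : z₁ ∉ Metric.closedBall (-1) ε) {Ψ : ℂ → ℂ}
    (hΨ : ∀ z, XX z → ContinuousAt Ψ z) : CircleIntegrable (fun z => kerM z₁ z * (Ψ z / z)) (-1) ε := by
  apply ContinuousOn.circleIntegrable hε.le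
  intro z h
  have hx := XX_of_sphere2 hε hε1 h
  exact ((kerM_cont hε1 hz (Metric.sphere_subset_closedBall h)).continuousAt.mul
    ((hΨ z hx).div continuousAt_id hx.1)).continuousWithinAt

lemma GF.cont {f : ℕ → ℂ} {Ψ : ℂ → ℂ} (h : GF f Ψ) (z : ℂ) (hz : XX z) : ContinuousAt Ψ z :=
  (h.diff z hz.2.1 hz.2.2).continuousAt

lemma GF.add {f g : ℕ → ℂ} {Ψ Φ : ℂ → ℂ} (hf : GF f Ψ) (hg : GF g Φ) :
    GF (fun t => f t + g t) (fun z => Ψ z + Φ z) := by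
  constructor
  · intro z h1 h2; exact (hf.diff z h1 h2).add (hg.diff z h1 h2)
  · intro z hz
    have := (hf.sum z hz).add (hg.sum z hz)
    have e : (fun t : ℕ => (br t : ℂ) * (f t + g t) * z ^ t) =
      fun t : ℕ => (br t : ℂ) * f t * z ^ t + (br t : ℂ) * g t * z ^ t := by funext t; ring
    rw [e]; exact this
  · intro z hz; simp only [hf.inv z hz, hg.inv z hz]
  · intro ε z₁ hε hε1 h0 h1 h2
    have A := hf.proj ε z₁ hε hε1 h0 h1 h2
    have B := hg.proj ε z₁ hε hε1 h0 h1 h2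
    have e1 : ∀ z, kerP z₁ z * ((Ψ z + Φ z) / z) = kerP z₁ z * (Ψ z / z) + kerP z₁ z * (Φ z / z) := fun z => by ring
    have e2 : ∀ z, kerM z₁ z * ((Ψ z + Φ z) / z) = kerM z₁ z * (Ψ z / z) + kerM z₁ z * (Φ z / z) := fun z => by ring
    simp only [e1, e2]
    rw [circleIntegral.integral_add (kerP_int hε hε1 h1 hf.cont) (kerP_int hε hε1 h1 hg.cont),
      circleIntegral.integral_add (kerM_int hε hε1 h2 hf.cont) (kerM_int hε hε1 h2 hg.cont)]
    linear_combination A + B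

lemma GF.smul (c : ℂ) {f : ℕ → ℂ} {Ψ : ℂ → ℂ} (hf : GF f Ψ) :
    GF (fun t => c * f t) (fun z => c * Ψ z) := by
  constructor
  · intro z h1 h2; exact (hf.diff z h1 h2).const_mul _
  · intro z hz
    have := (hf.sum z hz).mul_left c
    have e : (fun t : ℕ => (br t : ℂ) * (c * f t) * z ^ t) =
      fun t : ℕ => c * ((br t : ℂ) * f t * z ^ t) := by funext t; ring
    rw [e]; exact this
  · intro z hz; simp only [hf.inv z hz]
  · intro ε z₁ hε hε1 h0 h1 h2
    have A := hf.proj ε z₁ hε hε1 h0 h1 h2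
    have e1 : ∀ z, kerP z₁ z * ((c * Ψ z) / z) = c * (kerP z₁ z * (Ψ z / z)) := fun z => by ring
    have e2 : ∀ z, kerM z₁ z * ((c * Ψ z) / z) = c * (kerM z₁ z * (Ψ z / z)) := fun z => by ring
    simp only [e1, e2, circleIntegral.integral_const_mul]
    linear_combination c * A

/-- the plain generating series -/
structure PH (f : ℕ → ℂ) (Φ : ℂ → ℂ) : Prop where
  diff : ∀ z, z ≠ 1 → z ≠ -1 → DifferentiableAt ℂ Φ z
  sum : ∀ z : ℂ, ‖z‖ < 1 → HasSum (fun t : ℕ => f t * z ^ t) (Φ z)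
  inv : ∀ z, XX z → Φ z + Φ z⁻¹ = f 0

lemma PH.add {f g : ℕ → ℂ} {Ψ Φ : ℂ → ℂ} (hf : PH f Ψ) (hg : PH g Φ) :
    PH (fun t => f t + g t) (fun z => Ψ z + Φ z) := by
  constructor
  · intro z h1 h2; exact (hf.diff z h1 h2).add (hg.diff z h1 h2)
  · intro z hz
    have := (hf.sum z hz).add (hg.sum z hz)
    have e : (fun t : ℕ => (f t + g t) * z ^ t) =
      fun t : ℕ => f t * z ^ t + g t * z ^ t := by funext t; ring
    rw [e]; exact this
  · intro z hz; linear_combination hf.inv z hz + hg.inv z hz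

lemma PH.smul (c : ℂ) {f : ℕ → ℂ} {Ψ : ℂ → ℂ} (hf : PH f Ψ) :
    PH (fun t => c * f t) (fun z => c * Ψ z) := by
  constructor
  · intro z h1 h2; exact (hf.diff z h1 h2).const_mul _
  · intro z hz
    have := (hf.sum z hz).mul_left c
    have e : (fun t : ℕ => (c * f t) * z ^ t) =
      fun t : ℕ => c * (f t * z ^ t) := by funext t; ring
    rw [e]; exact this
  · intro z hz; linear_combination c * hf.inv z hz

lemma PH_basis {α : ℂ} (hα : α = 1 ∨ α = -1) (k : ℕ) :
    PH (fun t => (t : ℂ) ^ (2 * k) * α ^ t) (fun z => (pm (2 * k)).eval (vv α z)) := by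
  have hα2 : α ^ 2 = 1 := by rcases hα with rfl | rfl <;> norm_num
  have hn : ‖α‖ = 1 := by rcases hα with rfl | rfl <;> norm_num
  constructor
  · intro z h1 h2
    apply pm_diff _ hα2
    rcases hα with rfl | rfl <;> assumption
  · intro z hz
    have h1 := pm_hasSum (2 * k) (r := α * z) (by rw [norm_mul, hn, one_mul]; exact hz)
    have e : (fun t : ℕ => (t : ℂ) ^ (2 * k) * α ^ t * z ^ t) = fun t : ℕ =>
        (t : ℂ) ^ (2 * k) * (α * z) ^ t := by
      funext t; rw [mul_pow]; ring
    rw [e]; exact h1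
  · intro z hz
    have hza : z ≠ α := by rcases hα with rfl | rfl; exacts [hz.2.1, hz.2.2]
    rcases k with _ | k
    · simp only [mul_zero, pm, Polynomial.eval_X]
      rw [vv_inv hα2 hz.1 hza]; simp
    · have : 2 * (k+1) = (2 * k + 1) + 1 := by ring
      rw [this]
      simp only [pm_inv (2*k+1) hα2 hz.1 hza]
      simp [pow_succ, pow_mul]

lemma EQ_ind {C : (ℕ → ℂ) → Prop} (hadd : ∀ f g, C f → C g → C (fun t => f t + g t))
    (hsmul : ∀ (c : ℂ) f, C f → C (fun t => c * f t))
    (hb : ∀ (α : ℂ) (k : ℕ), (α = 1 ∨ α = -1) → C (fun t => (t : ℂ) ^ (2 * k) * α ^ t))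
    {f : ℕ → ℂ} (hf : EQ f) : C f := by
  have key : ∀ (P : Polynomial ℂ) (α : ℂ), (α = 1 ∨ α = -1) → C (fun t => P.eval ((t:ℂ)^2) * α ^ t) := by
    intro P α hα
    induction P using Polynomial.induction_on' with
    | add p q hp hq =>
      have := hadd _ _ hp hq
      simpa only [Polynomial.eval_add, add_mul] using this
    | monomial n a =>
      have := hsmul a _ (hb α n hα)
      have e : (fun t : ℕ => (Polynomial.monomial n a).eval ((t:ℂ)^2) * α ^ t) =
        fun t : ℕ => a * ((t : ℂ) ^ (2 * n) * α ^ t) := by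
        funext t; rw [Polynomial.eval_monomial, ← pow_mul]; ring
      rw [e]; exact this
  obtain ⟨P, hP⟩ := hf
  have h := hadd _ _ (hsmul (1/2) _ (hadd _ _ (key (P 0) 1 (Or.inl rfl)) (key (P 0) (-1) (Or.inr rfl))))
    (hsmul (1/2) _ (hadd _ _ (key (P 1) 1 (Or.inl rfl)) (hsmul (-1) _ (key (P 1) (-1) (Or.inr rfl)))))
  have e : f = fun t : ℕ => 1 / 2 * (Polynomial.eval ((t:ℂ) ^ 2) (P 0) * 1 ^ t + Polynomial.eval ((t:ℂ) ^ 2) (P 0) * (-1) ^ t) +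
        1 / 2 * (Polynomial.eval ((t:ℂ) ^ 2) (P 1) * 1 ^ t + -1 * (Polynomial.eval ((t:ℂ) ^ 2) (P 1) * (-1) ^ t)) := by
    funext t
    rw [hP t, one_pow]
    rcases Nat.even_or_odd t with h | h
    · rw [h.neg_one_pow, Nat.even_iff.1 h]; ring
    · rw [h.neg_one_pow, Nat.odd_iff.1 h]; ring
  rw [e]; exact h

lemma EQ.exists_GF {f : ℕ → ℂ} (hf : EQ f) : ∃ Ψ, GF f Ψ := by
  refine EQ_ind (C := fun f => ∃ Ψ, GF f Ψ) ?_ ?_ ?_ hf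
  · rintro f g ⟨Ψ, h⟩ ⟨Φ, h'⟩; exact ⟨_, h.add h'⟩
  · rintro c f ⟨Ψ, h⟩; exact ⟨_, h.smul c⟩
  · intro α k hα; exact ⟨_, GF_basis hα k⟩

lemma EQ.exists_PH {f : ℕ → ℂ} (hf : EQ f) : ∃ Ψ, PH f Ψ := by
  refine EQ_ind (C := fun f => ∃ Ψ, PH f Ψ) ?_ ?_ ?_ hf
  · rintro f g ⟨Ψ, h⟩ ⟨Φ, h'⟩; exact ⟨_, h.add h'⟩
  · rintro c f ⟨Ψ, h⟩; exact ⟨_, h.smul c⟩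
  · intro α k hα; exact ⟨_, PH_basis hα k⟩

open Classical in
noncomputable def gf (f : ℕ → ℂ) : ℂ → ℂ := if h : ∃ Ψ, GF f Ψ then h.choose else 0

lemma EQ.gf {f : ℕ → ℂ} (hf : EQ f) : GF f (gf f) := by
  have h := hf.exists_GF
  unfold _root_.gf
  rw [dif_pos h]
  exact h.choose_spec

lemma XX_open : IsOpen {z | XX z} := by
  have : {z | XX z} = ({0, 1, -1} : Set ℂ)ᶜ := by ext z; simp [XX]
  rw [this]
  exact (Set.Finite.isClosed (by simp)).isOpen_compl

lemma XX_conn : IsPreconnected {z | XX z} := by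
  have : {z | XX z} = ({0, 1, -1} : Set ℂ)ᶜ := by ext z; simp [XX]
  rw [this]
  refine (Set.Countable.isConnected_compl_of_one_lt_rank ?_ ?_).isPreconnected
  · simp
  · exact (Set.Finite.countable (by simp))

lemma XX_small {z : ℂ} (h0 : z ≠ 0) (h : ‖z‖ < 1) : XX z := by
  refine ⟨h0, ?_, ?_⟩ <;> rintro rfl <;> simp at h

/-- one-variable identity theorem -/
lemma ident1 {F : ℂ → ℂ} (hF : ∀ z, XX z → DifferentiableAt ℂ F z) {r : ℝ} (hr : 0 < r)
    (h0 : ∀ z, 0 < ‖z‖ → ‖z‖ < r → F z = 0) : ∀ z, XX z → F z = 0 := by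
  have hd : DifferentiableOn ℂ F {z | XX z} := fun z hz => (hF z hz).differentiableWithinAt
  have ha := hd.analyticOnNhd XX_open
  set ρ := min r 1 with hρ
  have hρ0 : 0 < ρ := lt_min hr one_pos
  have hn : ‖((ρ / 2 : ℝ) : ℂ)‖ = ρ / 2 := by
    rw [Complex.norm_real, Real.norm_eq_abs, abs_of_pos (by positivity)]
  have hx : XX ((ρ/2 : ℝ) : ℂ) := XX_small (by rw [← norm_pos_iff, hn]; positivity) (by rw [hn]; linarith [min_le_right r 1])
  have := ha.eqOn_zero_of_preconnected_of_eventuallyEq_zero XX_conn hx ?_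
  · exact fun z hz => this hz
  · have ho : IsOpen {z : ℂ | 0 < ‖z‖ ∧ ‖z‖ < r} :=
      (isOpen_lt continuous_const continuous_norm).inter (isOpen_lt continuous_norm continuous_const)
    filter_upwards [ho.mem_nhds (show ((ρ/2 : ℝ) : ℂ) ∈ _ from ⟨by rw [hn]; positivity, by rw [hn]; linarith [min_le_left r 1]⟩)] with z hz
    exact h0 z hz.1 hz.2

lemma GF.unique {f : ℕ → ℂ} {Ψ Φ : ℂ → ℂ} (h : GF f Ψ) (h' : GF f Φ) {z : ℂ} (hz : XX z) : Ψ z = Φ z := by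
  have := ident1 (F := fun z => Ψ z - Φ z) (fun z hz => (h.diff z hz.2.1 hz.2.2).sub (h'.diff z hz.2.1 hz.2.2)) one_pos
    (fun z h0 h1 => sub_eq_zero.2 ((h.sum z h1).unique (h'.sum z h1))) z hz
  exact sub_eq_zero.1 this

lemma hasSum_mul_C {ι κ : Type} {f : ι → ℂ} {g : κ → ℂ} {s t : ℂ} (hf : HasSum f s) (hg : HasSum g t) :
    HasSum (fun x : ι × κ => f x.1 * g x.2) (s * t) := by
  have h := summable_mul_of_summable_norm hf.summable.norm hg.summable.norm
  have e := tsum_mul_tsum_of_summable_norm hf.summable.norm hg.summable.norm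
  rw [hf.tsum_eq, hg.tsum_eq] at e
  rw [e]
  exact h.hasSum

lemma hasSum_prod_fin : ∀ (n : ℕ) (F : Fin n → ℕ → ℂ) (S : Fin n → ℂ), (∀ i, HasSum (F i) (S i)) →
    HasSum (fun b : Fin n → ℕ => ∏ i, F i (b i)) (∏ i, S i) := by
  intro n
  induction n with
  | zero => intro F S h; simp
  | succ n ih =>
    intro F S h
    have h1 := ih (fun i => F i.succ) (fun i => S i.succ) (fun i => h _)
    have h2 : HasSum (fun x : ℕ × (Fin n → ℕ) => F 0 x.1 * ∏ i, F (Fin.succ i) (x.2 i)) (S 0 * ∏ i, S (Fin.succ i)) :=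
      hasSum_mul_C (g := fun b : Fin n → ℕ => ∏ i, F (Fin.succ i) (b i)) (h 0) h1
    rw [Fin.prod_univ_succ, ← (Fin.consEquiv (fun _ => ℕ)).hasSum_iff]
    convert h2 using 1
    funext x
    simp [Fin.consEquiv, Fin.prod_univ_succ]

lemma ident_n {n : ℕ} {F : (Fin n → ℂ) → ℂ}
    (hF : ∀ w, (∀ i, XX (w i)) → ∀ i, DifferentiableAt ℂ (fun x => F (Function.update w i x)) (w i))
    {r : ℝ} (hr : 0 < r) (h0 : ∀ w, (∀ i, 0 < ‖w i‖ ∧ ‖w i‖ < r) → F w = 0) :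
    ∀ w, (∀ i, XX (w i)) → F w = 0 := by
  have key : ∀ s : Finset (Fin n), ∀ w, (∀ i, XX (w i)) → (∀ i, i ∉ s → ‖w i‖ < r) → F w = 0 := by
    intro s
    induction s using Finset.induction_on with
    | empty =>
      intro w hw hs
      exact h0 w fun i => ⟨norm_pos_iff.2 (hw i).1, hs i (by simp)⟩
    | insert a s ha ih =>
      intro w hw hs
      have hup : ∀ x, XX x → ∀ i, XX (Function.update w a x i) := by
        intro x hx i
        by_cases hi : i = a
        · subst hi; simpa using hx
        · simpa [hi] using hw i
      have := ident1 (F := fun x => F (Function.update w a x)) ?_ (r := min r 1) (by positivity) ?_ (w a) (hw a)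
      · simpa using this
      · intro x hx
        have := hF (Function.update w a x) (hup x hx) a
        simpa using this
      · intro x hx0 hx1
        refine ih _ (hup x (XX_small (norm_pos_iff.1 hx0) (lt_of_lt_of_le hx1 (min_le_right _ _)))) ?_
        intro i hi
        by_cases hia : i = a
        · subst hia; simpa using lt_of_lt_of_le hx1 (min_le_left _ _)
        · simpa [hia] using hs i (by simp [hia, hi])
  intro w hw
  exact key Finset.univ w hw (by simp)

/-- `F` is a finite sum of products of one-variable even quasi-polynomials -/
structure PRep {α : Type} [Fintype α] (F : (α → ℕ) → ℂ) (ι : Type) (T : Finset ι) (c : ι → ℂ)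
    (f : ι → α → ℕ → ℂ) : Prop where
  eq : ∀ τ a, EQ (f τ a)
  rep : ∀ b, F b = ∑ τ ∈ T, c τ * ∏ a, f τ a (b a)

lemma EQ_basic (e k : ℕ) : EQ (fun t => if t % 2 = e then ((t:ℂ) ^ 2) ^ k else 0) := by
  refine ⟨fun i => if i = e then Polynomial.X ^ k else 0, fun t => ?_⟩
  by_cases h : t % 2 = e <;> simp [h]

lemma N_rep (Nf : LatticeCountFamily) (g : ℕ) (α : Type) [Fintype α] [DecidableEq α]
    (h : 3 ≤ 2 * g + Fintype.card α) :
    ∃ ι T c f, PRep (fun b => (Nf.N g α b : ℂ)) ι T c f := by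
  choose P hP using fun ε : α → Fin 2 => Nf.quasipoly g α h (fun a => (ε a : ℕ))
  refine ⟨Σ _ : (α → Fin 2), (α →₀ ℕ), Finset.univ.sigma (fun ε => (P ε).support),
    fun τ => (((P τ.1).coeff τ.2 : ℚ) : ℂ), fun τ a t => if t % 2 = (τ.1 a : ℕ) then ((t:ℂ) ^ 2) ^ (τ.2 a) else 0,
    fun τ a => EQ_basic _ _, fun b => ?_⟩
  rw [Finset.sum_sigma]
  set ε₀ : α → Fin 2 := fun a => ⟨b a % 2, Nat.mod_lt _ two_pos⟩ with hε
  rw [Finset.sum_eq_single ε₀]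
  · rw [hP ε₀ b (fun a => rfl), MvPolynomial.eval_eq']
    push_cast
    apply Finset.sum_congr rfl
    intro d _
    congr 1
    apply Finset.prod_congr rfl
    intro a _
    simp [hε]
  · intro ε _ hne
    apply Finset.sum_eq_zero
    intro d _
    obtain ⟨a, ha⟩ := Function.ne_iff.1 hne
    rw [Finset.prod_eq_zero (Finset.mem_univ a), mul_zero]
    rw [if_neg]
    intro h'
    apply ha
    apply Fin.ext
    simp [hε, h']
  · simp

lemma EQ_zpow_sum {f : ℕ → ℂ} (hf : EQ f) {z : ℂ} (h0 : 0 < ‖z‖) (h1 : ‖z‖ < 1) :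
    HasSum (fun t : ℕ => f t * ((br t : ℂ) * z ^ ((t : ℤ) - 1))) (gf f z / z) := by
  have := (hf.gf.sum z h1).div_const z
  have e : (fun t : ℕ => f t * ((br t : ℂ) * z ^ ((t : ℤ) - 1))) = fun t : ℕ => (br t : ℂ) * f t * z ^ t / z := by
    funext t
    rw [zpow_sub_one₀ (norm_pos_iff.1 h0), zpow_natCast]; ring
  rw [e]; exact this

/-- everything we are given about `W` -/
structure WHyp (Nfam : LatticeCountFamily) (W : (g n : ℕ) → (Fin n → ℂ) → ℂ) : Prop where
  hhol : ∀ g n : ℕ, 3 ≤ 2 * g + n → ∀ z : Fin n → ℂ,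
      (∀ i, z i ≠ 0 ∧ z i ≠ 1 ∧ z i ≠ -1) → DifferentiableAt ℂ (W g n) z
  hsum : ∀ g n : ℕ, 3 ≤ 2 * g + n → ∀ z : Fin n → ℂ,
      (∀ i, 0 < ‖z i‖ ∧ ‖z i‖ < 1) →
      HasSum
        (fun b : Fin n → ℕ => (Nfam.N g (Fin n) b : ℂ) *
          ∏ i, (br (b i) : ℂ) * z i ^ ((b i : ℤ) - 1))
        (W g n z)

lemma W_rep_fin {Nf W} (H : WHyp Nf W) {g n : ℕ} (h : 3 ≤ 2 * g + n) {ι T c f}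
    (hr : PRep (fun b => (Nf.N g (Fin n) b : ℂ)) ι T c f) (v : Fin n → ℂ) (hv : ∀ i, XX (v i)) :
    W g n v = ∑ τ ∈ T, c τ * ∏ i, (gf (f τ i) (v i) / v i) := by
  have := ident_n (F := fun v => W g n v - ∑ τ ∈ T, c τ * ∏ i, (gf (f τ i) (v i) / v i)) ?_ one_pos ?_ v hv
  · exact sub_eq_zero.1 this
  · intro w hw i
    apply DifferentiableAt.sub
    · have h1 := H.hhol g n h w hw
      have h2 : DifferentiableAt ℂ (fun x : ℂ => Function.update w i x) (w i) :=
        (hasDerivAt_update w i (w i)).differentiableAt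
      have h3 : DifferentiableAt ℂ (W g n) (Function.update w i (w i)) := by simpa using h1
      exact h3.comp (w i) h2
    · apply DifferentiableAt.fun_sum
      intro τ _
      apply DifferentiableAt.const_mul
      apply DifferentiableAt.fun_finsetProd
      intro j _
      by_cases hj : j = i
      · subst hj
        simp only [Function.update_self]
        exact ((hr.eq τ j).gf.diff _ (hw j).2.1 (hw j).2.2).div differentiableAt_id (hw j).1
      · simp [hj]
  · intro w hw
    have h1 := H.hsum g n h w hw
    have h2 : HasSum (fun b : Fin n → ℕ => ∑ τ ∈ T, c τ * ∏ i, (f τ i (b i) * ((br (b i) : ℂ) * w i ^ ((b i : ℤ) - 1))))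
        (∑ τ ∈ T, c τ * ∏ i, (gf (f τ i) (w i) / w i)) := by
      apply hasSum_sum
      intro τ _
      exact (hasSum_prod_fin n _ _ (fun i => EQ_zpow_sum (hr.eq τ i) (hw i).1 (hw i).2)).mul_left _
    have e : (fun b : Fin n → ℕ => (Nf.N g (Fin n) b : ℂ) * ∏ i, (br (b i) : ℂ) * w i ^ ((b i : ℤ) - 1)) =
      fun b : Fin n → ℕ => ∑ τ ∈ T, c τ * ∏ i, (f τ i (b i) * ((br (b i) : ℂ) * w i ^ ((b i : ℤ) - 1))) := by
      funext b
      rw [hr.rep b, Finset.sum_mul]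
      apply Finset.sum_congr rfl
      intro τ _
      rw [mul_assoc, ← Finset.prod_mul_distrib]
    rw [e] at h1
    exact sub_eq_zero.2 (h1.unique h2)

lemma W_rep {Nf W} (H : WHyp Nf W) {g n : ℕ} (h : 3 ≤ 2 * g + n) {α : Type} [Fintype α] [DecidableEq α]
    (e : α ≃ Fin n) {ι T c f}
    (hr : PRep (fun b => (Nf.N g α b : ℂ)) ι T c f) (v : Fin n → ℂ) (hv : ∀ i, XX (v i)) :
    W g n v = ∑ τ ∈ T, c τ * ∏ a, (gf (f τ a) (v (e a)) / v (e a)) := by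
  have hr' : PRep (fun b => (Nf.N g (Fin n) b : ℂ)) ι T c (fun τ i => f τ (e.symm i)) := by
    refine ⟨fun τ i => hr.eq _ _, fun b => ?_⟩
    rw [← Nf.symm g α (Fin n) e b]
    rw [hr.rep (b ∘ e)]
    apply Finset.sum_congr rfl
    intro τ _
    congr 1
    rw [← Equiv.prod_comp e]
    simp
  rw [W_rep_fin H h hr' v hv]
  apply Finset.sum_congr rfl
  intro τ _
  congr 1
  rw [← Equiv.prod_comp e]
  simp

noncomputable def sfun (z : ℂ) : ℂ := z ^ 2 / (1 - z ^ 2) ^ 2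

lemma XX.sq {z : ℂ} (h : XX z) : 1 - z ^ 2 ≠ 0 := by
  intro e
  have : (z - 1) * (z + 1) = 0 := by linear_combination -e
  rcases mul_eq_zero.1 this with h' | h'
  · exact h.2.1 (sub_eq_zero.1 h')
  · exact h.2.2 (eq_neg_of_add_eq_zero_left h')

lemma sfun_inv {z : ℂ} (h : XX z) : sfun z⁻¹ = sfun z := by
  unfold sfun
  have h1 := h.sq
  have h2 := h.inv.sq
  have h0 := h.1
  rw [div_eq_div_iff (pow_ne_zero _ h2) (pow_ne_zero _ h1)]
  have e : z * z⁻¹ = 1 := mul_inv_cancel₀ h0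
  set y := z⁻¹
  have e2 : (y * (1 - z ^2) + z * (1 - y ^2)) = 0 := by linear_combination (-y - z) * e
  have e3 : y * (1 - z^2) = - (z * (1 - y^2)) := by linear_combination e2
  calc y ^ 2 * (1 - z ^ 2) ^ 2 = (y * (1 - z^2)) ^ 2 := by ring
    _ = _ := by rw [e3]; ring

lemma sfun_diff {z : ℂ} (h : XX z) : DifferentiableAt ℂ sfun z := by
  unfold sfun
  exact DifferentiableAt.div (by fun_prop) (by fun_prop) (pow_ne_zero _ h.sq)

noncomputable def evn (r : ℕ) : ℂ := if Even r then (r : ℂ) else 0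

lemma evn_sum {z : ℂ} (hz : ‖z‖ < 1) : HasSum (fun r : ℕ => evn r * z ^ r) (2 * sfun z) := by
  have h1 := hasSum_coe_mul_geometric_of_norm_lt_one hz
  have h2 := hasSum_coe_mul_geometric_of_norm_lt_one (𝕜 := ℂ) (r := -z) (by rwa [norm_neg])
  have h3 := (h1.add h2).div_const 2
  have e : (fun r : ℕ => evn r * z ^ r) = fun r : ℕ => ((r : ℂ) * z ^ r + (r : ℂ) * (-z) ^ r) / 2 := by
    funext r
    unfold evn
    rcases Nat.even_or_odd r with h | h
    · rw [if_pos h, h.neg_pow]; ring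
    · rw [if_neg (by simpa using h), h.neg_pow]; ring
  have e2 : 2 * sfun z = (z / (1 - z) ^ 2 + -z / (1 - -z) ^ 2) / 2 := by
    unfold sfun
    have a1 : 1 - z ≠ 0 := by
      intro h; rw [sub_eq_zero] at h; rw [← h] at hz; simp at hz
    have a2 : 1 + z ≠ 0 := by
      intro h; rw [eq_neg_of_add_eq_zero_right h] at hz; simp at hz
    have a3 : 1 - z ^ 2 = (1 - z) * (1 + z) := by ring
    rw [a3, sub_neg_eq_add]
    field_simp
    ring
  rw [e, e2]; exact h3

lemma conv_sum {a c : ℕ → ℂ} {A C z : ℂ} (ha : HasSum (fun t : ℕ => a t * z ^ t) A)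
    (hc : HasSum (fun t : ℕ => c t * z ^ t) C) :
    HasSum (fun t : ℕ => (∑ p ∈ Finset.range (t + 1), a p * c (t - p)) * z ^ t) (A * C) := by
  have h := hasSum_sum_range_mul_of_summable_norm ha.summable.norm hc.summable.norm
  rw [ha.tsum_eq, hc.tsum_eq] at h
  have e : (fun t : ℕ => (∑ p ∈ Finset.range (t + 1), a p * c (t - p)) * z ^ t) =
    fun n : ℕ => ∑ k ∈ Finset.range (n + 1), a k * z ^ k * (c (n - k) * z ^ (n - k)) := by
    funext t
    rw [Finset.sum_mul]
    apply Finset.sum_congr rfl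
    intro p hp
    have : t = p + (t - p) := by have := Finset.mem_range.1 hp; omega
    conv_lhs => rw [this, pow_add]
    simp only [add_tsub_cancel_left]
    ring
  rw [e]; exact h

lemma shift_sum {F : ℕ → ℂ} {z S : ℂ} (h0 : z ≠ 0) (h : HasSum (fun t : ℕ => F t * z ^ t) S) (b : ℕ) :
    HasSum (fun t : ℕ => F (t + b) * z ^ t) ((z ^ b)⁻¹ * (S - ∑ c ∈ Finset.range b, F c * z ^ c)) := by
  have h1 := ((hasSum_nat_add_iff' b).2 h).mul_left (z ^ b)⁻¹
  have e : (fun t : ℕ => F (t + b) * z ^ t) = fun t : ℕ => (z ^ b)⁻¹ * (F (t + b) * z ^ (t + b)) := by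
    funext t
    rw [pow_add]
    have : z ^ b ≠ 0 := pow_ne_zero _ h0
    field_simp
  rw [e]; exact h1

structure XG (X : ℕ → ℂ) (M : ℂ → ℂ) : Prop where
  diff : ∀ z, XX z → DifferentiableAt ℂ M z
  sum : ∀ z : ℂ, ‖z‖ < 1 → HasSum (fun t : ℕ => X t * z ^ t) (2 * sfun z * M z)
  inv : ∀ z, XX z → M z⁻¹ = M z

lemma XG.zero : XG (fun _ => 0) (fun _ => 0) := by
  refine ⟨fun z _ => differentiableAt_const _, fun z _ => ?_, fun z _ => rfl⟩
  simpa using hasSum_zero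

lemma XG.add {X Y M L} (h : XG X M) (h' : XG Y L) : XG (fun t => X t + Y t) (fun z => M z + L z) := by
  refine ⟨fun z hz => (h.diff z hz).add (h'.diff z hz), fun z hz => ?_, fun z hz => ?_⟩
  · have := (h.sum z hz).add (h'.sum z hz)
    simpa only [add_mul, mul_add] using this
  · simp only [h.inv z hz, h'.inv z hz]

lemma XG.smul (c : ℂ) {X M} (h : XG X M) : XG (fun t => c * X t) (fun z => c * M z) := by
  refine ⟨fun z hz => (h.diff z hz).const_mul _, fun z hz => ?_, fun z hz => ?_⟩
  · have := (h.sum z hz).mul_left c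
    have e : (fun t : ℕ => c * X t * z ^ t) = fun t : ℕ => c * (X t * z ^ t) := by funext t; ring
    have e2 : 2 * sfun z * (c * M z) = c * (2 * sfun z * M z) := by ring
    rw [e, e2]; exact this
  · simp only [h.inv z hz]

lemma XG.fsum {ι : Type*} (s : Finset ι) {X : ι → ℕ → ℂ} {M : ι → ℂ → ℂ} (h : ∀ i ∈ s, XG (X i) (M i)) :
    XG (fun t => ∑ i ∈ s, X i t) (fun z => ∑ i ∈ s, M i z) := by
  classical
  induction s using Finset.induction_on with
  | empty => simpa using XG.zero
  | insert a s ha ih =>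
    simp only [Finset.sum_insert ha]
    exact (h a (by simp)).add (ih fun i hi => h i (by simp [hi]))

lemma XG.ite (p : Prop) [Decidable p] {X M} (h : p → XG X M) :
    XG (fun t => if p then X t else 0) (fun z => if p then M z else 0) := by
  by_cases hp : p
  · simpa [hp] using h hp
  · simpa [hp] using XG.zero

/-- the one-index convolution of the recursion -/
noncomputable def conv1 (f : ℕ → ℂ) (c : ℕ) : ℂ :=
  ∑ p ∈ Finset.range (c + 1), if Even (c - p) then (br p : ℂ) * ((c - p : ℕ) : ℂ) * f p else 0

/-- the two-index convolution of the recursion -/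
noncomputable def conv2 (M : ℕ → ℕ → ℂ) (t : ℕ) : ℂ :=
  ∑ p ∈ Finset.range (t + 1), ∑ q ∈ Finset.range (t - p + 1),
    if Even (t - p - q) then (br p : ℂ) * (br q : ℂ) * ((t - p - q : ℕ) : ℂ) * M p q else 0

lemma conv1_sum {f : ℕ → ℂ} (hf : EQ f) {z : ℂ} (hz : ‖z‖ < 1) :
    HasSum (fun t : ℕ => conv1 f t * z ^ t) (2 * sfun z * gf f z) := by
  have h := conv_sum (hf.gf.sum z hz) (evn_sum hz)
  rw [mul_comm (2 * sfun z)]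
  have e : (fun t : ℕ => conv1 f t * z ^ t) = fun t : ℕ => (∑ p ∈ Finset.range (t + 1), (br p : ℂ) * f p * evn (t - p)) * z ^ t := by
    funext t
    unfold conv1 evn
    congr 1
    apply Finset.sum_congr rfl
    intro p _
    split_ifs <;> ring
  rw [e]; exact h

lemma conv2_XG {f f' : ℕ → ℂ} (hf : EQ f) (hf' : EQ f') :
    XG (conv2 (fun p q => f p * f' q)) (fun z => gf f z * gf f' z) := by
  refine ⟨fun z hz => (hf.gf.diff z hz.2.1 hz.2.2).mul (hf'.gf.diff z hz.2.1 hz.2.2), fun z hz => ?_, fun z hz => ?_⟩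
  · have h := conv_sum (hf.gf.sum z hz) (conv1_sum hf' hz)
    have e2 : 2 * sfun z * (gf f z * gf f' z) = gf f z * (2 * sfun z * gf f' z) := by ring
    have e : (fun t : ℕ => conv2 (fun p q => f p * f' q) t * z ^ t) =
        fun t : ℕ => (∑ p ∈ Finset.range (t + 1), (br p : ℂ) * f p * conv1 f' (t - p)) * z ^ t := by
      funext t
      unfold conv2 conv1
      congr 1
      apply Finset.sum_congr rfl
      intro p _
      rw [Finset.mul_sum]
      apply Finset.sum_congr rfl
      intro q _
      split_ifs <;> ring
    rw [e, e2]; exact h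
  · simp only [hf.gf.inv z hz, hf'.gf.inv z hz]

lemma coef_main {m : ℕ} (b : Fin m → ℕ) {N R X : ℕ → ℂ} {M : ℂ → ℂ} {n : Fin m → ℕ → ℂ}
    (hN : EQ N) (hR : EQ R) (hX : XG X M) (hn : ∀ j, EQ (n j))
    (hrel : ∀ t : ℕ, (t : ℂ) * N t = (1 / 2) * X t + ∑ j, conv1 (n j) (t + b j) + R t) :
    ∃ Λ : ℂ → ℂ, (∀ z, z ≠ 0 → DifferentiableAt ℂ Λ z) ∧ ∀ z, XX z →
      gf N z - sfun z * (M z + ∑ j, (z ^ b j + (z ^ b j)⁻¹) * gf (n j) z) = Λ z := by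
  obtain ⟨Φ, hΦ⟩ := hR.exists_PH
  set tr : Fin m → ℂ → ℂ := fun j z => (z ^ b j)⁻¹ * ∑ c ∈ Finset.range (b j), conv1 (n j) c * z ^ c with htr
  have dpow : ∀ (k : ℕ) (z : ℂ), z ≠ 0 → DifferentiableAt ℂ (fun z : ℂ => (z ^ k)⁻¹) z := fun k z hz =>
    DifferentiableAt.inv (by fun_prop) (pow_ne_zero _ hz)
  have dtr : ∀ j z, z ≠ 0 → DifferentiableAt ℂ (tr j) z := by
    intro j z hz
    exact (dpow _ z hz).mul (by fun_prop)
  set G : ℂ → ℂ := fun z => gf N z - N 0 - sfun z * M z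
     - ∑ j, ((z ^ b j)⁻¹ * (2 * sfun z * gf (n j) z) - tr j z) - Φ z with hG
  have G0 : ∀ z, XX z → G z = 0 := by
    apply ident1 (r := 1) _ one_pos
    · intro z hz0 hz1
      have hz := norm_pos_iff.1 hz0
      have h1 : HasSum (fun t : ℕ => (t : ℂ) * N t * z ^ t) (gf N z - N 0) := by
        have h := (hN.gf.sum z hz1).sub (hasSum_ite_eq 0 (N 0))
        have e : (fun t : ℕ => (t : ℂ) * N t * z ^ t) = fun t : ℕ => (br t : ℂ) * N t * z ^ t - if t = 0 then N 0 else 0 := by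
          funext t
          unfold br
          by_cases ht : t = 0
          · subst ht; simp
          · simp [ht]
        rw [e]; exact h
      have h2 := ((hX.sum z hz1).mul_left (1/2)).add
        ((hasSum_sum (s := Finset.univ) (fun j _ => shift_sum hz (conv1_sum (hn j) hz1) (b j))).add (hΦ.sum z hz1))
      have e : (fun t : ℕ => (t : ℂ) * N t * z ^ t) = fun t : ℕ =>
          1 / 2 * (X t * z ^ t) + (∑ j, conv1 (n j) (t + b j) * z ^ t + R t * z ^ t) := by
        funext t
        rw [hrel t, ← Finset.sum_mul]; ring
      rw [e] at h1
      have h3 := h1.unique h2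
      simp only [hG, htr]
      rw [h3]
      simp only [mul_sub]
      ring
    · intro z hz
      simp only [hG]
      apply DifferentiableAt.sub
      · apply DifferentiableAt.sub
        · exact ((hN.gf.diff z hz.2.1 hz.2.2).sub_const _).sub ((sfun_diff hz).mul (hX.diff z hz))
        · apply DifferentiableAt.fun_sum
          intro j _
          exact ((dpow _ z hz.1).mul (((sfun_diff hz).const_mul 2).mul ((hn j).gf.diff z hz.2.1 hz.2.2))).sub (dtr j z hz.1)
      · exact hΦ.diff z hz.2.1 hz.2.2
  refine ⟨fun z => N 0 + R 0 / 2 - (1 / 2) * ∑ j, (tr j z + tr j z⁻¹), ?_, ?_⟩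
  · intro z hz
    apply DifferentiableAt.const_sub
    apply DifferentiableAt.const_mul
    apply DifferentiableAt.fun_sum
    intro j _
    exact (dtr j z hz).add ((dtr j z⁻¹ (inv_ne_zero hz)).comp z (differentiableAt_inv hz))
  · intro z hz
    have A := G0 z hz
    have B := G0 z⁻¹ hz.inv
    simp only [hG] at A B
    have e1 : ∀ j, gf (n j) z⁻¹ = gf (n j) z := fun j => (hn j).gf.inv z hz
    simp only [hN.gf.inv z hz, hX.inv z hz, sfun_inv hz, e1, inv_pow, inv_inv] at B
    have C := hΦ.inv z hz
    simp only [Finset.sum_sub_distrib, Finset.sum_add_distrib, add_mul, mul_add] at A B ⊢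
    have S1 : ∀ u : Fin m → ℂ, ∑ j, u j * (2 * sfun z * gf (n j) z) = 2 * (sfun z * ∑ j, u j * gf (n j) z) := by
      intro u
      rw [Finset.mul_sum, Finset.mul_sum]
      exact Finset.sum_congr rfl fun j _ => by ring
    rw [S1] at A B
    linear_combination (A + B + C) / 2

lemma castite (p : Prop) [Decidable p] (a b : ℚ) : ((if p then a else b : ℚ) : ℂ) = if p then (a : ℂ) else (b : ℂ) := by
  split_ifs <;> rfl

lemma EQ.prod {ι : Type*} (s : Finset ι) {f : ι → ℕ → ℂ} (hf : ∀ i ∈ s, EQ (f i)) : EQ (fun t => ∏ i ∈ s, f i t) := by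
  classical
  induction s using Finset.induction_on with
  | empty => simpa using EQ.const 1
  | insert a s ha ih =>
    simp only [Finset.prod_insert ha]
    exact (hf a (by simp)).mul (ih fun i hi => hf i (by simp [hi]))

lemma EQ.smul (c : ℂ) {f : ℕ → ℂ} (hf : EQ f) : EQ (fun t => c * f t) := (EQ.const c).mul hf

lemma N_EQ (Nf : LatticeCountFamily) (g : ℕ) (α : Type) [Fintype α] [DecidableEq α]
    (h : 3 ≤ 2 * g + Fintype.card α) (c : ℕ → α → ℕ)
    (hc : ∀ a, (∀ t, c t a = t) ∨ ∃ k, ∀ t, c t a = k) : EQ (fun t => (Nf.N g α (c t) : ℂ)) := by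
  obtain ⟨ι, T, co, f, hr⟩ := N_rep Nf g α h
  have e : (fun t => (Nf.N g α (c t) : ℂ)) = fun t => ∑ τ ∈ T, co τ * ∏ a, f τ a (c t a) := by
    funext t; exact hr.rep (c t)
  rw [e]
  apply EQ.sum
  intro τ _
  apply EQ.smul
  apply EQ.prod
  intro a _
  rcases hc a with h | ⟨k, h⟩
  · simp only [h]; exact hr.eq τ a
  · simp only [h]; exact EQ.const _

lemma N_opt_congr (Nf : LatticeCountFamily) (g : ℕ) {β γ : Type} [Fintype β] [DecidableEq β] [Fintype γ] [DecidableEq γ]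
    (e : β ≃ γ) (p : ℕ) (u : β → ℕ) (v : γ → ℕ) (huv : ∀ a, u a = v (e a)) :
    Nf.N g (Option β) (fun x => Option.elim x p u) = Nf.N g (Option γ) (fun x => Option.elim x p v) := by
  rw [← Nf.symm g (Option β) (Option γ) (Equiv.optionCongr e)]
  congr 1
  funext x
  cases x <;> simp [huv]

lemma N_opt2_congr (Nf : LatticeCountFamily) (g : ℕ) {β γ : Type} [Fintype β] [DecidableEq β] [Fintype γ] [DecidableEq γ]
    (e : β ≃ γ) (p q : ℕ) (u : β → ℕ) (v : γ → ℕ) (huv : ∀ a, u a = v (e a)) :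
    Nf.N g (Option (Option β)) (fun x => Option.elim x p (fun y => Option.elim y q u)) =
      Nf.N g (Option (Option γ)) (fun x => Option.elim x p (fun y => Option.elim y q v)) := by
  apply N_opt_congr Nf g (Equiv.optionCongr e)
  intro x
  cases x <;> simp [huv]

def N1 (Nf : LatticeCountFamily) (g : ℕ) {m : ℕ} (b : Fin m → ℕ) (p : ℕ) : ℂ :=
  ((Nf.N g (Option (Fin m)) (fun x => Option.elim x p b) : ℚ) : ℂ)

def Nred (Nf : LatticeCountFamily) (g : ℕ) {m : ℕ} (I : Finset (Fin m)) (b : Fin m → ℕ) (p : ℕ) : ℂ :=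
  ((Nf.N g (Option {x // x ∈ I}) (fun x => Option.elim x p (fun a => b a.1)) : ℚ) : ℂ)

def N2 (Nf : LatticeCountFamily) (g : ℕ) {m : ℕ} (b : Fin m → ℕ) (p q : ℕ) : ℂ :=
  ((Nf.N g (Option (Option (Fin m))) (fun x => Option.elim x p (fun y => Option.elim y q b)) : ℚ) : ℂ)

lemma N1_EQ (Nf : LatticeCountFamily) {g m : ℕ} (h : 3 ≤ 2 * g + (m + 1)) (b : Fin m → ℕ) : EQ (N1 Nf g b) := by
  apply N_EQ Nf g (Option (Fin m)) (by simpa using h) (fun p x => Option.elim x p b)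
  rintro (_ | a)
  · left; intro t; rfl
  · right; exact ⟨b a, fun t => rfl⟩

lemma Nred_EQ (Nf : LatticeCountFamily) {g m : ℕ} {I : Finset (Fin m)} (h : 3 ≤ 2 * g + (I.card + 1)) (b : Fin m → ℕ) :
    EQ (Nred Nf g I b) := by
  apply N_EQ Nf g (Option {x // x ∈ I}) (by simpa using h) (fun p x => Option.elim x p (fun a => b a.1))
  rintro (_ | a)
  · left; intro t; rfl
  · right; exact ⟨b a, fun t => rfl⟩

noncomputable def eNone (m : ℕ) : Fin m ≃ {a : Option (Fin m) // a ≠ none} :=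
  Equiv.ofBijective (fun x => ⟨some x, by simp⟩) (by
    constructor
    · intro x y h; simpa using h
    · rintro ⟨_ | a, h⟩
      · exact absurd rfl h
      · exact ⟨a, rfl⟩)

noncomputable def eJ1 {m : ℕ} (j : Fin m) : {x // x ∈ ({j}ᶜ : Finset (Fin m))} ≃ {a : Option (Fin m) // a ≠ none ∧ a ≠ some j} :=
  Equiv.ofBijective (fun x => ⟨some x.1, by have := Finset.mem_compl.1 x.2; rw [Finset.mem_singleton] at this; simp [this]⟩) (by
    constructor
    · rintro ⟨x, hx⟩ ⟨y, hy⟩ h; simpa using h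
    · rintro ⟨_ | a, h⟩
      · exact absurd rfl h.1
      · exact ⟨⟨a, by simpa using h.2⟩, rfl⟩)

noncomputable def eJ2 {m : ℕ} (j : Fin m) : {x // x ∈ ({j}ᶜ : Finset (Fin m))} ≃ {a : Option (Fin m) // a ≠ some j ∧ a ≠ none} :=
  Equiv.ofBijective (fun x => ⟨some x.1, by have := Finset.mem_compl.1 x.2; rw [Finset.mem_singleton] at this; simp [this]⟩) (by
    constructor
    · rintro ⟨x, hx⟩ ⟨y, hy⟩ h; simpa using h
    · rintro ⟨_ | a, h⟩
      · exact absurd rfl h.2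
      · exact ⟨⟨a, by simpa using h.1⟩, rfl⟩)

def Bt {m : ℕ} (b : Fin m → ℕ) (t : ℕ) : Option (Fin m) → ℕ := fun x => Option.elim x t b

lemma Bt_some {m : ℕ} (b : Fin m → ℕ) (t : ℕ) (i : Fin m) : Bt b t (some i) = b i := rfl

lemma Bt_cases {m : ℕ} (b : Fin m → ℕ) (x : Option (Fin m)) :
    (∀ t, Bt b t x = t) ∨ ∃ k, ∀ t, Bt b t x = k := by
  cases x with
  | none => left; intro t; rfl
  | some a => right; exact ⟨b a, fun t => rfl⟩

/-- pair term -/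
noncomputable def Tm (Nf : LatticeCountFamily) (g : ℕ) {α : Type} [Fintype α] [DecidableEq α] (b : α → ℕ) (i j : α) : ℚ :=
  ∑ p ∈ Finset.range (b i + b j + 1),
            (if Even (b i + b j - p) then
              (br p : ℚ) * ((b i + b j - p : ℕ) : ℚ) *
                Nf.N g (Option {a : α // a ≠ i ∧ a ≠ j})
                  (fun x => Option.elim x p (fun a => b a.1))
             else 0)

/-- inner bracket -/
noncomputable def Bm (Nf : LatticeCountFamily) (g : ℕ) {α : Type} [Fintype α] [DecidableEq α] (b : α → ℕ) (i : α) (p q : ℕ) : ℚ :=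
  ((if g = 0 then 0 else
                    Nf.N (g - 1) (Option (Option {a : α // a ≠ i}))
                      (fun x => Option.elim x p
                        (fun y => Option.elim y q (fun a => b a.1))))
                  + ∑ g₁ ∈ Finset.range (g + 1),
                      ∑ I ∈ (Finset.univ : Finset {a : α // a ≠ i}).powerset,
                        (if 3 ≤ 2 * g₁ + (I.card + 1) ∧ 3 ≤ 2 * (g - g₁) + (Iᶜ.card + 1) then
                          Nf.N g₁ (Option {x : {a : α // a ≠ i} // x ∈ I})
                            (fun x => Option.elim x p (fun a => b a.1.1)) *
                          Nf.N (g - g₁) (Option {x : {a : α // a ≠ i} // x ∈ Iᶜ})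
                            (fun x => Option.elim x q (fun a => b a.1.1))
                         else 0))

noncomputable def Xm (Nf : LatticeCountFamily) (g : ℕ) {α : Type} [Fintype α] [DecidableEq α] (b : α → ℕ) (i : α) : ℚ :=
  ∑ p ∈ Finset.range (b i + 1), ∑ q ∈ Finset.range (b i - p + 1),
            (if Even (b i - p - q) then
              (br p : ℚ) * (br q : ℚ) * ((b i - p - q : ℕ) : ℚ) * Bm Nf g b i p q
             else 0)

lemma rec_short (Nf : LatticeCountFamily) (g : ℕ) (α : Type) [Fintype α] [DecidableEq α]
    (h : 4 ≤ 2 * g + Fintype.card α) (b : α → ℕ) :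
    (∑ i, (b i : ℚ)) * Nf.N g α b = (1 / 2) * (∑ i, ∑ j ∈ Finset.univ.filter (fun j => j ≠ i), Tm Nf g b i j)
      + (1 / 2) * ∑ i, Xm Nf g b i := Nf.recursion g α h b

lemma Tm_none_some (Nf : LatticeCountFamily) (g : ℕ) {m : ℕ} (b : Fin m → ℕ) (t : ℕ) (j : Fin m) :
    ((Tm Nf g (Bt b t) none (some j) : ℚ) : ℂ) = conv1 (Nred Nf g {j}ᶜ b) (t + b j) := by
  unfold Tm conv1 Nred
  push_cast [castite]
  apply Finset.sum_congr rfl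
  intro p _
  rw [N_opt_congr Nf g (eJ1 j) p (fun a => b a.1) (fun a => Bt b t a.1) (fun a => rfl)]
  rfl

lemma Tm_some_none (Nf : LatticeCountFamily) (g : ℕ) {m : ℕ} (b : Fin m → ℕ) (t : ℕ) (j : Fin m) :
    ((Tm Nf g (Bt b t) (some j) none : ℚ) : ℂ) = conv1 (Nred Nf g {j}ᶜ b) (t + b j) := by
  unfold Tm conv1 Nred
  push_cast [castite]
  rw [show Bt b t (some j) + Bt b t none = t + b j from add_comm _ _]
  apply Finset.sum_congr rfl
  intro p _
  rw [N_opt_congr Nf g (eJ2 j) p (fun a => b a.1) (fun a => Bt b t a.1) (fun a => rfl)]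

lemma card_ne2 {α : Type} [Fintype α] [DecidableEq α] {i j : α} (h : i ≠ j) :
    Fintype.card (Option {a : α // a ≠ i ∧ a ≠ j}) + 1 = Fintype.card α := by
  have h1 : Fintype.card {a : α // a ≠ i ∧ a ≠ j} = (({i, j} : Finset α)ᶜ).card := by
    rw [Fintype.card_subtype]
    congr 1
    ext a; simp
  rw [Fintype.card_option, h1, Finset.card_compl, Finset.card_pair h]
  have : 2 ≤ Fintype.card α := by
    rw [← Finset.card_pair h]; exact Finset.card_le_univ _
  omega

lemma card_ne1 {α : Type} [Fintype α] [DecidableEq α] (i : α) :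
    Fintype.card (Option (Option {a : α // a ≠ i})) = Fintype.card α + 1 := by
  have h1 : Fintype.card {a : α // a ≠ i} = (({i} : Finset α)ᶜ).card := by
    rw [Fintype.card_subtype]
    congr 1
    ext a; simp
  rw [Fintype.card_option, Fintype.card_option, h1, Finset.card_compl, Finset.card_singleton]
  have : 0 < Fintype.card α := Fintype.card_pos_iff.2 ⟨i⟩
  omega

lemma EQ_ite' (p : Prop) {inst : ℕ → Decidable p} {f : ℕ → ℂ} (hf : p → EQ f) :
    EQ (fun t => @ite ℂ p (inst t) (f t) 0) := by
  by_cases h : p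
  · simpa [h] using hf h
  · simpa [h] using EQ.const 0

lemma Tm_EQ (Nf : LatticeCountFamily) {g m : ℕ} (h : 4 ≤ 2 * g + (m + 1)) (b : Fin m → ℕ) {i j : Fin m} (hij : j ≠ i) :
    EQ (fun t => ((Tm Nf g (Bt b t) (some i) (some j) : ℚ) : ℂ)) := by
  unfold Tm
  push_cast [castite]
  simp only [Bt_some]
  apply EQ.sum
  intro p _
  apply EQ_ite'
  intro _
  apply EQ.smul
  apply N_EQ
  · have := card_ne2 (i := some i) (j := some j) (by simpa using hij.symm)
    simp only [Fintype.card_option, Fintype.card_fin] at this ⊢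
    omega
  · rintro (_ | a)
    · right; exact ⟨p, fun t => rfl⟩
    · exact Bt_cases b a.1

lemma Xm_EQ (Nf : LatticeCountFamily) {g m : ℕ} (h : 4 ≤ 2 * g + (m + 1)) (b : Fin m → ℕ) (i : Fin m) :
    EQ (fun t => ((Xm Nf g (Bt b t) (some i) : ℚ) : ℂ)) := by
  unfold Xm
  push_cast [castite]
  simp only [Bt_some]
  apply EQ.sum
  intro p _
  apply EQ.sum
  intro q _
  apply EQ_ite'
  intro _
  apply EQ.smul
  unfold Bm
  push_cast [castite]
  apply EQ.add
  · by_cases hg : g = 0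
    · simp only [hg, if_true]; exact EQ.const 0
    · simp only [hg, if_false]
      apply N_EQ
      · have := card_ne1 (some i)
        simp only [Fintype.card_option, Fintype.card_fin] at this ⊢
        omega
      · rintro (_ | _ | a)
        · right; exact ⟨p, fun t => rfl⟩
        · right; exact ⟨q, fun t => rfl⟩
        · exact Bt_cases b a.1
  · apply EQ.sum
    intro g₁ _
    apply EQ.sum
    intro I _
    apply EQ.ite
    intro hI
    apply EQ.mul
    · apply N_EQ
      · rw [Fintype.card_option, Fintype.card_coe]; exact hI.1
      · rintro (_ | a)
        · right; exact ⟨p, fun t => rfl⟩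
        · exact Bt_cases b a.1.1
    · apply N_EQ
      · rw [Fintype.card_option, Fintype.card_coe]; exact hI.2
      · rintro (_ | a)
        · right; exact ⟨q, fun t => rfl⟩
        · exact Bt_cases b a.1.1

lemma Bm_none (Nf : LatticeCountFamily) (g : ℕ) {m : ℕ} (b : Fin m → ℕ) (t p q : ℕ) :
    ((Bm Nf g (Bt b t) none p q : ℚ) : ℂ) = (if g = 0 then 0 else N2 Nf (g - 1) b p q) +
      ∑ g₁ ∈ Finset.range (g + 1), ∑ I : Finset (Fin m),
        if 3 ≤ 2 * g₁ + (I.card + 1) ∧ 3 ≤ 2 * (g - g₁) + (Iᶜ.card + 1) then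
          Nred Nf g₁ I b p * Nred Nf (g - g₁) Iᶜ b q else 0 := by
  unfold Bm
  push_cast [castite]
  congr 1
  · split_ifs
    · rfl
    · unfold N2
      rw [N_opt2_congr Nf (g-1) (eNone m) p q b (fun a => Bt b t a.1) (fun a => rfl)]
  · apply Finset.sum_congr rfl
    intro g₁ _
    rw [Finset.powerset_univ, ← Equiv.sum_comp (Equiv.finsetCongr (eNone m))]
    apply Finset.sum_congr rfl
    intro I _
    have hc : (I.map (eNone m).toEmbedding)ᶜ = Iᶜ.map (eNone m).toEmbedding := by
      ext x
      simp only [Finset.mem_compl, Finset.mem_map_equiv]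
    have key : ∀ (g' : ℕ) (J : Finset (Fin m)) (r : ℕ),
        (Nf.N g' (Option {x // x ∈ J.map (eNone m).toEmbedding}) (fun x => Option.elim x r (fun a => Bt b t a.1.1)) : ℂ)
        = Nred Nf g' J b r := by
      intro g' J r
      unfold Nred
      rw [N_opt_congr Nf g' ((eNone m).subtypeEquiv (p := fun x => x ∈ J)
        (q := fun x => x ∈ J.map (eNone m).toEmbedding) (fun a => by simp)) r (fun a => b a.1)
        (fun a => Bt b t a.1.1) (fun a => rfl)]
    rw [Equiv.finsetCongr_apply, hc]
    simp only [Finset.card_map, key]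

lemma conv2_add (M L : ℕ → ℕ → ℂ) (t : ℕ) : conv2 (fun p q => M p q + L p q) t = conv2 M t + conv2 L t := by
  unfold conv2
  rw [← Finset.sum_add_distrib]
  apply Finset.sum_congr rfl
  intro p _
  rw [← Finset.sum_add_distrib]
  apply Finset.sum_congr rfl
  intro q _
  split_ifs <;> ring

lemma conv2_zero (t : ℕ) : conv2 (fun _ _ => 0) t = 0 := by
  unfold conv2; simp

lemma conv2_smul (c : ℂ) (M : ℕ → ℕ → ℂ) (t : ℕ) : conv2 (fun p q => c * M p q) t = c * conv2 M t := by
  unfold conv2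
  rw [Finset.mul_sum]
  apply Finset.sum_congr rfl
  intro p _
  rw [Finset.mul_sum]
  apply Finset.sum_congr rfl
  intro q _
  split_ifs <;> ring

lemma conv2_sum {ι : Type*} (s : Finset ι) (M : ι → ℕ → ℕ → ℂ) (t : ℕ) :
    conv2 (fun p q => ∑ i ∈ s, M i p q) t = ∑ i ∈ s, conv2 (M i) t := by
  classical
  induction s using Finset.induction_on with
  | empty => simp [conv2_zero]
  | insert a s ha ih => simp only [Finset.sum_insert ha, conv2_add, ih]

/-- `XG` for a symbol of two arguments -/
def XG2 (M : ℕ → ℕ → ℂ) (L : ℂ → ℂ) : Prop := XG (conv2 M) L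

lemma XG2.add {M M' L L'} (h : XG2 M L) (h' : XG2 M' L') : XG2 (fun p q => M p q + M' p q) (fun z => L z + L' z) := by
  unfold XG2
  have e : conv2 (fun p q => M p q + M' p q) = fun t => conv2 M t + conv2 M' t := by funext t; exact conv2_add _ _ t
  rw [e]; exact XG.add h h'

lemma XG2.smul (c : ℂ) {M L} (h : XG2 M L) : XG2 (fun p q => c * M p q) (fun z => c * L z) := by
  unfold XG2
  have e : conv2 (fun p q => c * M p q) = fun t => c * conv2 M t := by funext t; exact conv2_smul _ _ t
  rw [e]; exact XG.smul c h

lemma XG2.fsum {ι : Type*} (s : Finset ι) {M : ι → ℕ → ℕ → ℂ} {L : ι → ℂ → ℂ} (h : ∀ i ∈ s, XG2 (M i) (L i)) :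
    XG2 (fun p q => ∑ i ∈ s, M i p q) (fun z => ∑ i ∈ s, L i z) := by
  unfold XG2
  have e : conv2 (fun p q => ∑ i ∈ s, M i p q) = fun t => ∑ i ∈ s, conv2 (M i) t := by funext t; exact conv2_sum _ _ t
  rw [e]; exact XG.fsum s h

lemma XG2.zero : XG2 (fun _ _ => 0) (fun _ => 0) := by
  unfold XG2
  have e : conv2 (fun _ _ => 0) = fun _ => 0 := by funext t; exact conv2_zero t
  rw [e]; exact XG.zero

lemma XG2.ite (p : Prop) [Decidable p] {M L} (h : p → XG2 M L) :
    XG2 (fun a b => if p then M a b else 0) (fun z => if p then L z else 0) := by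
  by_cases hp : p
  · simpa [hp] using h hp
  · simpa [hp] using XG2.zero

/-- generating function attached to a representation of the two-point symbol -/
noncomputable def M2h {m : ℕ} {ι : Type} (T : Finset ι) (c : ι → ℂ) (f : ι → Option (Option (Fin m)) → ℕ → ℂ)
    (b : Fin m → ℕ) (z z' : ℂ) : ℂ :=
  ∑ τ ∈ T, c τ * (gf (f τ none) z * gf (f τ (some none)) z' * ∏ j, f τ (some (some j)) (b j))

lemma N2_XG {Nf : LatticeCountFamily} {g m : ℕ} {ι T c f}
    (hr : PRep (fun b => (Nf.N g (Option (Option (Fin m))) b : ℂ)) ι T c f) (b : Fin m → ℕ) :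
    XG2 (N2 Nf g b) (fun z => M2h T c f b z z) := by
  have e : N2 Nf g b = fun p q => ∑ τ ∈ T, (c τ * ∏ j, f τ (some (some j)) (b j)) * (f τ none p * f τ (some none) q) := by
    funext p q
    unfold N2
    have := hr.rep (fun x => Option.elim x p (fun y => Option.elim y q b))
    rw [this]
    apply Finset.sum_congr rfl
    intro τ _
    rw [Fintype.prod_option, Fintype.prod_option]
    simp only [Option.elim]
    ring
  have e2 : (fun z => M2h T c f b z z) = fun z => ∑ τ ∈ T, (c τ * ∏ j, f τ (some (some j)) (b j)) * (gf (f τ none) z * gf (f τ (some none)) z) := by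
    funext z
    unfold M2h
    apply Finset.sum_congr rfl
    intro τ _
    ring
  rw [e, e2]
  apply XG2.fsum
  intro τ _
  apply XG2.smul
  exact conv2_XG (hr.eq _ _) (hr.eq _ _)

lemma coef_general (Nf : LatticeCountFamily) {g m : ℕ} (h : 4 ≤ 2 * g + (m + 1)) (b : Fin m → ℕ) {ι T c f}
    (hr : g ≠ 0 → PRep (fun b => (Nf.N (g - 1) (Option (Option (Fin m))) b : ℂ)) ι T c f) :
    ∃ Λ : ℂ → ℂ, (∀ z, z ≠ 0 → DifferentiableAt ℂ Λ z) ∧ ∀ z, XX z →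
      gf (N1 Nf g b) z - sfun z * (((if g = 0 then 0 else M2h T c f b z z) +
        ∑ g₁ ∈ Finset.range (g + 1), ∑ I : Finset (Fin m),
          if 3 ≤ 2 * g₁ + (I.card + 1) ∧ 3 ≤ 2 * (g - g₁) + (Iᶜ.card + 1) then
            gf (Nred Nf g₁ I b) z * gf (Nred Nf (g - g₁) Iᶜ b) z else 0)
        + ∑ j, (z ^ b j + (z ^ b j)⁻¹) * gf (Nred Nf g {j}ᶜ b) z) = Λ z := by
  set BB : ℕ → ℕ → ℂ := fun p q => (if g = 0 then 0 else N2 Nf (g - 1) b p q) +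
      ∑ g₁ ∈ Finset.range (g + 1), ∑ I : Finset (Fin m),
        if 3 ≤ 2 * g₁ + (I.card + 1) ∧ 3 ≤ 2 * (g - g₁) + (Iᶜ.card + 1) then
          Nred Nf g₁ I b p * Nred Nf (g - g₁) Iᶜ b q else 0 with hBB
  have hX : XG2 BB (fun z => (if g = 0 then 0 else M2h T c f b z z) +
        ∑ g₁ ∈ Finset.range (g + 1), ∑ I : Finset (Fin m),
          if 3 ≤ 2 * g₁ + (I.card + 1) ∧ 3 ≤ 2 * (g - g₁) + (Iᶜ.card + 1) then
            gf (Nred Nf g₁ I b) z * gf (Nred Nf (g - g₁) Iᶜ b) z else 0) := by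
    apply XG2.add
    · by_cases hg : g = 0
      · simp only [hg, if_true]; exact XG2.zero
      · simp only [hg, if_false]; exact N2_XG (hr hg) b
    · apply XG2.fsum
      intro g₁ _
      apply XG2.fsum
      intro I _
      apply XG2.ite
      intro hI
      exact conv2_XG (Nred_EQ Nf hI.1 b) (Nred_EQ Nf hI.2 b)
  have hn : ∀ j : Fin m, EQ (Nred Nf g {j}ᶜ b) := by
    intro j
    apply Nred_EQ
    rw [Finset.card_compl, Finset.card_singleton, Fintype.card_fin]
    have := j.pos
    omega
  set R : ℕ → ℂ := fun t => (-(∑ j, (b j : ℂ))) * N1 Nf g b t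
     + ((1 / 2) * (∑ i, ∑ j, if j ≠ i then ((Tm Nf g (Bt b t) (some i) (some j) : ℚ) : ℂ) else 0)
      + (1 / 2) * ∑ i, ((Xm Nf g (Bt b t) (some i) : ℚ) : ℂ)) with hR
  have hREQ : EQ R := by
    apply EQ.add
    · exact (N1_EQ Nf (by omega) b).smul _
    · apply EQ.add
      · apply EQ.smul
        apply EQ.sum
        intro i _
        apply EQ.sum
        intro j _
        apply EQ.ite
        intro hij
        exact Tm_EQ Nf h b hij
      · apply EQ.smul
        apply EQ.sum
        intro i _
        exact Xm_EQ Nf h b i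
  refine coef_main b (N1_EQ Nf (by omega) b) hREQ hX hn ?_
  intro t
  have h1 := rec_short Nf g (Option (Fin m)) (by simpa using h) (Bt b t)
  have h2 := congrArg (fun x : ℚ => (x : ℂ)) h1
  simp only [Finset.sum_filter, Fintype.sum_option] at h2
  push_cast [castite] at h2
  simp only [Tm_none_some, Tm_some_none] at h2
  have hXn : ((Xm Nf g (Bt b t) none : ℚ) : ℂ) = conv2 BB t := by
    unfold Xm conv2
    push_cast [castite]
    simp only [Bm_none]
    rfl
  have hN : ((Nf.N g (Option (Fin m)) (Bt b t) : ℚ) : ℂ) = N1 Nf g b t := rfl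
  rw [hXn, hN] at h2
  simp only [ne_eq, not_true_eq_false, if_false, reduceCtorEq, not_false_eq_true, if_true, zero_add,
    Finset.sum_add_distrib, Option.some.injEq] at h2
  have hb : ((Bt b t none : ℕ) : ℂ) = t := rfl
  have hb2 : ∀ j, ((Bt b t (some j) : ℕ) : ℂ) = b j := fun _ => rfl
  simp only [hb, hb2] at h2
  simp only [hR, ne_eq]
  linear_combination h2

lemma circleIntegral_zero' (c : ℂ) (ε : ℝ) : (∮ _z in C(c, ε), (0:ℂ)) = 0 := by
  simp [circleIntegral]

lemma circleIntegral_fsum {ι : Type*} {s : Finset ι} {f : ι → ℂ → ℂ} {c : ℂ} {ε : ℝ} (h : ∀ i ∈ s, CircleIntegrable (f i) c ε) :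
    (∮ z in C(c, ε), ∑ i ∈ s, f i z) = ∑ i ∈ s, ∮ z in C(c, ε), f i z := by
  unfold circleIntegral
  rw [← intervalIntegral.integral_finsetSum]
  · simp only [Finset.smul_sum]
  · intro i hi
    exact (h i hi).out

def okp (z w : ℂ) : Prop := z ≠ w ∧ z * w ≠ 1

structure Y1 (y : ℂ → ℕ → ℂ) (Y : ℂ → ℂ → ℂ) : Prop where
  cont : ∀ b, ContinuousOn (fun z => y z b) {z | XX z}
  bd : ∃ C : ℝ, ∀ z : ℂ, 3/4 ≤ ‖z‖ → ‖z‖ ≤ 5/4 → ∀ b : ℕ, ‖(br b : ℂ) * y z b‖ ≤ C * 4 ^ b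
  sum : ∀ z w : ℂ, 3/4 ≤ ‖z‖ → ‖z‖ ≤ 5/4 → XX z → 0 < ‖w‖ → ‖w‖ < 1/8 →
    HasSum (fun b : ℕ => (br b : ℂ) * y z b * w ^ b) (w * Y z w)
  sep : ∃ (n : ℕ) (A C : Fin n → ℂ → ℂ), (∀ l, ContinuousOn (A l) {z | XX z}) ∧
    (∀ l w, XX w → DifferentiableAt ℂ (C l) w) ∧
    ∀ z w, XX z → XX w → okp z w → (z - w) ^ 2 * (1 - z * w) ^ 2 * Y z w = ∑ l, A l z * C l w

lemma circ_hasSum {ι : Type} [Countable ι] {c : ℂ} {ε : ℝ} (hε : 0 < ε) {φ : ι → ℂ → ℂ} {Φ : ℂ → ℂ} {u : ι → ℝ}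
    (hc : ∀ i, ContinuousOn (φ i) (Metric.sphere c ε)) (hb : ∀ i, ∀ z ∈ Metric.sphere c ε, ‖φ i z‖ ≤ u i)
    (hu : Summable u) (hs : ∀ z ∈ Metric.sphere c ε, HasSum (fun i => φ i z) (Φ z)) :
    HasSum (fun i => ∮ z in C(c, ε), φ i z) (∮ z in C(c, ε), Φ z) := by
  unfold circleIntegral
  apply intervalIntegral.hasSum_integral_of_dominated_convergence (bound := fun i _ => ε * u i)
  · intro i
    apply Continuous.aestronglyMeasurable
    apply Continuous.fun_smul
    · have e : deriv (circleMap c ε) = fun θ => circleMap 0 ε θ * Complex.I := by funext θ; rw [deriv_circleMap]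
      rw [e]; fun_prop
    · exact (hc i).comp_continuous (continuous_circleMap c ε) (fun θ => circleMap_mem_sphere c hε.le θ)
  · intro i
    filter_upwards with θ _
    rw [norm_smul]
    simp only [deriv_circleMap, norm_mul, Complex.norm_I, mul_one, norm_circleMap_zero, abs_of_pos hε]
    exact mul_le_mul_of_nonneg_left (hb i _ (circleMap_mem_sphere c hε.le θ)) hε.le
  · filter_upwards with θ _
    exact hu.mul_left _
  · simp
  · filter_upwards with θ _
    exact (hs _ (circleMap_mem_sphere c hε.le θ)).const_smul _

inductive RepI {m : ℕ} : Finset (Fin m) → (ℂ → (Fin m → ℕ) → ℂ) → (ℂ → (Fin m → ℂ) → ℂ) → Prop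
  | prod (I : Finset (Fin m)) (a : ℂ → ℂ) (ha : ContinuousOn a {z | XX z}) (y : Fin m → ℂ → ℕ → ℂ) (Y : Fin m → ℂ → ℂ → ℂ)
      (h : ∀ j ∈ I, Y1 (y j) (Y j)) :
      RepI I (fun z b => a z * ∏ j ∈ I, y j z (b j)) (fun z w => a z * ∏ j ∈ I, Y j z (w j))
  | zero (I : Finset (Fin m)) : RepI I (fun _ _ => 0) (fun _ _ => 0)
  | add (I : Finset (Fin m)) (F V F' V') : RepI I F V → RepI I F' V' →
      RepI I (fun z b => F z b + F' z b) (fun z w => V z w + V' z w)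
  | congr (I : Finset (Fin m)) (F V F' V') : RepI I F V → (∀ z, XX z → ∀ b, F z b = F' z b) →
      (∀ z w, XX z → (∀ j, XX (w j)) → (∀ j, okp z (w j)) → V z w = V' z w) → RepI I F' V'

lemma RepI.mul {m : ℕ} {I : Finset (Fin m)} {F V F' V'} (h : RepI I F V) (h' : RepI Iᶜ F' V') :
    RepI Finset.univ (fun z b => F z b * F' z b) (fun z w => V z w * V' z w) := by
  classical
  induction h with
  | prod a ha y Y h =>
    induction h' with
    | prod a' ha' y' Y' h' =>
      refine RepI.congr _ _ _ _ _ (RepI.prod Finset.univ (fun z => a z * a' z) (ha.mul ha')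
        (fun j => if j ∈ I then y j else y' j) (fun j => if j ∈ I then Y j else Y' j) ?_) ?_ ?_
      · intro j _
        by_cases hj : j ∈ I
        · simpa [hj] using h j hj
        · simpa [hj] using h' j (by simpa using hj)
      · intro z _ b
        rw [← Finset.prod_mul_prod_compl I]
        rw [Finset.prod_congr rfl (g := fun j => y j z (b j)) (s₂ := I), Finset.prod_congr rfl (g := fun j => y' j z (b j)) (s₂ := Iᶜ)]
        · ring
        · intro x hx; simp [Finset.mem_compl.1 hx]
        · intro x hx; simp [hx]
      · intro z w _ _ _
        rw [← Finset.prod_mul_prod_compl I]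
        rw [Finset.prod_congr rfl (g := fun j => Y j z (w j)) (s₂ := I), Finset.prod_congr rfl (g := fun j => Y' j z (w j)) (s₂ := Iᶜ)]
        · ring
        · intro x hx; simp [Finset.mem_compl.1 hx]
        · intro x hx; simp [hx]
    | zero => simpa using RepI.zero Finset.univ
    | add F V F' V' _ _ h1 h2 =>
      have := RepI.add _ _ _ _ _ h1 h2
      simpa only [mul_add] using this
    | congr F V F' V' _ e1 e2 h1 =>
      exact RepI.congr _ _ _ _ _ h1 (fun z hz b => by rw [e1 z hz]) (fun z w hz hw hq => by rw [e2 z w hz hw hq])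
  | zero => simpa using RepI.zero Finset.univ
  | add F V F' V' _ _ h1 h2 =>
    have := RepI.add _ _ _ _ _ h1 h2
    simpa only [add_mul] using this
  | congr F V F' V' _ e1 e2 h1 =>
    exact RepI.congr _ _ _ _ _ h1 (fun z hz b => by rw [e1 z hz]) (fun z w hz hw hq => by rw [e2 z w hz hw hq])

lemma RepI.smul {m : ℕ} {I : Finset (Fin m)} {F V} (h : RepI I F V) {s : ℂ → ℂ} (hs : ContinuousOn s {z | XX z}) :
    RepI I (fun z b => s z * F z b) (fun z w => s z * V z w) := by
  induction h with
  | prod a ha y Y h =>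
    simpa only [mul_assoc] using RepI.prod I (fun z => s z * a z) (hs.mul ha) y Y h
  | zero => simpa using RepI.zero I
  | add F V F' V' _ _ h1 h2 =>
    have := RepI.add _ _ _ _ _ h1 h2
    simpa only [mul_add] using this
  | congr F V F' V' _ e1 e2 h1 =>
    exact RepI.congr _ _ _ _ _ h1 (fun z hz b => by rw [e1 z hz]) (fun z w hz hw hq => by rw [e2 z w hz hw hq])

lemma RepI.fsum {m : ℕ} {I : Finset (Fin m)} {ι : Type} (s : Finset ι) {F : ι → ℂ → (Fin m → ℕ) → ℂ} {V : ι → ℂ → (Fin m → ℂ) → ℂ}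
    (h : ∀ i ∈ s, RepI I (F i) (V i)) : RepI I (fun z b => ∑ i ∈ s, F i z b) (fun z w => ∑ i ∈ s, V i z w) := by
  classical
  induction s using Finset.induction_on with
  | empty => simpa using RepI.zero I
  | insert a s ha ih =>
    simp only [Finset.sum_insert ha]
    exact RepI.add _ _ _ _ _ (h a (by simp)) (ih (fun i hi => h i (by simp [hi])))

lemma okp.ne {z w : ℂ} (h : okp z w) : (z - w) ^ 2 * (1 - z * w) ^ 2 ≠ 0 :=
  mul_ne_zero (pow_ne_zero _ (sub_ne_zero.2 h.1)) (pow_ne_zero _ (sub_ne_zero.2 (Ne.symm h.2)))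

lemma RepI.contF {m : ℕ} {I : Finset (Fin m)} {F V} (h : RepI I F V) (b) : ContinuousOn (fun z => F z b) {z | XX z} := by
  induction h with
  | prod a ha y Y h => exact ha.mul (continuousOn_finsetProd _ (fun j hj => (h j hj).cont _))
  | zero => exact continuousOn_const
  | add F V F' V' _ _ h1 h2 => exact h1.add h2
  | congr F V F' V' _ e1 e2 h1 => exact h1.congr (fun z hz => (e1 z hz b).symm)

lemma RepI.contV {m : ℕ} {I : Finset (Fin m)} {F V} (h : RepI I F V) (w : Fin m → ℂ) (hw : ∀ j, XX (w j)) :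
    ContinuousOn (fun z => V z w) {z | XX z ∧ ∀ j, okp z (w j)} := by
  induction h with
  | prod a ha y Y h =>
    refine (ha.mono (fun z hz => hz.1)).mul (continuousOn_finsetProd _ (fun j hj => ?_))
    obtain ⟨n, A, C, hA, hC, e⟩ := (h j hj).sep
    have : ContinuousOn (fun z => (∑ l, A l z * C l (w j)) / ((z - w j) ^ 2 * (1 - z * w j) ^ 2)) {z | XX z ∧ ∀ j, okp z (w j)} := by
      apply ContinuousOn.div
      · exact continuousOn_finsetSum _ (fun l _ => ((hA l).mono (fun z hz => hz.1)).mul continuousOn_const)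
      · fun_prop
      · intro z hz; exact (hz.2 j).ne
    refine this.congr (fun z hz => ?_)
    simp only
    rw [← e z (w j) hz.1 (hw j) (hz.2 j), mul_div_cancel_left₀ _ (hz.2 j).ne]
  | zero => exact continuousOn_const
  | add F V F' V' _ _ h1 h2 => exact h1.add h2
  | congr F V F' V' _ e1 e2 h1 => exact h1.congr (fun z hz => (e2 z w hz.1 hw hz.2).symm)

structure Ctr (c : ℂ) (ε : ℝ) : Prop where
  c : c = 1 ∨ c = -1
  pos : 0 < ε
  lt : ε < 1/4

lemma Ctr.XX {c ε} (h : Ctr c ε) {z} (hz : z ∈ Metric.sphere c ε) : XX z := by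
  rcases h.c with rfl | rfl
  · exact XX_of_sphere1 h.pos (by linarith [h.lt]) hz
  · exact XX_of_sphere2 h.pos (by linarith [h.lt]) hz

lemma Ctr.norm {c ε} (h : Ctr c ε) {z} (hz : z ∈ Metric.closedBall c ε) : 3/4 ≤ ‖z‖ ∧ ‖z‖ ≤ 5/4 := by
  have hc : ‖c‖ = 1 := by rcases h.c with rfl | rfl <;> simp
  rw [mem_closedBall_iff_norm] at hz
  have := h.lt
  have h1 := abs_norm_sub_norm_le z c
  rw [hc, abs_le] at h1
  constructor <;> linarith [h1.1, h1.2]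

lemma ok_small {z w : ℂ} (h1 : 3/4 ≤ ‖z‖) (h2 : ‖z‖ ≤ 5/4) (hw : ‖w‖ < 1/8) : okp z w := by
  constructor
  · rintro rfl; linarith
  · intro h
    have := congrArg norm h
    rw [norm_mul, norm_one] at this
    nlinarith [norm_nonneg w, norm_nonneg z]

lemma repA {m : ℕ} {F V} (h : RepI (Finset.univ : Finset (Fin m)) F V) {c ε} (hc : Ctr c ε) {k : ℂ → ℂ}
    (hk : ContinuousOn k (Metric.sphere c ε)) (w : Fin m → ℂ) (hw : ∀ j, 0 < ‖w j‖ ∧ ‖w j‖ < 1/8) :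
    HasSum (fun b : Fin m → ℕ => (∏ j, (br (b j) : ℂ) * w j ^ b j) * ∮ z in C(c, ε), k z * F z b)
      ((∏ j, w j) * ∮ z in C(c, ε), k z * V z w) := by
  have hXX : ∀ j, XX (w j) := fun j => XX_small (norm_pos_iff.1 (hw j).1) (by linarith [(hw j).2])
  have hok : ∀ z ∈ Metric.sphere c ε, ∀ j, okp z (w j) := fun z hz j =>
    ok_small (hc.norm (Metric.sphere_subset_closedBall hz)).1 (hc.norm (Metric.sphere_subset_closedBall hz)).2 (hw j).2
  have hsub : Metric.sphere c ε ⊆ {z | XX z ∧ ∀ j, okp z (w j)} := fun z hz => ⟨hc.XX hz, hok z hz⟩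
  have hsub' : Metric.sphere c ε ⊆ {z | XX z} := fun z hz => hc.XX hz
  induction h with
  | prod a ha y Y h =>
    have hY : ∀ j, Y1 (y j) (Y j) := fun j => h j (Finset.mem_univ _)
    choose C hC using fun j => (hY j).bd
    have hka : ContinuousOn (fun z => k z * a z) (Metric.sphere c ε) := hk.mul (ha.mono hsub')
    obtain ⟨M, hM⟩ := (isCompact_sphere c ε).exists_bound_of_continuousOn hka
    have key := circ_hasSum (c := c) (ε := ε) hc.pos (ι := Fin m → ℕ)
      (φ := fun b z => k z * a z * ∏ j, ((br (b j) : ℂ) * y j z (b j) * w j ^ b j))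
      (Φ := fun z => k z * a z * ∏ j, (w j * Y j z (w j)))
      (u := fun b => M * ∏ j, (C j * (4 * ‖w j‖) ^ b j)) ?_ ?_ ?_ ?_
    · rw [← circleIntegral.integral_const_mul]
      simp only [← circleIntegral.integral_const_mul]
      have e1 : (fun z => (∏ j, w j) * (k z * (a z * ∏ j, Y j z (w j)))) = fun z => k z * a z * ∏ j, (w j * Y j z (w j)) := by
        funext z; rw [Finset.prod_mul_distrib]; ring
      have e2 : ∀ b : Fin m → ℕ, (fun z => (∏ j, (br (b j) : ℂ) * w j ^ b j) * (k z * (a z * ∏ j, y j z (b j)))) =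
          fun z => k z * a z * ∏ j, ((br (b j) : ℂ) * y j z (b j) * w j ^ b j) := by
        intro b; funext z; simp only [Finset.prod_mul_distrib]; ring
      simp only [e1, e2]
      exact key
    · intro b
      refine hka.mul (continuousOn_finsetProd _ (fun j _ => ?_))
      exact (continuousOn_const.mul (((hY j).cont _).mono hsub')).mul continuousOn_const
    · intro b z hz
      have hn := hc.norm (Metric.sphere_subset_closedBall hz)
      rw [norm_mul, norm_prod]
      apply mul_le_mul (hM z hz) _ (Finset.prod_nonneg fun _ _ => norm_nonneg _) ((norm_nonneg _).trans (hM z hz))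
      apply Finset.prod_le_prod (fun _ _ => norm_nonneg _)
      intro j _
      rw [norm_mul, norm_pow, mul_pow, ← mul_assoc]
      exact mul_le_mul_of_nonneg_right (hC j z hn.1 hn.2 _) (by positivity)
    · apply Summable.mul_left
      have := (hasSum_prod_fin m (fun j b => ((C j * (4 * ‖w j‖) ^ b : ℝ) : ℂ)) _ (fun j => Summable.hasSum ?_)).summable
      · have e : (fun b : Fin m → ℕ => ∏ j, ((C j * (4 * ‖w j‖) ^ b j : ℝ) : ℂ)) =
          fun b : Fin m → ℕ => ((∏ j, (C j * (4 * ‖w j‖) ^ b j) : ℝ) : ℂ) := by funext b; push_cast; rfl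
        rw [e] at this
        exact Complex.summable_ofReal.1 this
      · apply Complex.summable_ofReal.2
        apply Summable.mul_left
        exact summable_geometric_of_lt_one (by positivity) (by linarith [(hw j).2])
    · intro z hz
      have hn := hc.norm (Metric.sphere_subset_closedBall hz)
      apply HasSum.mul_left
      exact hasSum_prod_fin m (fun j b => (br b : ℂ) * y j z b * w j ^ b) _
        (fun j => (hY j).sum z (w j) hn.1 hn.2 (hc.XX hz) (hw j).1 (hw j).2)
  | zero => simp [circleIntegral_zero']
  | add F V F' V' r1 r2 h1 h2 =>
    have := h1.add h2
    have e1 : ∀ b, (∮ z in C(c, ε), k z * (F z b + F' z b)) = (∮ z in C(c, ε), k z * F z b) + ∮ z in C(c, ε), k z * F' z b := by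
      intro b
      rw [← circleIntegral.integral_add]
      · simp only [mul_add]
      · exact (hk.mul ((r1.contF b).mono hsub')).circleIntegrable hc.pos.le
      · exact (hk.mul ((r2.contF b).mono hsub')).circleIntegrable hc.pos.le
    have e2 : (∮ z in C(c, ε), k z * (V z w + V' z w)) = (∮ z in C(c, ε), k z * V z w) + ∮ z in C(c, ε), k z * V' z w := by
      rw [← circleIntegral.integral_add]
      · simp only [mul_add]
      · exact (hk.mul ((r1.contV w hXX).mono hsub)).circleIntegrable hc.pos.le
      · exact (hk.mul ((r2.contV w hXX).mono hsub)).circleIntegrable hc.pos.le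
    simp only [e1, e2]
    simp only [← mul_add] at this
    exact this
  | congr F V F' V' _ e1 e2 h1 =>
    have := h1
    rw [circleIntegral.integral_congr hc.pos.le (g := fun z => k z * V' z w) (fun z hz => by
      simp only [e2 z w (hc.XX hz) hXX (hok z hz)])] at this
    have e : ∀ b, (∮ z in C(c, ε), k z * F z b) = ∮ z in C(c, ε), k z * F' z b := fun b =>
      circleIntegral.integral_congr hc.pos.le (fun z hz => by simp only [e1 z (hc.XX hz) b])
    simp only [e] at this
    exact this

lemma repB {m : ℕ} {F V} (h : RepI (Finset.univ : Finset (Fin m)) F V) {c ε} (hc : Ctr c ε) {k : ℂ → ℂ}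
    (hk : ContinuousOn k (Metric.sphere c ε)) :
    ∃ G : (Fin m → ℂ) → ℂ, (∀ w, (∀ i, XX (w i)) → ∀ i, DifferentiableAt ℂ (fun x => G (Function.update w i x)) (w i)) ∧
      ∀ w, (∀ i, XX (w i)) → (∀ z ∈ Metric.sphere c ε, ∀ j, okp z (w j)) →
        G w = ∮ z in C(c, ε), k z * ((∏ j, ((z - w j) ^ 2 * (1 - z * w j) ^ 2)) * V z w) := by
  have hsub' : Metric.sphere c ε ⊆ {z | XX z} := fun z hz => hc.XX hz
  induction h with
  | prod a ha y Y h =>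
    have hY : ∀ j, Y1 (y j) (Y j) := fun j => h j (Finset.mem_univ _)
    choose n A C hA hC e using fun j => (hY j).sep
    refine ⟨fun w => ∑ L ∈ Fintype.piFinset (fun j => (Finset.univ : Finset (Fin (n j)))),
      (∮ z in C(c, ε), k z * (a z * ∏ j, A j (L j) z)) * ∏ j, C j (L j) (w j), ?_, ?_⟩
    · intro w hw i
      apply DifferentiableAt.fun_sum
      intro L _
      apply DifferentiableAt.const_mul
      apply DifferentiableAt.fun_finsetProd
      intro j _
      by_cases hj : j = i
      · subst hj; simpa using hC j (L j) (w j) (hw j)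
      · simp [Function.update_of_ne hj]
    · intro w hw hok
      simp only
      rw [circleIntegral.integral_congr hc.pos.le (g := fun z => ∑ L ∈ Fintype.piFinset (fun j => (Finset.univ : Finset (Fin (n j)))),
        k z * (a z * ∏ j, A j (L j) z) * ∏ j, C j (L j) (w j))]
      · rw [circleIntegral_fsum]
        · apply Finset.sum_congr rfl
          intro L _
          rw [mul_comm, ← circleIntegral.integral_const_mul]
          simp only [mul_comm (∏ j, C j (L j) (w j))]
        · intro L _
          apply ContinuousOn.circleIntegrable hc.pos.le
          exact (hk.mul ((ha.mono hsub').mul (continuousOn_finsetProd _ (fun j _ => (hA j _).mono hsub')))).mul continuousOn_const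
      · intro z hz
        simp only
        have : ∏ j, ((z - w j) ^ 2 * (1 - z * w j) ^ 2 * Y j z (w j)) = ∑ L ∈ Fintype.piFinset (fun j => (Finset.univ : Finset (Fin (n j)))),
            ∏ j, (A j (L j) z * C j (L j) (w j)) := by
          rw [← Finset.prod_univ_sum (t := fun j => (Finset.univ : Finset (Fin (n j)))) (f := fun j l => A j l z * C j l (w j))]
          exact Finset.prod_congr rfl (fun j _ => e j z (w j) (hc.XX hz) (hw j) (hok z hz j))
        rw [Finset.prod_mul_distrib] at this
        calc _ = k z * a z * ((∏ j, ((z - w j) ^ 2 * (1 - z * w j) ^ 2)) * ∏ j, Y j z (w j)) := by ring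
          _ = _ := by
            rw [this, Finset.mul_sum]
            apply Finset.sum_congr rfl
            intro L _
            rw [Finset.prod_mul_distrib]; ring
  | zero => exact ⟨fun _ => 0, fun w _ i => by simp, fun w _ _ => by simp [circleIntegral_zero']⟩
  | add F V F' V' r1 r2 h1 h2 =>
    obtain ⟨G, hG, eG⟩ := h1
    obtain ⟨G', hG', eG'⟩ := h2
    refine ⟨fun w => G w + G' w, fun w hw i => (hG w hw i).add (hG' w hw i), fun w hw hok => ?_⟩
    simp only
    rw [eG w hw hok, eG' w hw hok, ← circleIntegral.integral_add]
    · simp only [mul_add]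
    all_goals
      apply ContinuousOn.circleIntegrable hc.pos.le
      refine hk.mul (ContinuousOn.mul (by fun_prop) ?_)
    · exact (r1.contV w hw).mono (fun z hz => ⟨hc.XX hz, hok z hz⟩)
    · exact (r2.contV w hw).mono (fun z hz => ⟨hc.XX hz, hok z hz⟩)
  | congr F V F' V' _ e1 e2 h1 =>
    obtain ⟨G, hG, eG⟩ := h1
    refine ⟨G, hG, fun w hw hok => ?_⟩
    rw [eG w hw hok]
    exact circleIntegral.integral_congr hc.pos.le (fun z hz => by simp only [e2 z w (hc.XX hz) hw (hok z hz)])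

lemma rep_zero {m : ℕ} {F V} (h : RepI (Finset.univ : Finset (Fin m)) F V) {c ε} (hc : Ctr c ε)
    (h0 : ∀ b, ∀ k : ℂ → ℂ, (∀ z ∈ Metric.closedBall c ε, DifferentiableAt ℂ k z) → ∮ z in C(c, ε), k z * F z b = 0)
    {k : ℂ → ℂ} (hk : ∀ z ∈ Metric.closedBall c ε, DifferentiableAt ℂ k z) (w : Fin m → ℂ) (hw : ∀ j, XX (w j))
    (hok : ∀ z ∈ Metric.closedBall c ε, ∀ j, okp z (w j)) : ∮ z in C(c, ε), k z * V z w = 0 := by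
  set k' : ℂ → ℂ := fun z => k z / ∏ j, ((z - w j) ^ 2 * (1 - z * w j) ^ 2) with hk'
  have hne : ∀ z ∈ Metric.closedBall c ε, ∏ j, ((z - w j) ^ 2 * (1 - z * w j) ^ 2) ≠ 0 := fun z hz =>
    Finset.prod_ne_zero_iff.2 (fun j _ => (hok z hz j).ne)
  have hdk : ∀ z ∈ Metric.closedBall c ε, DifferentiableAt ℂ k' z := by
    intro z hz
    refine (hk z hz).div ?_ (hne z hz)
    apply DifferentiableAt.fun_finsetProd
    intro j _; fun_prop
  obtain ⟨G, hG, eG⟩ := repB h hc (k := k') (fun z hz => (hdk z (Metric.sphere_subset_closedBall hz)).continuousAt.continuousWithinAt)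
  have hz := ident_n hG (r := 1/8) (by norm_num) ?_ w hw
  · rw [eG w hw (fun z hz => hok z (Metric.sphere_subset_closedBall hz))] at hz
    rw [← hz]
    apply circleIntegral.integral_congr hc.pos.le
    intro z hz
    have := hne z (Metric.sphere_subset_closedBall hz)
    simp only [hk']
    field_simp
  · intro v hv
    have hXX : ∀ j, XX (v j) := fun j => XX_small (norm_pos_iff.1 (hv j).1) (by linarith [(hv j).2])
    rw [eG v hXX (fun z hz j =>
      ok_small (hc.norm (Metric.sphere_subset_closedBall hz)).1 (hc.norm (Metric.sphere_subset_closedBall hz)).2 (hv j).2)]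
    set k2 : ℂ → ℂ := fun z => k' z * ∏ j, ((z - v j) ^ 2 * (1 - z * v j) ^ 2) with hk2
    have hd2 : ∀ z ∈ Metric.closedBall c ε, DifferentiableAt ℂ k2 z := by
      intro z hz
      refine (hdk z hz).mul ?_
      apply DifferentiableAt.fun_finsetProd
      intro j _; fun_prop
    have := repA h hc (k := k2) (fun z hz => (hd2 z (Metric.sphere_subset_closedBall hz)).continuousAt.continuousWithinAt) v hv
    simp only [h0 _ k2 hd2, mul_zero] at this
    have := this.unique hasSum_zero
    rcases mul_eq_zero.1 this with h' | h'
    · obtain ⟨j, _, hj⟩ := Finset.prod_eq_zero_iff.1 h'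
      exact absurd hj (hXX j).1
    · rw [← h']
      simp only [hk2, mul_assoc]

lemma sep_mk {Y : ℂ → ℂ → ℂ} (p : Fin 5 → ℂ → ℂ) (hp : ∀ l w, XX w → DifferentiableAt ℂ (p l) w)
    (h : ∀ z w, XX z → XX w → okp z w → (z - w) ^ 2 * (1 - z * w) ^ 2 * Y z w =
      p 0 w + z * p 1 w + z ^ 2 * p 2 w + z ^ 3 * p 3 w + z ^ 4 * p 4 w) :
    ∃ (n : ℕ) (A C : Fin n → ℂ → ℂ), (∀ l, ContinuousOn (A l) {z | XX z}) ∧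
    (∀ l w, XX w → DifferentiableAt ℂ (C l) w) ∧
    ∀ z w, XX z → XX w → okp z w → (z - w) ^ 2 * (1 - z * w) ^ 2 * Y z w = ∑ l, A l z * C l w := by
  refine ⟨5, fun l z => z ^ (l : ℕ), p, fun l => by fun_prop, hp, fun z w hz hw ho => ?_⟩
  rw [h z w hz hw ho]
  simp [Fin.sum_univ_five]

lemma Y1_EQ {f : ℕ → ℂ} (hf : EQ f) : Y1 (fun _ b => f b) (fun _ w => gf f w / w) := by
  have hg := hf.gf
  refine ⟨fun b => continuousOn_const, ?_, ?_, ?_⟩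
  · have h1 := (hg.sum (1/2) (by norm_num)).summable.norm
    obtain ⟨C, hC⟩ := h1.tendsto_atTop_zero.bddAbove_range
    refine ⟨C, fun z _ _ b => ?_⟩
    have h2 : ‖(br b : ℂ) * f b * (1/2) ^ b‖ ≤ C := hC ⟨b, rfl⟩
    rw [norm_mul, norm_pow] at h2
    have h3 : ‖(1/2 : ℂ)‖ = 1/2 := by norm_num
    rw [h3] at h2
    have hC0 : 0 ≤ C := le_trans (by positivity) h2
    have h4 : ‖(br b : ℂ) * f b‖ ≤ C * 2 ^ b := by
      have : ‖(br b : ℂ) * f b‖ = ‖(br b : ℂ) * f b‖ * (1/2) ^ b * 2 ^ b := by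
        rw [mul_assoc, ← mul_pow]; norm_num
      rw [this]
      exact mul_le_mul_of_nonneg_right h2 (by positivity)
    refine h4.trans (mul_le_mul_of_nonneg_left ?_ hC0)
    exact pow_le_pow_left₀ (by norm_num) (by norm_num) b
  · intro z w _ _ _ h0 h1
    rw [mul_div_cancel₀ _ (norm_pos_iff.1 h0)]
    exact hg.sum w (by linarith)
  · refine sep_mk ![fun w => w ^ 2 * (gf f w / w), fun w => (-2 * w - 2 * w ^ 3) * (gf f w / w), fun w => (1 + 4 * w ^ 2 + w ^ 4) * (gf f w / w),
      fun w => (-2 * w - 2 * w ^ 3) * (gf f w / w), fun w => w ^ 2 * (gf f w / w)] ?_ ?_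
    · intro l w hw
      have hd : DifferentiableAt ℂ (fun w => gf f w / w) w := (hg.diff w hw.2.1 hw.2.2).div differentiableAt_id hw.1
      fin_cases l <;> simp only [Fin.zero_eta, Fin.mk_one, Fin.reduceFinMk, Matrix.cons_val] <;>
        exact DifferentiableAt.mul (by fun_prop) hd
    · intro z w hz hw ho
      simp only [Matrix.cons_val]
      ring

lemma br_geom {x : ℂ} (hx : ‖x‖ < 1) : HasSum (fun b : ℕ => (br b : ℂ) * x ^ b) (x / (1 - x) ^ 2 + 1) := by
  have h1 := hasSum_coe_mul_geometric_of_norm_lt_one hx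
  have h2 := hasSum_ite_eq (0:ℕ) (1:ℂ)
  have e : (fun b : ℕ => (br b : ℂ) * x ^ b) = fun b : ℕ => (b : ℂ) * x ^ b + if b = 0 then 1 else 0 := by
    funext b
    by_cases hb : b = 0 <;> simp [br, hb]
  rw [e]
  exact h1.add h2

lemma br_le (b : ℕ) : ‖(br b : ℂ)‖ ≤ 3 ^ b := by
  rw [Complex.norm_natCast]
  unfold br
  split_ifs with h
  · subst h; simp
  · exact_mod_cast (Nat.lt_pow_self (by norm_num : 1 < 3)).le

noncomputable def hh (z w : ℂ) : ℂ := z * w / (z - w) ^ 2 + 1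

lemma Y1_inv : Y1 (fun z b => (z ^ b)⁻¹) (fun z w => hh z w / w) := by
  refine ⟨fun b => ?_, ⟨1, ?_⟩, ?_, ?_⟩
  · exact ContinuousOn.inv₀ (by fun_prop) (fun z hz => pow_ne_zero _ hz.1)
  · intro z h1 h2 b
    rw [norm_mul, norm_inv, norm_pow]
    have : (‖z‖ ^ b)⁻¹ ≤ (4/3) ^ b := by
      rw [← inv_pow]
      apply pow_le_pow_left₀ (by positivity)
      rw [inv_le_comm₀ (by linarith) (by norm_num)]; linarith
    calc _ ≤ (3:ℝ) ^ b * (4/3) ^ b := mul_le_mul (br_le b) this (by positivity) (by positivity)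
      _ = _ := by rw [← mul_pow]; norm_num
  · intro z w h1 h2 hz h0 hw
    have hw0 := norm_pos_iff.1 h0
    have hne : z - w ≠ 0 := sub_ne_zero.2 (ok_small h1 h2 hw).1
    have hx : ‖w / z‖ < 1 := by
      rw [norm_div, div_lt_one (by linarith)]; linarith
    have := br_geom hx
    rw [mul_div_cancel₀ _ hw0]
    have e : w / z / (1 - w / z) ^ 2 + 1 = hh z w := by
      unfold hh
      have := hz.1
      have h3 : 1 - w / z ≠ 0 := by
        rw [one_sub_div this]; exact div_ne_zero hne this
      field_simp
    rw [e] at this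
    convert this using 1
    funext b; rw [div_pow]; ring
  · refine sep_mk ![fun w => w ^ 2 / w, fun w => (-w - 2 * w ^ 3) / w, fun w => (1 + 2 * w ^ 2 + w ^ 4) / w,
      fun w => (-2 * w - w ^ 3) / w, fun w => w ^ 2 / w] ?_ ?_
    · intro l w hw
      fin_cases l <;> simp only [Fin.zero_eta, Fin.mk_one, Fin.reduceFinMk, Matrix.cons_val] <;>
        exact DifferentiableAt.div (by fun_prop) (by fun_prop) hw.1
    · intro z w hz hw ho
      have hne : z - w ≠ 0 := sub_ne_zero.2 ho.1
      have := hw.1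
      simp only [Matrix.cons_val]
      unfold hh
      field_simp
      ring

lemma Y1_pow : Y1 (fun z b => z ^ b) (fun z w => hh z⁻¹ w / w) := by
  have he : ∀ z w : ℂ, z ≠ 0 → z * w ≠ 1 → hh z⁻¹ w = z * w / (1 - z * w) ^ 2 + 1 := by
    intro z w h0 h1
    have h3 : 1 - z * w ≠ 0 := sub_ne_zero.2 (Ne.symm h1)
    unfold hh
    have : z⁻¹ - w = (1 - z * w) / z := by field_simp
    rw [this]
    field_simp
  refine ⟨fun b => ?_, ⟨1, ?_⟩, ?_, ?_⟩
  · fun_prop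
  · intro z h1 h2 b
    rw [norm_mul, norm_pow]
    have : ‖z‖ ^ b ≤ (4/3) ^ b := pow_le_pow_left₀ (by positivity) (by linarith) b
    calc _ ≤ (3:ℝ) ^ b * (4/3) ^ b := mul_le_mul (br_le b) this (by positivity) (by positivity)
      _ = _ := by rw [← mul_pow]; norm_num
  · intro z w h1 h2 hz h0 hw
    have hw0 := norm_pos_iff.1 h0
    have hx : ‖z * w‖ < 1 := by
      rw [norm_mul]; nlinarith [norm_nonneg z]
    have := br_geom hx
    rw [mul_div_cancel₀ _ hw0, he z w hz.1 (ok_small h1 h2 hw).2]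
    convert this using 1
    funext b; rw [mul_pow]; ring
  · refine sep_mk ![fun w => w ^ 2 / w, fun w => (-2 * w - w ^ 3) / w, fun w => (1 + 2 * w ^ 2 + w ^ 4) / w,
      fun w => (-w - 2 * w ^ 3) / w, fun w => w ^ 2 / w] ?_ ?_
    · intro l w hw
      fin_cases l <;> simp only [Fin.zero_eta, Fin.mk_one, Fin.reduceFinMk, Matrix.cons_val] <;>
        exact DifferentiableAt.div (by fun_prop) (by fun_prop) hw.1
    · intro z w hz hw ho
      have h3 : 1 - z * w ≠ 0 := sub_ne_zero.2 (Ne.symm ho.2)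
      have := hw.1
      simp only [Matrix.cons_val]
      rw [he z w hz.1 ho.2]
      field_simp
      ring

lemma GF.fsum {ι : Type} (s : Finset ι) {f : ι → ℕ → ℂ} {Ψ : ι → ℂ → ℂ} (h : ∀ i ∈ s, GF (f i) (Ψ i)) :
    GF (fun t => ∑ i ∈ s, f i t) (fun z => ∑ i ∈ s, Ψ i z) := by
  classical
  induction s using Finset.induction_on with
  | empty => simpa using (EQ.const 0).gf.smul 0
  | insert a s ha ih =>
    simp only [Finset.sum_insert ha]
    exact (h a (by simp)).add (ih (fun i hi => h i (by simp [hi])))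

lemma gf_split {Nf : LatticeCountFamily} {g : ℕ} {β : Type} [Fintype β] [DecidableEq β] {ι T c f}
    (hr : PRep (fun b => (Nf.N g (Option β) b : ℂ)) ι T c f) (d : β → ℕ) {z : ℂ} (hz : XX z)
    (hE : EQ (fun p => (Nf.N g (Option β) (fun x => Option.elim x p d) : ℂ))) :
    gf (fun p => (Nf.N g (Option β) (fun x => Option.elim x p d) : ℂ)) z =
      ∑ τ ∈ T, c τ * (gf (f τ none) z * ∏ x, f τ (some x) (d x)) := by
  have h1 : GF (fun p => ∑ τ ∈ T, (c τ * ∏ x, f τ (some x) (d x)) * f τ none p)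
      (fun z => ∑ τ ∈ T, (c τ * ∏ x, f τ (some x) (d x)) * gf (f τ none) z) :=
    GF.fsum T (fun τ _ => (hr.eq τ none).gf.smul _)
  have e : (fun p => (Nf.N g (Option β) (fun x => Option.elim x p d) : ℂ)) =
      fun p => ∑ τ ∈ T, (c τ * ∏ x, f τ (some x) (d x)) * f τ none p := by
    funext p
    rw [hr.rep]
    apply Finset.sum_congr rfl
    intro τ _
    rw [Fintype.prod_option]
    simp only [Option.elim]
    ring
  have h2 := hE.gf
  rw [e] at h2 ⊢
  rw [h2.unique h1 hz]
  apply Finset.sum_congr rfl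
  intro τ _
  ring

lemma W_split {Nf W} (H : WHyp Nf W) {g n : ℕ} (h : 3 ≤ 2 * g + (n + 1)) {β : Type} [Fintype β] [DecidableEq β] {ι T c f}
    (hr : PRep (fun b => (Nf.N g (Option β) b : ℂ)) ι T c f) (e : β ≃ Fin n) (v : Fin n → ℂ) (hv : ∀ i, XX (v i)) {z : ℂ} (hz : XX z) :
    W g (n + 1) (Fin.cons z v) = ∑ τ ∈ T, c τ * (gf (f τ none) z / z * ∏ x, (gf (f τ (some x)) (v (e x)) / v (e x))) := by
  rw [W_rep H h ((Equiv.optionCongr e).trans (finSuccEquiv n).symm) hr]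
  · apply Finset.sum_congr rfl
    intro τ _
    rw [Fintype.prod_option]
    simp
  · intro i
    refine Fin.cases ?_ (fun j => ?_) i
    · simpa using hz
    · simpa using hv j

lemma W_GF {Nf W} (H : WHyp Nf W) {g m : ℕ} (h : 3 ≤ 2 * g + (m + 1)) (v : Fin m → ℂ) (hv : ∀ i, XX (v i)) :
    ∃ f Ψ, GF f Ψ ∧ ∀ z, XX z → W g (m + 1) (Fin.cons z v) = Ψ z / z := by
  obtain ⟨ι, T, c, f, hr⟩ := N_rep Nf g (Option (Fin m)) (by simpa using h)
  refine ⟨_, _, GF.fsum T (fun τ _ => (hr.eq τ none).gf.smul (c τ * ∏ x, (gf (f τ (some x)) (v x) / v x))), fun z hz => ?_⟩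
  rw [W_split H h hr (Equiv.refl _) v hv hz, Finset.sum_div]
  apply Finset.sum_congr rfl
  intro τ _
  simp only [Equiv.refl_apply]
  ring

lemma gf_cont {f : ℕ → ℂ} (hf : EQ f) {u : ℂ → ℂ} (hu : ContinuousOn u {z | XX z}) (hu' : ∀ z, XX z → XX (u z)) :
    ContinuousOn (fun z => gf f (u z)) {z | XX z} := by
  have : ContinuousOn (gf f) {z | XX z} := fun z hz => (hf.gf.cont z hz).continuousWithinAt
  exact this.comp hu (fun z hz => hu' z hz)

lemma rep_red {Nf W} (H : WHyp Nf W) {g m : ℕ} (I : Finset (Fin m)) (h : 3 ≤ 2 * g + (I.card + 1)) {u : ℂ → ℂ}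
    (hu : ContinuousOn u {z | XX z}) (hu' : ∀ z, XX z → XX (u z)) :
    RepI I (fun z b => gf (Nred Nf g I b) (u z)) (fun z w => u z * W g (I.card + 1) (Fin.cons (u z) (restr w I))) := by
  obtain ⟨ι, T, c, f, hr⟩ := N_rep Nf g (Option {x // x ∈ I}) (by simpa using h)
  refine RepI.congr _ _ _ _ _ (RepI.fsum T (fun τ _ => RepI.prod I (fun z => c τ * gf (f τ none) (u z))
    (continuousOn_const.mul (gf_cont (hr.eq τ none) hu hu'))
    (fun j _ b => if hj : j ∈ I then f τ (some ⟨j, hj⟩) b else 0)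
    (fun j _ w => if hj : j ∈ I then gf (f τ (some ⟨j, hj⟩)) w / w else 0) ?_)) ?_ ?_
  · intro j hj
    simp only [hj, dif_pos]
    exact Y1_EQ (hr.eq τ _)
  · intro z hz b
    have := gf_split hr (fun x => b x.1) (hu' z hz) (Nred_EQ Nf h b)
    unfold Nred
    rw [this]
    apply Finset.sum_congr rfl
    intro τ _
    rw [← Finset.prod_coe_sort, mul_assoc]
    simp
  · intro z w hz hw _
    rw [W_split H h hr (I.orderIsoOfFin rfl).symm.toEquiv (restr w I) (fun i => hw _) (hu' z hz), Finset.mul_sum]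
    apply Finset.sum_congr rfl
    intro τ _
    rw [← Finset.prod_coe_sort]
    have : (u z) ≠ 0 := (hu' z hz).1
    simp [restr]
    field_simp

lemma rep_full {Nf W} (H : WHyp Nf W) {g m : ℕ} (h : 3 ≤ 2 * g + (m + 1)) :
    RepI Finset.univ (fun z b => gf (N1 Nf g b) z) (fun z (w : Fin m → ℂ) => z * W g (m + 1) (Fin.cons z w)) := by
  obtain ⟨ι, T, c, f, hr⟩ := N_rep Nf g (Option (Fin m)) (by simpa using h)
  refine RepI.congr _ _ _ _ _ (RepI.fsum T (fun τ _ => RepI.prod Finset.univ (fun z => c τ * gf (f τ none) z)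
    (continuousOn_const.mul (gf_cont (hr.eq τ none) continuousOn_id (fun z hz => hz)))
    (fun j _ b => f τ (some j) b)
    (fun j _ w => gf (f τ (some j)) w / w) ?_)) ?_ ?_
  · intro j hj
    exact Y1_EQ (hr.eq τ _)
  · intro z hz b
    have := gf_split hr b hz (N1_EQ Nf h b)
    unfold N1
    rw [this]
    apply Finset.sum_congr rfl
    intro τ _
    rw [mul_assoc]
  · intro z w hz hw _
    rw [W_split H h hr (Equiv.refl _) w hw hz, Finset.mul_sum]
    apply Finset.sum_congr rfl
    intro τ _
    have : z ≠ 0 := hz.1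
    simp only [Equiv.refl_apply]
    field_simp

lemma rep_two {Nf W} (H : WHyp Nf W) {g m : ℕ} (h : 3 ≤ 2 * g + (m + 2)) {ι T c f}
    (hr : PRep (fun b => (Nf.N g (Option (Option (Fin m))) b : ℂ)) ι T c f) :
    RepI Finset.univ (fun z b => M2h T c f b z z⁻¹) (fun z (w : Fin m → ℂ) => W g (m + 2) (Fin.cons z (Fin.cons z⁻¹ w))) := by
  refine RepI.congr _ _ _ _ _ (RepI.fsum T (fun τ _ => RepI.prod Finset.univ
    (fun z => c τ * (gf (f τ none) z * gf (f τ (some none)) z⁻¹))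
    (continuousOn_const.mul ((gf_cont (hr.eq τ none) continuousOn_id (fun z hz => hz)).mul
      (gf_cont (hr.eq τ _) (continuousOn_id.inv₀ (fun z hz => hz.1)) (fun z hz => hz.inv))))
    (fun j _ b => f τ (some (some j)) b)
    (fun j _ w => gf (f τ (some (some j))) w / w) ?_)) ?_ ?_
  · intro j hj
    exact Y1_EQ (hr.eq τ _)
  · intro z hz b
    unfold M2h
    apply Finset.sum_congr rfl
    intro τ _
    rw [mul_assoc]
  · intro z w hz hw _
    rw [W_split H h hr (finSuccEquiv m).symm (Fin.cons z⁻¹ w) ?_ hz]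
    · apply Finset.sum_congr rfl
      intro τ _
      have : z ≠ 0 := hz.1
      rw [Fintype.prod_option]
      simp
      field_simp
    · intro i
      refine Fin.cases ?_ (fun j => ?_) i
      · simpa using hz.inv
      · simpa using hw j

lemma rep_single {m : ℕ} (W) (I : Finset (Fin m)) (j : Fin m) (hI : I = {j}) :
    RepI I (fun z b => (z ^ b j)⁻¹) (fun z w => z * extW W 0 (I.card + 1) (Fin.cons z (restr w I))) ∧
    RepI I (fun z b => z ^ b j) (fun z w => z⁻¹ * extW W 0 (I.card + 1) (Fin.cons z⁻¹ (restr w I))) := by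
  subst hI
  have key : ∀ (z : ℂ) (w : Fin m → ℂ), z ≠ 0 → w j ≠ 0 → z * extW W 0 (({j} : Finset (Fin m)).card + 1) (Fin.cons z (restr w {j})) = hh z (w j) / w j := by
    intro z w hz hw
    have h1 : restr w ({j} : Finset (Fin m)) ⟨0, by simp⟩ = w j := by
      unfold restr
      have := (({j} : Finset (Fin m)).orderIsoOfFin rfl ⟨0, by simp⟩).2
      rw [Finset.mem_singleton.1 this]
    have h2 : (Fin.cons z (restr w ({j} : Finset (Fin m))) : Fin (({j} : Finset (Fin m)).card + 1) → ℂ) ⟨1, by simp⟩ = w j := by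
      rw [← h1]; rfl
    have h3 : (Fin.cons z (restr w ({j} : Finset (Fin m))) : Fin (({j} : Finset (Fin m)).card + 1) → ℂ) ⟨0, by simp⟩ = z := rfl
    unfold extW
    rw [dif_pos ⟨rfl, by simp⟩, h2, h3]
    unfold hh
    by_cases hzw : z - w j = 0
    · rw [hzw]; field_simp
    · field_simp
  constructor
  · refine RepI.congr _ _ _ _ _ (RepI.prod {j} (fun _ => 1) continuousOn_const (fun _ z b => (z ^ b)⁻¹) _ (fun _ _ => Y1_inv)) ?_ ?_
    · intro z _ b; simp
    · intro z w hz hw _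
      rw [key z w hz.1 (hw j).1]; simp
  · refine RepI.congr _ _ _ _ _ (RepI.prod {j} (fun _ => 1) continuousOn_const (fun _ z b => z ^ b) _ (fun _ _ => Y1_pow)) ?_ ?_
    · intro z _ b; simp
    · intro z w hz hw _
      rw [key z⁻¹ w hz.inv.1 (hw j).1]; simp

noncomputable def E1 (Nf : LatticeCountFamily) (g : ℕ) {m : ℕ} (I : Finset (Fin m)) (z : ℂ) (b : Fin m → ℕ) : ℂ :=
  if g = 0 ∧ I.card = 1 then ∏ j ∈ I, (z ^ b j)⁻¹ else gf (Nred Nf g I b) z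

noncomputable def E2 (Nf : LatticeCountFamily) (g : ℕ) {m : ℕ} (I : Finset (Fin m)) (z : ℂ) (b : Fin m → ℕ) : ℂ :=
  if g = 0 ∧ I.card = 1 then ∏ j ∈ I, z ^ b j else gf (Nred Nf g I b) z⁻¹

lemma rep_E {Nf W} (H : WHyp Nf W) {g m : ℕ} (I : Finset (Fin m)) (h : ¬ (g = 0 ∧ I.card = 0)) :
    RepI I (E1 Nf g I) (fun z w => z * extW W g (I.card + 1) (Fin.cons z (restr w I))) ∧
    RepI I (E2 Nf g I) (fun z w => z⁻¹ * extW W g (I.card + 1) (Fin.cons z⁻¹ (restr w I))) := by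
  by_cases h1 : g = 0 ∧ I.card = 1
  · obtain ⟨rfl, h2⟩ := h1
    obtain ⟨j, rfl⟩ := Finset.card_eq_one.1 h2
    have := rep_single W {j} j rfl
    constructor
    · exact RepI.congr _ _ _ _ _ this.1 (fun z _ b => by simp [E1]) (fun _ _ _ _ _ => rfl)
    · exact RepI.congr _ _ _ _ _ this.2 (fun z _ b => by simp [E2]) (fun _ _ _ _ _ => rfl)
  · have hs : 3 ≤ 2 * g + (I.card + 1) := by omega
    have hx : ¬ (g = 0 ∧ I.card + 1 = 2) := by omega
    constructor
    · exact RepI.congr _ _ _ _ _ (rep_red H I hs continuousOn_id (fun z hz => hz)) (fun z _ b => by simp [E1, h1])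
        (fun z w _ _ _ => by rw [extW, dif_neg hx]; rfl)
    · exact RepI.congr _ _ _ _ _ (rep_red H I hs (u := fun z => z⁻¹) (continuousOn_id.inv₀ (fun z hz => hz.1)) (fun z hz => hz.inv))
        (fun z _ b => by simp [E2, h1]) (fun z w _ _ _ => by rw [extW, dif_neg hx])

lemma RepI.ite {m : ℕ} {I : Finset (Fin m)} {F V} (p : Prop) [Decidable p] (h : p → RepI I F V) :
    RepI I (fun z b => if p then F z b else 0) (fun z w => if p then V z w else 0) := by
  by_cases hp : p
  · simpa [hp] using h hp
  · simpa [hp] using RepI.zero I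

noncomputable def Bc (Nf : LatticeCountFamily) (g m : ℕ) {ι : Type} (T : Finset ι) (c : ι → ℂ) (f : ι → Option (Option (Fin m)) → ℕ → ℂ)
    (z : ℂ) (b : Fin m → ℕ) : ℂ :=
  (if ¬ g = 0 then M2h T c f b z z⁻¹ else 0) + ∑ g₁ ∈ Finset.range (g + 1), ∑ I ∈ (Finset.univ : Finset (Fin m)).powerset,
    if ¬(g₁ = 0 ∧ I.card = 0) ∧ ¬(g - g₁ = 0 ∧ Iᶜ.card = 0) then E1 Nf g₁ I z b * E2 Nf (g - g₁) Iᶜ z b else 0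

lemma rep_bracket {Nf W} (H : WHyp Nf W) {g m : ℕ} (h : g ≠ 0 → 4 ≤ 2 * g + (m + 1)) {ι T c f}
    (hr : g ≠ 0 → PRep (fun b => (Nf.N (g - 1) (Option (Option (Fin m))) b : ℂ)) ι T c f) :
    RepI Finset.univ (Bc Nf g m T c f) (fun z w => recursionBracket W g m w z) := by
  unfold Bc recursionBracket
  apply RepI.add
  · refine RepI.congr _ _ _ _ _ (RepI.ite (¬ g = 0) (fun hg => rep_two H (by have := h hg; omega) (hr hg))) (fun _ _ _ => rfl) ?_
    intro z w hz _ _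
    by_cases hg : g = 0
    · simp [hg]
    · have hx : ¬ (g - 1 = 0 ∧ m + 2 = 2) := by have := h hg; omega
      rw [if_pos hg, if_neg hg, extW, dif_neg hx]
  · apply RepI.fsum
    intro g₁ _
    apply RepI.fsum
    intro I _
    apply RepI.ite
    intro hc
    refine RepI.congr _ _ _ _ _ ((rep_E H I hc.1).1.mul (rep_E H Iᶜ hc.2).2) (fun _ _ _ => rfl) ?_
    intro z w hz _ _
    have := hz.1
    field_simp

lemma sum_card_one {m : ℕ} (X : Finset (Fin m) → ℂ) : (∑ I : Finset (Fin m), if I.card = 1 then X I else 0) = ∑ j, X {j} := by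
  rw [← Finset.sum_filter]
  have : (Finset.univ : Finset (Finset (Fin m))).filter (fun I => I.card = 1) = Finset.univ.map ⟨fun j : Fin m => {j}, Finset.singleton_injective⟩ := by
    ext I
    simp only [Finset.mem_filter, Finset.mem_univ, true_and, Finset.mem_map, Function.Embedding.coeFn_mk, Finset.card_eq_one]
    exact ⟨fun ⟨j, hj⟩ => ⟨j, hj.symm⟩, fun ⟨j, hj⟩ => ⟨j, hj.symm⟩⟩
  rw [this, Finset.sum_map]
  rfl

lemma Bc_eq (Nf : LatticeCountFamily) {g m : ℕ} (h : 4 ≤ 2 * g + (m + 1)) {ι T c f}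
    (hr : g ≠ 0 → PRep (fun b => (Nf.N (g - 1) (Option (Option (Fin m))) b : ℂ)) ι T c f) {z : ℂ} (hz : XX z) (b : Fin m → ℕ) :
    Bc Nf g m T c f z b = (((if g = 0 then 0 else M2h T c f b z z) +
        ∑ g₁ ∈ Finset.range (g + 1), ∑ I : Finset (Fin m),
          if 3 ≤ 2 * g₁ + (I.card + 1) ∧ 3 ≤ 2 * (g - g₁) + (Iᶜ.card + 1) then
            gf (Nred Nf g₁ I b) z * gf (Nred Nf (g - g₁) Iᶜ b) z else 0)
        + ∑ j, (z ^ b j + (z ^ b j)⁻¹) * gf (Nred Nf g {j}ᶜ b) z) := by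
  unfold Bc
  rw [add_assoc]
  congr 1
  · by_cases hg : g = 0
    · simp [hg]
    · simp only [hg, if_false, not_false_eq_true, if_true]
      unfold M2h
      apply Finset.sum_congr rfl
      intro τ _
      rw [((hr hg).eq τ (some none)).gf.inv z hz]
  · have hterm : ∀ g₁ ∈ Finset.range (g + 1), ∀ I : Finset (Fin m),
        (if ¬(g₁ = 0 ∧ I.card = 0) ∧ ¬(g - g₁ = 0 ∧ Iᶜ.card = 0) then E1 Nf g₁ I z b * E2 Nf (g - g₁) Iᶜ z b else 0) =
        (if 3 ≤ 2 * g₁ + (I.card + 1) ∧ 3 ≤ 2 * (g - g₁) + (Iᶜ.card + 1) then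
            gf (Nred Nf g₁ I b) z * gf (Nred Nf (g - g₁) Iᶜ b) z else 0) +
        ((if g₁ = 0 then (if I.card = 1 then (∏ j ∈ I, (z ^ b j)⁻¹) * gf (Nred Nf g Iᶜ b) z else 0) else 0) +
        (if g₁ = g then (if Iᶜ.card = 1 then (∏ j ∈ Iᶜ, z ^ b j) * gf (Nred Nf g Iᶜᶜ b) z else 0) else 0)) := by
      intro g₁ hg₁ I
      have hle : g₁ ≤ g := by simpa [Nat.lt_succ_iff] using hg₁
      have hcard : I.card + Iᶜ.card = m := by simpa using Finset.card_add_card_compl I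
      by_cases hA : g₁ = 0 ∧ I.card = 1
      · obtain ⟨rfl, hI⟩ := hA
        have c1 : ¬ (0 = 0 ∧ I.card = 0) ∧ ¬ (g - 0 = 0 ∧ Iᶜ.card = 0) := by omega
        have c2 : ¬ (3 ≤ 2 * 0 + (I.card + 1) ∧ 3 ≤ 2 * (g - 0) + (Iᶜ.card + 1)) := by omega
        have c3 : ¬ (g - 0 = 0 ∧ Iᶜ.card = 1) := by omega
        have c4 : (if 0 = g then (if Iᶜ.card = 1 then (∏ j ∈ Iᶜ, z ^ b j) * gf (Nred Nf g Iᶜᶜ b) z else 0) else 0) = 0 := by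
          by_cases h0 : 0 = g
          · rw [if_pos h0, if_neg (by omega)]
          · rw [if_neg h0]
        rw [if_pos c1, if_neg c2, c4, if_pos rfl, if_pos hI, E1, if_pos ⟨rfl, hI⟩, E2, if_neg c3]
        have hE : EQ (Nred Nf (g - 0) Iᶜ b) := Nred_EQ Nf (by omega) b
        rw [hE.gf.inv z hz]
        simp
      · have c0 : (if g₁ = 0 then (if I.card = 1 then (∏ j ∈ I, (z ^ b j)⁻¹) * gf (Nred Nf g Iᶜ b) z else 0) else 0) = 0 := by
          by_cases h0 : g₁ = 0
          · rw [if_pos h0, if_neg (by omega)]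
          · rw [if_neg h0]
        rw [c0]
        by_cases hB : g₁ = g ∧ Iᶜ.card = 1
        · obtain ⟨rfl, hI⟩ := hB
          have c1 : ¬ (g₁ = 0 ∧ I.card = 0) ∧ ¬ (g₁ - g₁ = 0 ∧ Iᶜ.card = 0) := by omega
          have c2 : ¬ (3 ≤ 2 * g₁ + (I.card + 1) ∧ 3 ≤ 2 * (g₁ - g₁) + (Iᶜ.card + 1)) := by omega
          rw [if_pos c1, if_neg c2, if_pos rfl, if_pos hI, E1, if_neg hA, E2, if_pos ⟨by omega, hI⟩, compl_compl]
          ring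
        · have c4 : (if g₁ = g then (if Iᶜ.card = 1 then (∏ j ∈ Iᶜ, z ^ b j) * gf (Nred Nf g Iᶜᶜ b) z else 0) else 0) = 0 := by
            by_cases h0 : g₁ = g
            · rw [if_pos h0, if_neg (by omega)]
            · rw [if_neg h0]
          rw [c4, add_zero, add_zero]
          by_cases hc : ¬(g₁ = 0 ∧ I.card = 0) ∧ ¬(g - g₁ = 0 ∧ Iᶜ.card = 0)
          · rw [if_pos hc, if_pos (by omega), E1, if_neg hA, E2, if_neg (by omega)]
            have hE : EQ (Nred Nf (g - g₁) Iᶜ b) := Nred_EQ Nf (by omega) b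
            rw [hE.gf.inv z hz]
          · rw [if_neg hc, if_neg (by omega)]
    have e1 : ∀ I : Finset (Fin m), Iᶜᶜ = I := fun I => compl_compl I
    have hs : (∑ g₁ ∈ Finset.range (g + 1), ∑ I ∈ (Finset.univ : Finset (Fin m)).powerset,
        if ¬(g₁ = 0 ∧ I.card = 0) ∧ ¬(g - g₁ = 0 ∧ Iᶜ.card = 0) then E1 Nf g₁ I z b * E2 Nf (g - g₁) Iᶜ z b else 0) =
        ∑ g₁ ∈ Finset.range (g + 1), ∑ I : Finset (Fin m), ((if 3 ≤ 2 * g₁ + (I.card + 1) ∧ 3 ≤ 2 * (g - g₁) + (Iᶜ.card + 1) then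
            gf (Nred Nf g₁ I b) z * gf (Nred Nf (g - g₁) Iᶜ b) z else 0) +
        ((if g₁ = 0 then (if I.card = 1 then (∏ j ∈ I, (z ^ b j)⁻¹) * gf (Nred Nf g Iᶜ b) z else 0) else 0) +
        (if g₁ = g then (if Iᶜ.card = 1 then (∏ j ∈ Iᶜ, z ^ b j) * gf (Nred Nf g Iᶜᶜ b) z else 0) else 0))) := by
      apply Finset.sum_congr rfl
      intro g₁ hg₁
      rw [Finset.powerset_univ]
      exact Finset.sum_congr rfl (fun I _ => hterm g₁ hg₁ I)
    rw [hs]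
    simp only [Finset.sum_add_distrib]
    congr 1
    have s1 : (∑ g₁ ∈ Finset.range (g + 1), ∑ I : Finset (Fin m),
        (if g₁ = 0 then (if I.card = 1 then (∏ j ∈ I, (z ^ b j)⁻¹) * gf (Nred Nf g Iᶜ b) z else 0) else 0)) =
        ∑ j, (z ^ b j)⁻¹ * gf (Nred Nf g {j}ᶜ b) z := by
      rw [Finset.sum_eq_single 0]
      · simp only [if_true]
        rw [sum_card_one (fun I => (∏ j ∈ I, (z ^ b j)⁻¹) * gf (Nred Nf g Iᶜ b) z)]
        simp
      · intro g₁ _ hne; simp [hne]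
      · simp
    have s2 : (∑ g₁ ∈ Finset.range (g + 1), ∑ I : Finset (Fin m),
        (if g₁ = g then (if Iᶜ.card = 1 then (∏ j ∈ Iᶜ, z ^ b j) * gf (Nred Nf g Iᶜᶜ b) z else 0) else 0)) =
        ∑ j, z ^ b j * gf (Nred Nf g {j}ᶜ b) z := by
      rw [Finset.sum_eq_single g]
      · simp only [if_true]
        rw [← Equiv.sum_comp (compl_involutive.toPerm (compl : Finset (Fin m) → Finset (Fin m)))]
        simp only [Function.Involutive.coe_toPerm, compl_compl]
        rw [sum_card_one (fun I => (∏ j ∈ I, z ^ b j) * gf (Nred Nf g Iᶜ b) z)]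
        simp
      · intro g₁ _ hne; simp [hne]
      · simp
    rw [s1, s2, ← Finset.sum_add_distrib]
    apply Finset.sum_congr rfl
    intro j _
    ring

def Good (W : (g n : ℕ) → (Fin n → ℂ) → ℂ) (g m : ℕ) : Prop :=
  ∃ F, RepI (Finset.univ : Finset (Fin m)) F (fun z w => W g (m + 1) (Fin.cons z w) - z / (1 - z ^ 2) ^ 2 * recursionBracket W g m w z) ∧
    ∀ b, ∃ Λ : ℂ → ℂ, (∀ z, z ≠ 0 → DifferentiableAt ℂ Λ z) ∧ ∀ z, XX z → F z b = Λ z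

lemma good_mk {Nf W} (H : WHyp Nf W) {g m : ℕ} (h : 3 ≤ 2 * g + (m + 1)) {Bf}
    (hB : RepI (Finset.univ : Finset (Fin m)) Bf (fun z w => recursionBracket W g m w z))
    (hL : ∀ b, ∃ Λ : ℂ → ℂ, (∀ z, z ≠ 0 → DifferentiableAt ℂ Λ z) ∧ ∀ z, XX z → gf (N1 Nf g b) z - sfun z * Bf z b = Λ z) :
    Good W g m := by
  have hs : ContinuousOn (fun z => - sfun z) {z | XX z} := fun z hz => (sfun_diff hz).continuousAt.neg.continuousWithinAt
  have hi : ContinuousOn (fun z : ℂ => z⁻¹) {z | XX z} := continuousOn_id.inv₀ (fun z hz => hz.1)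
  have hR := (RepI.add _ _ _ _ _ (rep_full H h) (hB.smul hs)).smul hi
  refine ⟨_, RepI.congr _ _ _ _ _ hR (fun _ _ _ => rfl) ?_, ?_⟩
  · intro z w hz _ _
    have h0 := hz.1
    have h1 := hz.sq
    unfold sfun
    field_simp
    ring
  · intro b
    obtain ⟨Λ, hΛ, e⟩ := hL b
    refine ⟨fun z => z⁻¹ * Λ z, fun z hz => (differentiableAt_inv hz).mul (hΛ z hz), fun z hz => ?_⟩
    simp only [← e z hz]
    ring

lemma good_general {Nf W} (H : WHyp Nf W) {g m : ℕ} (h : 4 ≤ 2 * g + (m + 1)) : Good W g m := by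
  have key : ∃ (ι : Type) (T : Finset ι) (c : ι → ℂ) (f : ι → Option (Option (Fin m)) → ℕ → ℂ),
      g ≠ 0 → PRep (fun b => (Nf.N (g - 1) (Option (Option (Fin m))) b : ℂ)) ι T c f := by
    by_cases hg : g = 0
    · exact ⟨PUnit, ∅, fun _ => 0, fun _ _ _ => 0, fun h => absurd hg h⟩
    · obtain ⟨ι, T, c, f, hf⟩ := N_rep Nf (g - 1) (Option (Option (Fin m))) (by simp; omega)
      exact ⟨ι, T, c, f, fun _ => hf⟩
  obtain ⟨ι, T, c, f, hr⟩ := key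
  refine good_mk H (by omega) (rep_bracket H (fun _ => h) hr) ?_
  intro b
  obtain ⟨Λ, hΛ, e⟩ := coef_general Nf h b hr
  exact ⟨Λ, hΛ, fun z hz => by rw [Bc_eq Nf h hr hz b]; exact e z hz⟩

lemma avoid (α : ℂ) (v : ℂ) (h : v ≠ α) : ∃ r : ℝ, 0 < r ∧ ∀ ε, ε < r → v ∉ Metric.closedBall α ε :=
  ⟨dist v α, dist_pos.2 h, fun ε hε hv => absurd (Metric.mem_closedBall.1 hv) (not_le.2 hε)⟩

lemma avoid2 (v : ℂ) (h : XX v) : ∃ r : ℝ, 0 < r ∧ ∀ ε, ε < r → (v ∉ Metric.closedBall 1 ε ∧ v ∉ Metric.closedBall (-1) ε) := by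
  obtain ⟨r, hr, h1⟩ := avoid 1 v h.2.1
  obtain ⟨s, hs, h2⟩ := avoid (-1) v h.2.2
  exact ⟨min r s, lt_min hr hs, fun ε hε => ⟨h1 ε (lt_of_lt_of_le hε (min_le_left _ _)), h2 ε (lt_of_lt_of_le hε (min_le_right _ _))⟩⟩

lemma avoidF {ι : Type} (s : Finset ι) (v : ι → ℂ) (h : ∀ i, XX (v i)) :
    ∃ r : ℝ, 0 < r ∧ ∀ ε, ε < r → ∀ i ∈ s, (v i ∉ Metric.closedBall 1 ε ∧ v i ∉ Metric.closedBall (-1) ε) := by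
  classical
  induction s using Finset.induction_on with
  | empty => exact ⟨1, one_pos, by simp⟩
  | insert a s _ ih =>
    obtain ⟨r, hr, h1⟩ := ih
    obtain ⟨t, ht, h2⟩ := avoid2 (v a) (h a)
    refine ⟨min r t, lt_min hr ht, fun ε hε i hi => ?_⟩
    rcases Finset.mem_insert.1 hi with rfl | hi
    · exact h2 ε (lt_of_lt_of_le hε (min_le_right _ _))
    · exact h1 ε (lt_of_lt_of_le hε (min_le_left _ _)) i hi

lemma one_side {g m : ℕ} {W} (hG : Good W g m) {α : ℂ} {ε : ℝ} (hc : Ctr α ε) {k : ℂ → ℂ}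
    (hk : ∀ z ∈ Metric.closedBall α ε, DifferentiableAt ℂ k z) (zs : Fin m → ℂ) (hzs : ∀ j, XX (zs j))
    (hok : ∀ z ∈ Metric.closedBall α ε, ∀ j, okp z (zs j))
    (hint : CircleIntegrable (fun z => k z * W g (m + 1) (Fin.cons z zs)) α ε) :
    (∮ z in C(α, ε), k z * (z / (1 - z ^ 2) ^ 2) * recursionBracket W g m zs z) = ∮ z in C(α, ε), k z * W g (m + 1) (Fin.cons z zs) := by
  obtain ⟨F, hF, hL⟩ := hG
  have h0 := rep_zero hF hc (k := k) ?_ hk zs hzs hok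
  · have hV : CircleIntegrable (fun z => k z * (W g (m + 1) (Fin.cons z zs) - z / (1 - z ^ 2) ^ 2 * recursionBracket W g m zs z)) α ε := by
      apply ContinuousOn.circleIntegrable hc.pos.le
      apply ContinuousOn.mul
      · exact fun z hz => (hk z (Metric.sphere_subset_closedBall hz)).continuousAt.continuousWithinAt
      · exact (hF.contV zs hzs).mono (fun z hz => ⟨hc.XX hz, hok z (Metric.sphere_subset_closedBall hz)⟩)
    have e := circleIntegral.integral_sub hint hV
    rw [h0, sub_zero] at e
    rw [← e]
    congr 1
    funext z
    ring
  · intro b k hk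
    obtain ⟨Λ, hΛ, e⟩ := hL b
    rw [circleIntegral.integral_congr (g := fun z => k z * Λ z) hc.pos.le (fun z hz => by simp only [e z (hc.XX hz)])]
    apply circ_zero hc.pos.le
    intro z hz
    refine (hk z hz).mul (hΛ z ?_)
    rintro rfl
    have := (hc.norm hz).1
    norm_num at this

lemma finish {Nf W} (H : WHyp Nf W) {g m : ℕ} (h : 3 ≤ 2 * g + (m + 1)) (hG : Good W g m) (z₁ : ℂ) (zs : Fin m → ℂ)
    (hz₁ : XX z₁) (hzs : ∀ i, XX (zs i)) :
    ∃ ε₀ : ℝ, 0 < ε₀ ∧ ∀ ε : ℝ, 0 < ε → ε < ε₀ →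
      W g (m + 1) (Fin.cons z₁ zs) =
        (1 / (2 * Real.pi * Complex.I)) *
          ((∮ z in C(1, ε), kerP z₁ z * (z / (1 - z ^ 2) ^ 2) * recursionBracket W g m zs z) +
            (∮ z in C(-1, ε), kerM z₁ z * (z / (1 - z ^ 2) ^ 2) * recursionBracket W g m zs z)) := by
  obtain ⟨r, hr, h1⟩ := avoid2 z₁ hz₁
  obtain ⟨s, hs, h2⟩ := avoidF Finset.univ zs hzs
  obtain ⟨t, ht, h3⟩ := avoidF Finset.univ (fun i => (zs i)⁻¹) (fun i => (hzs i).inv)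
  obtain ⟨f, Ψ, hΨ, e⟩ := W_GF H h zs hzs
  refine ⟨min (1/4) (min r (min s t)), by positivity, fun ε hε hlt => ?_⟩
  rw [lt_min_iff, lt_min_iff, lt_min_iff] at hlt
  obtain ⟨l0, l1, l2, l3⟩ := hlt
  have hok : ∀ α : ℂ, (∀ i, zs i ∉ Metric.closedBall α ε) → (∀ i, (zs i)⁻¹ ∉ Metric.closedBall α ε) →
      ∀ z ∈ Metric.closedBall α ε, ∀ j, okp z (zs j) := by
    intro α a1 a2 z hz j
    refine ⟨fun q => a1 j (q ▸ hz), fun q => a2 j ?_⟩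
    rwa [← eq_inv_of_mul_eq_one_left q]
  have c1 : Ctr 1 ε := ⟨Or.inl rfl, hε, l0⟩
  have c2 : Ctr (-1) ε := ⟨Or.inr rfl, hε, l0⟩
  have hε1 : ε < 1 := by linarith
  have d1 := h1 ε l1
  have p1 := kerP_int hε hε1 d1.1 hΨ.cont
  have p2 := kerM_int hε hε1 d1.2 hΨ.cont
  have q1 : Set.EqOn (fun z => kerP z₁ z * (Ψ z / z)) (fun z => kerP z₁ z * W g (m + 1) (Fin.cons z zs)) (Metric.sphere 1 ε) :=
    fun z hz => by simp only [e z (c1.XX hz)]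
  have q2 : Set.EqOn (fun z => kerM z₁ z * (Ψ z / z)) (fun z => kerM z₁ z * W g (m + 1) (Fin.cons z zs)) (Metric.sphere (-1) ε) :=
    fun z hz => by simp only [e z (c2.XX hz)]
  have aε : |ε| = ε := abs_of_pos hε
  have i1 : CircleIntegrable (fun z => kerP z₁ z * W g (m + 1) (Fin.cons z zs)) 1 ε := by
    apply ContinuousOn.circleIntegrable hε.le
    refine ContinuousOn.congr ?_ q1.symm
    intro z hz
    exact ((kerP_cont hε1 d1.1 (Metric.sphere_subset_closedBall hz)).continuousAt.mul
      ((hΨ.cont z (c1.XX hz)).div continuousAt_id (c1.XX hz).1)).continuousWithinAt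
  have i2 : CircleIntegrable (fun z => kerM z₁ z * W g (m + 1) (Fin.cons z zs)) (-1) ε := by
    apply ContinuousOn.circleIntegrable hε.le
    refine ContinuousOn.congr ?_ q2.symm
    intro z hz
    exact ((kerM_cont hε1 d1.2 (Metric.sphere_subset_closedBall hz)).continuousAt.mul
      ((hΨ.cont z (c2.XX hz)).div continuousAt_id (c2.XX hz).1)).continuousWithinAt
  rw [one_side hG c1 (fun z hz => kerP_cont hε1 d1.1 hz) zs hzs (hok 1 (fun i => (h2 ε l2 i (Finset.mem_univ i)).1) (fun i => (h3 ε l3 i (Finset.mem_univ i)).1)) i1,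
    one_side hG c2 (fun z hz => kerM_cont hε1 d1.2 hz) zs hzs (hok (-1) (fun i => (h2 ε l2 i (Finset.mem_univ i)).2) (fun i => (h3 ε l3 i (Finset.mem_univ i)).2)) i2,
    ← circleIntegral.integral_congr hε.le q1, ← circleIntegral.integral_congr hε.le q2,
    hΨ.proj ε z₁ hε hε1 hz₁.1 d1.1 d1.2, e z₁ hz₁, ← mul_assoc, one_div, inv_mul_cancel₀ Complex.two_pi_I_ne_zero, one_mul]

lemma N1_03 (Nf : LatticeCountFamily) (b : Fin 2 → ℕ) (p : ℕ) : N1 Nf 0 b p = if Even (p + b 0 + b 1) then 1 else 0 := by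
  have h := Nf.symm 0 (Option (Fin 2)) (Fin 3) (finSuccEquiv 2).symm (Fin.cons p b)
  have e : ((Fin.cons p b : Fin 3 → ℕ) ∘ (finSuccEquiv 2).symm) = fun x => Option.elim x p b := by
    funext x
    rcases x with _ | x <;> simp
  rw [e, Nf.base_zero_three] at h
  unfold N1
  rw [h, castite]
  simp
  rfl

lemma N1_11 (Nf : LatticeCountFamily) (b : Fin 0 → ℕ) (p : ℕ) : N1 Nf 1 b p = if Even p then ((p : ℂ) ^ 2 + 20) / 48 else 0 := by
  have h := Nf.symm 1 (Option (Fin 0)) (Fin 1) (finSuccEquiv 0).symm (Fin.cons p b)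
  have e : ((Fin.cons p b : Fin 1 → ℕ) ∘ (finSuccEquiv 0).symm) = fun x => Option.elim x p b := by
    funext x
    rcases x with _ | x <;> simp
  rw [e, Nf.base_one_one] at h
  unfold N1
  rw [h, castite]
  simp

lemma cub_sum {z : ℂ} (hz : ‖z‖ < 1) : HasSum (fun r : ℕ => (r : ℂ) ^ 3 * z ^ r) (z * (1 + 4 * z + z ^ 2) / (1 - z) ^ 4) := by
  have h := pm_hasSum 3 hz
  have a1 : 1 - z ≠ 0 := by
    intro h; rw [sub_eq_zero] at h; rw [← h] at hz; simp at hz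
  have e : z * (1 + 4 * z + z ^ 2) / (1 - z) ^ 4 = (pm 3).eval (1 / (1 - z)) := by
    simp [pm]
    field_simp
    ring
  rw [e]; exact h

lemma cub_even {z : ℂ} (hz : ‖z‖ < 1) : HasSum (fun r : ℕ => (if Even r then (r : ℂ) ^ 3 else 0) * z ^ r) (8 * sfun z * (6 * sfun z + 1)) := by
  have h1 := cub_sum hz
  have h2 := cub_sum (z := -z) (by rwa [norm_neg])
  have h3 := (h1.add h2).div_const 2
  have e : (fun r : ℕ => (if Even r then (r : ℂ) ^ 3 else 0) * z ^ r) = fun r : ℕ => ((r : ℂ) ^ 3 * z ^ r + (r : ℂ) ^ 3 * (-z) ^ r) / 2 := by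
    funext r
    rcases Nat.even_or_odd r with h | h
    · rw [if_pos h, h.neg_pow]; ring
    · rw [if_neg (by simpa using h), h.neg_pow]; ring
  have e2 : 8 * sfun z * (6 * sfun z + 1) = (z * (1 + 4 * z + z ^ 2) / (1 - z) ^ 4 + -z * (1 + 4 * -z + (-z) ^ 2) / (1 - -z) ^ 4) / 2 := by
    unfold sfun
    have a1 : 1 - z ≠ 0 := by
      intro h; rw [sub_eq_zero] at h; rw [← h] at hz; simp at hz
    have a2 : 1 + z ≠ 0 := by
      intro h; rw [eq_neg_of_add_eq_zero_right h] at hz; simp at hz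
    have a3 : 1 - z ^ 2 = (1 - z) * (1 + z) := by ring
    rw [a3, sub_neg_eq_add]
    field_simp
    ring
  rw [e, e2]; exact h3

lemma gf_11 (Nf : LatticeCountFamily) (b : Fin 0 → ℕ) {z : ℂ} (hz : XX z) : gf (N1 Nf 1 b) z = sfun z * (sfun z + 1) + 5 / 12 := by
  have hE := (N1_EQ Nf (g := 1) (m := 0) (by norm_num) b).gf
  rw [← sub_eq_zero]
  refine ident1 (F := fun z => gf (N1 Nf 1 b) z - (sfun z * (sfun z + 1) + 5 / 12)) ?_ one_pos ?_ z hz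
  · intro z hz
    exact (hE.diff z hz.2.1 hz.2.2).sub (((sfun_diff hz).mul ((sfun_diff hz).add_const _)).add_const _)
  · intro z h0 h1
    rw [sub_eq_zero]
    refine (hE.sum z h1).unique ?_
    have h2 := ((cub_even h1).div_const 48).add (((evn_sum h1).mul_left (5/12)).add (hasSum_ite_eq 0 (5/12 : ℂ)))
    have e : (fun t : ℕ => (br t : ℂ) * N1 Nf 1 b t * z ^ t) = fun t : ℕ => (if Even t then (t : ℂ) ^ 3 else 0) * z ^ t / 48 +
        (5 / 12 * (evn t * z ^ t) + if t = 0 then 5/12 else 0) := by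
      funext t
      rw [N1_11]
      unfold evn br
      by_cases ht : t = 0
      · subst ht; norm_num
      · by_cases hp : Even t
        · simp only [ht, hp, if_true, if_false]; ring
        · simp only [ht, hp, if_false]; ring
    rw [e]
    have e2 : sfun z * (sfun z + 1) + 5 / 12 = 8 * sfun z * (6 * sfun z + 1) / 48 + (5 / 12 * (2 * sfun z) + 5 / 12) := by ring
    rw [e2]; exact h2

lemma gf_03 (Nf : LatticeCountFamily) (b : Fin 2 → ℕ) {z : ℂ} (hz : XX z) :
    gf (N1 Nf 0 b) z = if Even (b 0 + b 1) then 1 + 2 * sfun z else sfun z * (z + z⁻¹) := by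
  have hE := (N1_EQ Nf (g := 0) (m := 2) (by norm_num) b).gf
  by_cases hb : Even (b 0 + b 1)
  · rw [if_pos hb, ← sub_eq_zero]
    refine ident1 (F := fun z => gf (N1 Nf 0 b) z - (1 + 2 * sfun z)) ?_ one_pos ?_ z hz
    · intro z hz
      exact (hE.diff z hz.2.1 hz.2.2).sub (((sfun_diff hz).const_mul 2).const_add _)
    · intro z h0 h1
      rw [sub_eq_zero]
      refine (hE.sum z h1).unique ?_
      have h2 := (hasSum_ite_eq 0 (1 : ℂ)).add (evn_sum h1)
      have e : (fun t : ℕ => (br t : ℂ) * N1 Nf 0 b t * z ^ t) = fun t : ℕ => (if t = 0 then (1 : ℂ) else 0) + evn t * z ^ t := by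
        funext t
        have hq : Even (t + b 0 + b 1) ↔ Even t := by rw [add_assoc, Nat.even_add]; simp [hb]
        rw [N1_03, if_congr hq rfl rfl]
        unfold evn br
        by_cases ht : t = 0
        · subst ht; simp
        · by_cases hp : Even t <;> simp [ht, hp]
      rw [e]; exact h2
  · rw [if_neg hb, ← sub_eq_zero]
    refine ident1 (F := fun z => gf (N1 Nf 0 b) z - (sfun z * (z + z⁻¹))) ?_ one_pos ?_ z hz
    · intro z hz
      exact (hE.diff z hz.2.1 hz.2.2).sub ((sfun_diff hz).mul (differentiableAt_id.add (differentiableAt_inv hz.1)))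
    · intro z h0 h1
      rw [sub_eq_zero]
      refine (hE.sum z h1).unique ?_
      have h2 := (hasSum_coe_mul_geometric_of_norm_lt_one h1).sub (evn_sum h1)
      have e : (fun t : ℕ => (br t : ℂ) * N1 Nf 0 b t * z ^ t) = fun t : ℕ => (t : ℂ) * z ^ t - evn t * z ^ t := by
        funext t
        have hq : Even (t + b 0 + b 1) ↔ ¬ Even t := by rw [add_assoc, Nat.even_add]; simp [hb]
        rw [N1_03, if_congr hq rfl rfl]
        unfold evn br
        by_cases ht : t = 0
        · subst ht; simp
        · by_cases hp : Even t <;> simp [ht, hp]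
      have e2 : sfun z * (z + z⁻¹) = z / (1 - z) ^ 2 - 2 * sfun z := by
        unfold sfun
        have a0 : z ≠ 0 := norm_pos_iff.1 h0
        have a1 : 1 - z ≠ 0 := by
          intro h; rw [sub_eq_zero] at h; rw [← h] at h1; simp at h1
        have a2 : 1 + z ≠ 0 := by
          intro h; rw [eq_neg_of_add_eq_zero_right h] at h1; simp at h1
        have a3 : 1 - z ^ 2 = (1 - z) * (1 + z) := by ring
        rw [a3]
        field_simp
        ring
      rw [e, e2]; exact h2

lemma geo_id {z : ℂ} (hz : XX z) (d : ℕ) :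
    sfun z * (z ^ (d + 2) + (z ^ (d + 2))⁻¹) - sfun z * (z ^ d + (z ^ d)⁻¹) = (z ^ d)⁻¹ * ∑ i ∈ Finset.range (d + 1), (z ^ 2) ^ i := by
  have h1 := hz.sq
  have h0 := hz.1
  have hne : z ^ 2 - 1 ≠ 0 := fun h => h1 (by linear_combination -h)
  have hne' : z ^ 2 ≠ 1 := fun h => hne (by rw [h]; ring)
  rw [geom_sum_eq hne']
  unfold sfun
  have : (1 - z ^ 2) ^ 2 = (z ^ 2 - 1) ^ 2 := by ring
  rw [this]
  field_simp
  ring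

lemma laurent (d : ℕ) : ∃ Λ : ℂ → ℂ, (∀ z, z ≠ 0 → DifferentiableAt ℂ Λ z) ∧ ∀ z, XX z →
    (if Even d then 1 + 2 * sfun z else sfun z * (z + z⁻¹)) - sfun z * (z ^ d + (z ^ d)⁻¹) = Λ z := by
  induction d using Nat.twoStepInduction with
  | zero => exact ⟨fun _ => 1, fun z _ => differentiableAt_const _, fun z _ => by simp; ring⟩
  | one => exact ⟨fun _ => 0, fun z _ => differentiableAt_const _, fun z _ => by simp⟩
  | more d ih _ =>
    obtain ⟨Λ, hΛ, e⟩ := ih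
    refine ⟨fun z => Λ z - (z ^ d)⁻¹ * ∑ i ∈ Finset.range (d + 1), (z ^ 2) ^ i, ?_, ?_⟩
    · intro z hz
      exact (hΛ z hz).sub (DifferentiableAt.mul (DifferentiableAt.inv (by fun_prop) (pow_ne_zero _ hz)) (by fun_prop))
    · intro z hz
      have he : Even (d + 2) ↔ Even d := by simp [Nat.even_add]
      simp only [he, ← e z hz, ← geo_id hz d]
      ring

lemma laurent2 (b0 b1 : ℕ) : ∃ Λ : ℂ → ℂ, (∀ z, z ≠ 0 → DifferentiableAt ℂ Λ z) ∧ ∀ z, XX z →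
    (if Even (b0 + b1) then 1 + 2 * sfun z else sfun z * (z + z⁻¹)) - sfun z * ((z ^ b0)⁻¹ * z ^ b1 + (z ^ b1)⁻¹ * z ^ b0) = Λ z := by
  rcases le_total b0 b1 with hle | hle
  · obtain ⟨d, rfl⟩ := Nat.exists_eq_add_of_le hle
    obtain ⟨Λ, hΛ, e⟩ := laurent d
    refine ⟨Λ, hΛ, fun z hz => ?_⟩
    have he : Even (b0 + (b0 + d)) ↔ Even d := by rw [← add_assoc, Nat.even_add]; simp
    have h0 : z ^ b0 ≠ 0 := pow_ne_zero _ hz.1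
    have h1 : z ^ d ≠ 0 := pow_ne_zero _ hz.1
    rw [← e z hz]
    simp only [he, pow_add]
    field_simp
  · obtain ⟨d, rfl⟩ := Nat.exists_eq_add_of_le hle
    obtain ⟨Λ, hΛ, e⟩ := laurent d
    refine ⟨Λ, hΛ, fun z hz => ?_⟩
    have he : Even ((b1 + d) + b1) ↔ Even d := by rw [add_right_comm, Nat.even_add]; simp
    have h0 : z ^ b1 ≠ 0 := pow_ne_zero _ hz.1
    have h1 : z ^ d ≠ 0 := pow_ne_zero _ hz.1
    rw [← e z hz]
    simp only [he, pow_add]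
    field_simp
    ring

lemma good_03 {Nf W} (H : WHyp Nf W) : Good W 0 2 := by
  refine good_mk H (by norm_num) (rep_bracket H (g := 0) (m := 2) (ι := PUnit) (T := ∅) (c := fun _ => 0) (f := fun _ _ _ => 0)
    (fun h => absurd rfl h) (fun h => absurd rfl h)) ?_
  intro b
  obtain ⟨Λ, hΛ, e⟩ := laurent2 (b 0) (b 1)
  refine ⟨Λ, hΛ, fun z hz => ?_⟩
  rw [gf_03 Nf b hz, ← e z hz]
  congr 2
  unfold Bc
  rw [if_neg (by simp), zero_add, Finset.sum_range_one, Finset.powerset_univ]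
  have ht : ∀ I : Finset (Fin 2), (if ¬(0 = 0 ∧ I.card = 0) ∧ ¬(0 - 0 = 0 ∧ Iᶜ.card = 0) then E1 Nf 0 I z b * E2 Nf (0 - 0) Iᶜ z b else 0) =
      if I.card = 1 then (∏ j ∈ I, (z ^ b j)⁻¹) * ∏ j ∈ Iᶜ, z ^ b j else 0 := by
    intro I
    have hcard : I.card + Iᶜ.card = 2 := by simpa using Finset.card_add_card_compl I
    by_cases hI : I.card = 1
    · rw [if_pos (by omega), if_pos hI, E1, if_pos ⟨rfl, hI⟩, E2, if_pos ⟨rfl, by omega⟩]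
    · rw [if_neg (by omega), if_neg hI]
  rw [Finset.sum_congr rfl (fun I _ => ht I), sum_card_one (fun I => (∏ j ∈ I, (z ^ b j)⁻¹) * ∏ j ∈ Iᶜ, z ^ b j), Fin.sum_univ_two]
  have c0 : ({0} : Finset (Fin 2))ᶜ = {1} := by decide
  have c1 : ({1} : Finset (Fin 2))ᶜ = {0} := by decide
  rw [c0, c1]
  simp

lemma bracket_11 (W) (w : Fin 0 → ℂ) {z : ℂ} (hz : XX z) : recursionBracket W 1 0 w z = sfun z + 1 := by
  unfold recursionBracket
  rw [if_neg one_ne_zero, Finset.sum_eq_zero, add_zero]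
  · rw [extW, dif_pos ⟨rfl, rfl⟩]
    have a0 := hz.1
    have a1 := hz.sq
    have e0 : (Fin.cons z (Fin.cons z⁻¹ w) : Fin (0 + 2) → ℂ) ⟨0, by omega⟩ = z := rfl
    have e1 : (Fin.cons z (Fin.cons z⁻¹ w) : Fin (0 + 2) → ℂ) ⟨1, by omega⟩ = z⁻¹ := rfl
    rw [e0, e1, mul_inv_cancel₀ a0]
    have e2 : (z - z⁻¹) ^ 2 = (1 - z ^ 2) ^ 2 / z ^ 2 := by field_simp; ring
    rw [e2]
    unfold sfun
    field_simp
  · intro g₁ hg₁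
    apply Finset.sum_eq_zero
    intro I _
    have hI : I.card = 0 := by simp [Subsingleton.elim I ∅]
    have hI' : Iᶜ.card = 0 := by simp [Subsingleton.elim Iᶜ ∅]
    have := Finset.mem_range.1 hg₁
    rw [if_neg (by omega)]

lemma good_11 {Nf W} (H : WHyp Nf W) : Good W 1 0 := by
  have hs : ContinuousOn (fun z => sfun z + 1) {z | XX z} := fun z hz => ((sfun_diff hz).continuousAt.add continuousAt_const).continuousWithinAt
  have hR := RepI.prod (Finset.univ : Finset (Fin 0)) (fun z => sfun z + 1) hs (fun _ _ _ => 0) (fun _ _ _ => 0) (fun j => j.elim0)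
  refine good_mk H (by norm_num) (RepI.congr _ _ _ (fun z _ => sfun z + 1) _ hR (fun z _ b => by simp) (fun z w hz _ _ => by rw [bracket_11 W w hz]; simp)) ?_
  intro b
  exact ⟨fun _ => 5 / 12, fun z _ => differentiableAt_const _, fun z hz => by rw [gf_11 Nf b hz]; ring⟩

/-- **Local topological recursion governs the enumeration of lattice points in
$\overline{\mathcal M}_{g,n}$.**  If `W g n` is holomorphic on
$(\mathbb C\setminus\{0,1,-1\})^n$ and agrees on the punctured unit polydisc with
the generating series of the lattice point count $\overline N_{g,n}$, then for all
$(g,n)$ with $2g-2+n\ge 1$ the function `W g n` satisfies the local topological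
recursion on the spectral curve $x = z + 1/z$, $y = z$,
$\omega_{0,2} = dz_1dz_2/(z_1-z_2)^2 + dz_1dz_2/(z_1z_2)$, with the residues at the
branch points $z = \pm 1$ written as circle integrals against the kernel
$(1/(z_1-z) + \log z/z_1)\,z/(1-z^2)^2$ (with the appropriate branch of the
logarithm at each branch point).  Here the number of variables is `m + 1`. -/
theorem local_topological_recursion (Nfam : LatticeCountFamily)
    (W : (g n : ℕ) → (Fin n → ℂ) → ℂ)
    (hhol : ∀ g n : ℕ, 3 ≤ 2 * g + n → ∀ z : Fin n → ℂ,
      (∀ i, z i ≠ 0 ∧ z i ≠ 1 ∧ z i ≠ -1) → DifferentiableAt ℂ (W g n) z)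
    (hsum : ∀ g n : ℕ, 3 ≤ 2 * g + n → ∀ z : Fin n → ℂ,
      (∀ i, 0 < ‖z i‖ ∧ ‖z i‖ < 1) →
      HasSum
        (fun b : Fin n → ℕ => (Nfam.N g (Fin n) b : ℂ) *
          ∏ i, (br (b i) : ℂ) * z i ^ ((b i : ℤ) - 1))
        (W g n z))
    (g m : ℕ) (h : 3 ≤ 2 * g + (m + 1)) (z₁ : ℂ) (zs : Fin m → ℂ)
    (hz₁ : z₁ ≠ 0 ∧ z₁ ≠ 1 ∧ z₁ ≠ -1)
    (hzs : ∀ i, zs i ≠ 0 ∧ zs i ≠ 1 ∧ zs i ≠ -1) :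
    ∃ ε₀ : ℝ, 0 < ε₀ ∧ ∀ ε : ℝ, 0 < ε → ε < ε₀ →
      W g (m + 1) (Fin.cons z₁ zs) =
        (1 / (2 * Real.pi * Complex.I)) *
          ((∮ z in C(1, ε),
              (1 / (z₁ - z) + Complex.log z / z₁) * (z / (1 - z ^ 2) ^ 2) *
                recursionBracket W g m zs z) +
            (∮ z in C(-1, ε),
              (1 / (z₁ - z) + (Complex.log (-z) + Real.pi * Complex.I) / z₁) *
                (z / (1 - z ^ 2) ^ 2) * recursionBracket W g m zs z)) := by
  have H : WHyp Nfam W := ⟨hhol, hsum⟩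
  have hG : Good W g m := by
    by_cases h4 : 4 ≤ 2 * g + (m + 1)
    · exact good_general H h4
    · have hc : (g = 0 ∧ m = 2) ∨ (g = 1 ∧ m = 0) := by omega
      rcases hc with ⟨rfl, rfl⟩ | ⟨rfl, rfl⟩
      · exact good_03 H
      · exact good_11 H
  exact finish H h hG z₁ zs hz₁ hzs
end

section
/- Define L₁(z) = Log z and L₋₁(z) = Log(−z) + πi. For every z₁ ∈ ℂ∖{0,1,−1} and every ε with 0 < ε < 1, ε < |z₁−1| and ε < |z₁+1|: (1/(2πi))·∑_{α∈{1,−1}} ∮_{C(α,ε)} (1/(z₁−z) + L_α(z)/z₁)·(z/(1−z²)²)·( z²/(z²−1)² + 1 ) dz = (5z₁⁸ − 8z₁⁶ + 18z₁⁴ − 8z₁² + 5)/(12·z₁·(z₁²−1)⁴). -/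
open Complex in
lemma TR_aux (a c : ℂ) (ha : a ≠ 0) (ha1 : a ≠ 1) (ε : ℝ)
    (h0 : 0 < ε) (h1 : ε < 1) (hε : ε < ‖a - 1‖) :
    (∮ z in C(1, ε), (1 / (a - z) + (Complex.log z + c) / a) * (z / (1 - z ^ 2) ^ 2) *
            (z ^ 2 / (z ^ 2 - 1) ^ 2 + 1)) =
      (7 / 32 * (1 / (a - 1) ^ 2 + 1 / a) + 1 / 32 * (2 / (a - 1) ^ 3 - 1 / a)
        + 1 / 48 * (3 / (a - 1) ^ 4 + 1 / a)) * (2 * Real.pi * Complex.I) := by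
  have hb : a - 1 ≠ 0 := sub_ne_zero.2 ha1
  -- facts on the closed ball
  have hball : ∀ z ∈ Metric.closedBall (1 : ℂ) ε,
      z ∈ slitPlane ∧ z ≠ 0 ∧ z + 1 ≠ 0 ∧ a - z ≠ 0 := by
    intro z hz
    rw [Metric.mem_closedBall, dist_eq_norm] at hz
    have hre : 0 < z.re := by
      have := (abs_le.1 ((Complex.abs_re_le_norm (z - 1)).trans hz)).1
      simp at this
      linarith
    refine ⟨Or.inl hre, ?_, ?_, ?_⟩
    · rintro rfl
      simp at hre
    · intro h
      have := congrArg Complex.re h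
      simp at this
      linarith
    · intro h
      rw [sub_eq_zero] at h
      subst h
      linarith
  have hsph : ∀ z ∈ Metric.sphere (1 : ℂ) ε, z - 1 ≠ 0 := by
    intro z hz h
    rw [Metric.mem_sphere, dist_eq_norm, h] at hz
    simp at hz
    linarith
  set k0 : ℂ := 1 / (a - 1) ^ 2 + 1 / a with hk0
  set k1 : ℂ := 2 / (a - 1) ^ 3 - 1 / a with hk1
  set k2 : ℂ := 3 / (a - 1) ^ 4 + 1 / a with hk2
  set c1 : ℂ := 7 / 32 * k0 + 1 / 32 * k1 + 1 / 48 * k2 with hc1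
  let q : ℂ → ℂ := fun z => (4 * (a - 1) - 3 * (z - 1)) / ((a - 1) ^ 4 * (a - z) ^ 2) - 1 / (a * z)
  let K' : ℂ → ℂ := fun z => 1 / (a - z) ^ 2 + 1 / (a * z)
  let T : ℂ → ℂ := fun z => -(7 / 32) / (z + 1) + 1 / 32 / (z + 1) ^ 2 - 1 / 48 / (z + 1) ^ 3
  let B : ℂ → ℂ := fun z => K' z * T z + 7 / 32 * (k1 + k2 * (z - 1) + (z - 1) ^ 2 * q z)
    + 1 / 32 * (k2 + (z - 1) * q z) + 1 / 48 * q z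
  let f : ℂ → ℂ := fun z => (1 / (a - z) + (Complex.log z + c) / a) * (z / (1 - z ^ 2) ^ 2) *
            (z ^ 2 / (z ^ 2 - 1) ^ 2 + 1)
  have hBd : DifferentiableOn ℂ B (Metric.closedBall 1 ε) := by
    intro z hz
    obtain ⟨-, hz0, hz1, hza⟩ := hball z hz
    apply DifferentiableAt.differentiableWithinAt
    simp only [B, K', T, q]
    fun_prop (disch := first | assumption | simp [*])
  have hB0 : (∮ z in C(1, ε), B z) = 0 := by
    refine Complex.circleIntegral_eq_zero_of_differentiable_on_off_countable h0.le
      Set.countable_empty hBd.continuousOn ?_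
    intro z hz
    exact (hBd.mono Metric.ball_subset_closedBall).differentiableAt
      (Metric.isOpen_ball.mem_nhds hz.1)
  have hBi : CircleIntegrable B 1 ε :=
    (hBd.continuousOn.mono Metric.sphere_subset_closedBall).circleIntegrable h0.le
  have hfi : CircleIntegrable f 1 ε := by
    refine ContinuousOn.circleIntegrable h0.le ?_
    intro z hz
    obtain ⟨hzs, hz0, hz1, hza⟩ := hball z (Metric.sphere_subset_closedBall hz)
    have hs := hsph z hz
    have hu : z ^ 2 - 1 ≠ 0 := by
      rw [show z ^ 2 - 1 = (z - 1) * (z + 1) by ring]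
      exact mul_ne_zero hs hz1
    have hu' : 1 - z ^ 2 ≠ 0 := by
      rw [show 1 - z ^ 2 = -(z ^ 2 - 1) by ring]
      exact neg_ne_zero.2 hu
    apply DifferentiableWithinAt.continuousWithinAt (𝕜 := ℂ)
    apply DifferentiableAt.differentiableWithinAt
    simp only [f]
    fun_prop (disch := first | assumption | exact pow_ne_zero _ ‹_› | simp [*])
  have hsi : CircleIntegrable (fun z : ℂ => c1 * (z - 1)⁻¹) 1 ε := by
    refine ContinuousOn.circleIntegrable h0.le ?_
    intro z hz
    have hs := hsph z hz
    apply DifferentiableWithinAt.continuousWithinAt (𝕜 := ℂ)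
    fun_prop (disch := assumption)
  have hG : (∮ z in C(1, ε), (f z - (B z + c1 * (z - 1)⁻¹))) = 0 := by
    let G : ℂ → ℂ := fun z => ((a - z)⁻¹ + (Complex.log z + c) / a) *
        (-(1 / 2 * (z ^ 2 - 1)⁻¹ + 1 / 4 * (z ^ 2 - 1)⁻¹ ^ 2 + 1 / 6 * (z ^ 2 - 1)⁻¹ ^ 3))
      + (-(k0 / 96) * (z - 1)⁻¹ ^ 2 - (1 / 32 * k0 + 1 / 48 * k1) * (z - 1)⁻¹)
    refine circleIntegral.integral_eq_zero_of_hasDerivWithinAt (f := G) h0.le ?_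
    intro z hz
    obtain ⟨hzs, hz0, hz1, hza⟩ := hball z (Metric.sphere_subset_closedBall hz)
    have hs := hsph z hz
    have hu0 : z ^ 2 - 1 = (z - 1) * (z + 1) := by ring
    have hu : z ^ 2 - 1 ≠ 0 := by
      rw [hu0]
      exact mul_ne_zero hs hz1
    apply HasDerivAt.hasDerivWithinAt
    have d1 : HasDerivAt (fun z : ℂ => (z - 1)⁻¹) (-1 / (z - 1) ^ 2) z :=
      ((hasDerivAt_id z).sub_const 1).inv hs
    have d2 : HasDerivAt (fun z : ℂ => (z ^ 2 - 1)⁻¹) (-(2 * z) / (z ^ 2 - 1) ^ 2) z := by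
      have := ((hasDerivAt_pow 2 z).sub_const 1).fun_inv hu
      simpa using this
    have d3 : HasDerivAt (fun z : ℂ => (a - z)⁻¹) (1 / (a - z) ^ 2) z := by
      have := ((hasDerivAt_id z).const_sub a).fun_inv hza
      simpa using this
    have d4 : HasDerivAt (fun z : ℂ => (Complex.log z + c) / a) (z⁻¹ / a) z :=
      ((Complex.hasDerivAt_log hzs).add_const c).div_const a
    have dK := d3.fun_add d4
    have dH := (((d2.const_mul (1 / 2)).fun_add ((d2.fun_pow 2).const_mul (1 / 4))).fun_add
      ((d2.fun_pow 3).const_mul (1 / 6))).fun_neg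
    have dR := ((d1.fun_pow 2).const_mul (-(k0 / 96))).fun_sub
      (d1.const_mul (1 / 32 * k0 + 1 / 48 * k1))
    have dG := (dK.fun_mul dH).fun_add dR
    convert dG using 1
    have hKt : K' z = k0 + k1 * (z - 1) + k2 * (z - 1) ^ 2 + (z - 1) ^ 3 * q z := by
      simp only [K', q, hk0, hk1, hk2]
      field_simp
      ring
    have hHt : 1 / 2 * (z ^ 2 - 1)⁻¹ + 1 / 4 * (z ^ 2 - 1)⁻¹ ^ 2 + 1 / 6 * (z ^ 2 - 1)⁻¹ ^ 3
        = 7 / 32 * (z - 1)⁻¹ + 1 / 32 * (z - 1)⁻¹ ^ 2 + 1 / 48 * (z - 1)⁻¹ ^ 3 + T z := by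
      simp only [T, hu0]
      field_simp
      ring
    have hK2 : 1 / (a - z) ^ 2 + z⁻¹ / a = K' z := by
      simp only [K']
      field_simp
    have hBt : B z + c1 * (z - 1)⁻¹ = K' z * (7 / 32 * (z - 1)⁻¹ + 1 / 32 * (z - 1)⁻¹ ^ 2
        + 1 / 48 * (z - 1)⁻¹ ^ 3 + T z) - 1 / 48 * k0 * (z - 1)⁻¹ ^ 3
        - (1 / 32 * k0 + 1 / 48 * k1) * (z - 1)⁻¹ ^ 2 := by
      rw [mul_add (K' z) _ (T z)]
      simp only [B]
      generalize hT : K' z * T z = X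
      rw [hKt, hc1]
      generalize q z = Q
      clear_value k0 k1 k2
      field_simp
      ring
    have hft : f z = ((a - z)⁻¹ + (Complex.log z + c) / a) *
        (-(1 / 2 * (-(2 * z) / (z ^ 2 - 1) ^ 2) +
          1 / 4 * (2 * (z ^ 2 - 1)⁻¹ * (-(2 * z) / (z ^ 2 - 1) ^ 2)) +
          1 / 6 * (3 * (z ^ 2 - 1)⁻¹ ^ 2 * (-(2 * z) / (z ^ 2 - 1) ^ 2)))) := by
      simp only [f]
      rw [one_div, mul_assoc]
      congr 1
      rw [show (1 - z ^ 2) ^ 2 = (z ^ 2 - 1) ^ 2 by ring]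
      field_simp
      ring
    rw [hft, hBt, hK2, hHt]
    generalize K' z = X
    generalize T z = Y
    clear_value k0 k1 k2
    simp only [div_eq_mul_inv, ← inv_pow]
    generalize (z - 1)⁻¹ = S
    generalize (z ^ 2 - 1)⁻¹ = U
    push_cast
    ring
  have hBs : CircleIntegrable (fun z => B z + c1 * (z - 1)⁻¹) 1 ε := hBi.add hsi
  rw [circleIntegral.integral_sub hfi hBs, circleIntegral.integral_add hBi hsi, hB0,
    circleIntegral.integral_const_mul, circleIntegral.integral_sub_center_inv _ h0.ne',
    zero_add, sub_eq_zero] at hG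
  exact hG

lemma TR_neg (f : ℂ → ℂ) (ε : ℝ) :
    (∮ z in C(-1, ε), f z) = -∮ z in C(1, ε), f (-z) := by
  have h1 : ∀ θ : ℝ, circleMap (-1) ε (θ + Real.pi) = - circleMap 1 ε θ := by
    intro θ
    simp [circleMap, add_mul, Complex.exp_add]
    ring
  have h2 : ∀ θ : ℝ, circleMap 0 ε (θ + Real.pi) = - circleMap 0 ε θ := by
    intro θ
    simp [circleMap, add_mul, Complex.exp_add]
  simp only [circleIntegral, deriv_circleMap]
  have hp : Function.Periodic (fun θ : ℝ => (circleMap 0 ε θ * Complex.I) •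
      f (circleMap (-1) ε θ)) (2 * Real.pi) := by
    intro θ
    simp [periodic_circleMap _ _ θ]
  have h3 := hp.intervalIntegral_add_eq 0 Real.pi
  rw [zero_add] at h3
  rw [h3, ← intervalIntegral.integral_neg]
  have h4 := intervalIntegral.integral_comp_add_right (a := 0) (b := 2 * Real.pi)
    (fun θ : ℝ => (circleMap 0 ε θ * Complex.I) • f (circleMap (-1) ε θ)) Real.pi
  rw [zero_add, add_comm (2 * Real.pi)] at h4
  rw [← h4]
  congr 1
  ext θ
  rw [h1, h2]
  simp

/-- The `(g,n) = (1,1)` case of the local topological recursion on the spectral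
curve `x = z + 1/z`, `y = z`, `ω₀₂ = dz₁dz₂/(z₁-z₂)² + dz₁dz₂/(z₁z₂)`: the sum of
the two residues at the branch points `z = ±1`, written as circle integrals,
equals the generating function `Ω₁,₁/dz₁`.  The factor `z²/(z²-1)² + 1` is
`W₀₂(z, 1/z)` for `W₀₂(u,v) = 1/(u-v)² + 1/(uv)`. -/
theorem local_TR_11 (z₁ : ℂ) (h : z₁ ≠ 0 ∧ z₁ ≠ 1 ∧ z₁ ≠ -1) (ε : ℝ)
    (hε0 : 0 < ε) (hε1 : ε < 1) (hεa : ε < ‖z₁ - 1‖) (hεb : ε < ‖z₁ + 1‖) :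
    (1 / (2 * Real.pi * Complex.I)) *
      ((∮ z in C(1, ε),
          (1 / (z₁ - z) + Complex.log z / z₁) * (z / (1 - z ^ 2) ^ 2) *
            (z ^ 2 / (z ^ 2 - 1) ^ 2 + 1)) +
        (∮ z in C(-1, ε),
          (1 / (z₁ - z) + (Complex.log (-z) + Real.pi * Complex.I) / z₁) *
            (z / (1 - z ^ 2) ^ 2) * (z ^ 2 / (z ^ 2 - 1) ^ 2 + 1))) =
    (5 * z₁ ^ 8 - 8 * z₁ ^ 6 + 18 * z₁ ^ 4 - 8 * z₁ ^ 2 + 5) /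
      (12 * z₁ * (z₁ ^ 2 - 1) ^ 4) := by
  obtain ⟨ha, ha1, ha2⟩ := h
  have hna1 : -z₁ ≠ 1 := fun h => ha2 (by rw [← h, neg_neg])
  have e1 := TR_aux z₁ 0 ha ha1 ε hε0 hε1 hεa
  have e2 := TR_aux (-z₁) (Real.pi * Complex.I) (neg_ne_zero.2 ha) hna1 ε hε0 hε1
    (by rwa [show -z₁ - 1 = -(z₁ + 1) by ring, norm_neg])
  simp only [add_zero] at e1
  have e3 : (∮ z in C(-1, ε),
          (1 / (z₁ - z) + (Complex.log (-z) + Real.pi * Complex.I) / z₁) *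
            (z / (1 - z ^ 2) ^ 2) * (z ^ 2 / (z ^ 2 - 1) ^ 2 + 1)) =
      -∮ z in C(1, ε), (1 / (-z₁ - z) + (Complex.log z + Real.pi * Complex.I) / (-z₁)) *
        (z / (1 - z ^ 2) ^ 2) * (z ^ 2 / (z ^ 2 - 1) ^ 2 + 1) := by
    rw [TR_neg]
    congr 2
    ext z
    rw [show -z₁ - z = -(z₁ - -z) by ring, neg_neg, neg_sq, div_neg, div_neg, neg_div]
    ring
  rw [e1, e3, e2]
  have hpi : (2 * Real.pi * Complex.I : ℂ) ≠ 0 := Complex.two_pi_I_ne_zero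
  rw [← neg_mul, ← add_mul, one_div, mul_comm, mul_assoc, mul_inv_cancel₀ hpi, mul_one]
  have hb : z₁ - 1 ≠ 0 := sub_ne_zero.2 ha1
  have hb2 : z₁ + 1 ≠ 0 := fun h => ha2 (eq_neg_of_add_eq_zero_left h)
  rw [show -z₁ - 1 = -(z₁ + 1) by ring, show z₁ ^ 2 - 1 = (z₁ - 1) * (z₁ + 1) by ring]
  field_simp
  ring
end
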